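/- Let M₁, M₂ be positive integers and ℓ₁, ℓ₂ integers with 1 ≤ ℓ₁ ≤ M₁, 1 ≤ ℓ₂ ≤ M₂. For T ≥ 10 set y = T^{3/4}. Then for every ε > 0, ∫_{T/2}^T R₀(x;y)⁴ dx = (1/(32π⁴)) · C₄(ℓ₁/M₁, ℓ₂/M₂) · ∫_{T/2}^T x dx + O(T^{2−1/8+ε}), where the implied constant depends at most on M₁, M₂ and ε. -/

import Mathlib

open Real MeasureTheory Finset
open scoped Classical

noncomputable section

/-- The phase `h ℓ₂/M₂ + r ℓ₁/M₁ + 1/8` attached to a factorization pair `p = (h, r)`. -/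
def phase (M₁ M₂ ℓ₁ ℓ₂ : ℕ) (p : ℕ × ℕ) : ℝ :=
  ((p.1 : ℝ) * ℓ₂) / M₂ + ((p.2 : ℝ) * ℓ₁) / M₁ + 1/8

/-- The series `s_{4;v}` with sign pattern `(1, e₂, e₃, e₄)`. -/
def s4 (M₁ M₂ ℓ₁ ℓ₂ : ℕ) (e₂ e₃ e₄ : ℝ) : ℝ :=
  ∑' q : ℕ × ℕ × ℕ × ℕ,
    if 0 < q.1 ∧ 0 < q.2.1 ∧ 0 < q.2.2.1 ∧ 0 < q.2.2.2 ∧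
        Real.sqrt q.1 + e₂ * Real.sqrt q.2.1 + e₃ * Real.sqrt q.2.2.1
          + e₄ * Real.sqrt q.2.2.2 = 0 then
      ((q.1 : ℝ) * q.2.1 * q.2.2.1 * q.2.2.2) ^ (-(3:ℝ)/4) *
        ∑ p₁ ∈ Nat.divisorsAntidiagonal q.1, ∑ p₂ ∈ Nat.divisorsAntidiagonal q.2.1,
        ∑ p₃ ∈ Nat.divisorsAntidiagonal q.2.2.1, ∑ p₄ ∈ Nat.divisorsAntidiagonal q.2.2.2,
          Real.cos (2 * π * (phase M₁ M₂ ℓ₁ ℓ₂ p₁ + e₂ * phase M₁ M₂ ℓ₁ ℓ₂ p₂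
            + e₃ * phase M₁ M₂ ℓ₁ ℓ₂ p₃ + e₄ * phase M₁ M₂ ℓ₁ ℓ₂ p₄))
    else 0

/-- `C₄(ℓ₁/M₁, ℓ₂/M₂) = Σ_{v=1}^3 binom(3,v) s_{4;v}`. -/
def C4 (M₁ M₂ ℓ₁ ℓ₂ : ℕ) : ℝ :=
  3 * s4 M₁ M₂ ℓ₁ ℓ₂ 1 1 (-1) + 3 * s4 M₁ M₂ ℓ₁ ℓ₂ 1 (-1) (-1)
    + s4 M₁ M₂ ℓ₁ ℓ₂ (-1) (-1) (-1)

/-- `τ(n,x) = Σ_{hr=n} cos(4π√(nx) − 2π(hℓ₂/M₂ + rℓ₁/M₁ + 1/8))`. -/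
def tau (M₁ M₂ ℓ₁ ℓ₂ n : ℕ) (x : ℝ) : ℝ :=
  ∑ p ∈ Nat.divisorsAntidiagonal n,
    Real.cos (4 * π * Real.sqrt (n * x) - 2 * π * phase M₁ M₂ ℓ₁ ℓ₂ p)

/-- `R₀(x;y) = (x^{1/4}/(√2 π)) Σ_{n ≤ y} τ(n,x) n^{−3/4}`. -/
def R0 (M₁ M₂ ℓ₁ ℓ₂ : ℕ) (y x : ℝ) : ℝ :=
  x ^ ((1:ℝ)/4) / (Real.sqrt 2 * π) *
    ∑ n ∈ Finset.Icc 1 ⌊y⌋₊, tau M₁ M₂ ℓ₁ ℓ₂ n x * (n : ℝ) ^ (-(3:ℝ)/4)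

lemma sum_le_of_inj {ι κ : Type*} (s : Finset ι) (t : Finset κ) (φ : ι → κ) (f : ι → ℝ) (g : κ → ℝ)
    (hφ : ∀ i ∈ s, φ i ∈ t) (hinj : ∀ i ∈ s, ∀ j ∈ s, φ i = φ j → i = j)
    (hg : ∀ k ∈ t, 0 ≤ g k) (h : ∀ i ∈ s, f i ≤ g (φ i)) :
    ∑ i ∈ s, f i ≤ ∑ k ∈ t, g k := by
  calc ∑ i ∈ s, f i ≤ ∑ i ∈ s, g (φ i) := Finset.sum_le_sum h
    _ = ∑ k ∈ s.image φ, g k := by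
        rw [Finset.sum_image]
        intro i hi j hj hij
        exact hinj i hi j hj hij
    _ ≤ ∑ k ∈ t, g k := by
        apply Finset.sum_le_sum_of_subset_of_nonneg
        · intro k hk
          obtain ⟨i, hi, rfl⟩ := Finset.mem_image.1 hk
          exact hφ i hi
        · intro k hk _
          exact hg k hk

lemma sum_le_of_fiber {ι κ : Type*} [DecidableEq κ] (s : Finset ι) (t : Finset κ) (φ : ι → κ) (f : ι → ℝ) (g : κ → ℝ)
    (D : ℝ) (hφ : ∀ i ∈ s, φ i ∈ t) (hg : ∀ k ∈ t, 0 ≤ g k)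
    (hcard : ∀ k ∈ t, ((s.filter (fun i => φ i = k)).card : ℝ) ≤ D)
    (h : ∀ i ∈ s, f i ≤ g (φ i)) :
    ∑ i ∈ s, f i ≤ D * ∑ k ∈ t, g k := by
  calc ∑ i ∈ s, f i ≤ ∑ i ∈ s, g (φ i) := Finset.sum_le_sum h
    _ = ∑ k ∈ t, ∑ i ∈ s.filter (fun i => φ i = k), g (φ i) :=
        (Finset.sum_fiberwise_of_maps_to hφ _).symm
    _ ≤ ∑ k ∈ t, D * g k := by
        apply Finset.sum_le_sum
        intro k hk
        have : ∑ i ∈ s.filter (fun i => φ i = k), g (φ i)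
            = ((s.filter (fun i => φ i = k)).card : ℝ) * g k := by
          rw [Finset.sum_congr rfl (g := fun _ => g k)]
          · simp
          · intro i hi
            rw [(Finset.mem_filter.1 hi).2]
        rw [this]
        exact mul_le_mul_of_nonneg_right (hcard k hk) (hg k hk)
    _ = D * ∑ k ∈ t, g k := by rw [Finset.mul_sum]

lemma card_le_of_fiber {ι κ : Type*} [DecidableEq κ] (s : Finset ι) (t : Finset κ) (φ : ι → κ)
    (D : ℝ) (hφ : ∀ i ∈ s, φ i ∈ t)
    (hcard : ∀ k ∈ t, ((s.filter (fun i => φ i = k)).card : ℝ) ≤ D) :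
    (s.card : ℝ) ≤ D * t.card := by
  have := sum_le_of_fiber s t φ (fun _ => 1) (fun _ => 1) D hφ (fun _ _ => zero_le_one) hcard
    (fun _ _ => le_refl _)
  simpa using this

lemma card_le_of_inj {ι κ : Type*} (s : Finset ι) (t : Finset κ) (φ : ι → κ)
    (hφ : ∀ i ∈ s, φ i ∈ t) (hinj : ∀ i ∈ s, ∀ j ∈ s, φ i = φ j → i = j) :
    (s.card : ℝ) ≤ t.card := by
  exact_mod_cast Finset.card_le_card_of_injOn φ hφ (fun i hi j hj h => hinj i hi j hj h)

/-- Divisor bound. -/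
lemma divisor_bound (ε : ℝ) (hε : 0 < ε) :
    ∃ K : ℝ, 1 ≤ K ∧ ∀ n : ℕ, 1 ≤ n → (n.divisors.card : ℝ) ≤ K * (n : ℝ) ^ ε := by
  obtain ⟨P, hP⟩ := exists_nat_ge ((2:ℝ) ^ (1/ε))
  set c : ℝ := max 1 (1 / (ε * Real.log 2)) with hc
  have hl2 : 0 < Real.log 2 := Real.log_pos (by norm_num)
  have hc1 : 1 ≤ c := le_max_left _ _
  have hc2 : 1 / (ε * Real.log 2) ≤ c := le_max_right _ _
  refine ⟨c ^ P, one_le_pow₀ hc1, ?_⟩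
  intro n hn
  have hn0 : n ≠ 0 := by omega
  have key : ∀ p : ℕ, p.Prime → ∀ a : ℕ,
      ((a + 1 : ℕ) : ℝ) ≤ (if p < P then c else 1) * ((p:ℝ) ^ a) ^ ε := by
    intro p hp a
    have hp2 : (2:ℝ) ≤ p := by exact_mod_cast hp.two_le
    have e1 : ((p:ℝ) ^ a) ^ ε = ((p:ℝ) ^ ε) ^ a := by
      rw [← Real.rpow_natCast, ← Real.rpow_natCast, ← Real.rpow_mul (by positivity),
        ← Real.rpow_mul (by positivity), mul_comm]
    split_ifs with h
    · have h1 : ((2:ℝ) ^ a) ^ ε ≤ ((p:ℝ) ^ a) ^ ε := by gcongr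
      have h2 : 1 + a * (ε * Real.log 2) ≤ ((2:ℝ) ^ a) ^ ε := by
        rw [← Real.rpow_natCast, ← Real.rpow_mul (by norm_num), Real.rpow_def_of_pos (by norm_num)]
        have := Real.add_one_le_exp (Real.log 2 * (a * ε))
        linarith
      have h3 : 1 ≤ c * (ε * Real.log 2) := by
        rw [div_le_iff₀ (by positivity)] at hc2
        exact hc2
      push_cast
      calc (a:ℝ) + 1 ≤ a * (c * (ε * Real.log 2)) + c := by nlinarith [Nat.cast_nonneg (α := ℝ) a]
        _ = c * (1 + a * (ε * Real.log 2)) := by ring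
        _ ≤ c * ((p:ℝ) ^ a) ^ ε := by
          apply mul_le_mul_of_nonneg_left (h2.trans h1) (by linarith)
    · have hpP : (P:ℝ) ≤ p := by exact_mod_cast not_lt.1 h
      have h1 : (2:ℝ) ≤ (p:ℝ) ^ ε := by
        calc (2:ℝ) = ((2:ℝ) ^ (1/ε)) ^ ε := by
              rw [← Real.rpow_mul (by norm_num)]; field_simp; simp
          _ ≤ (p:ℝ) ^ ε := by gcongr; exact hP.trans hpP
      rw [e1, one_mul]
      calc ((a + 1 : ℕ) : ℝ) ≤ ((2 ^ a : ℕ) : ℝ) := by exact_mod_cast Nat.lt_two_pow_self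
        _ = 2 ^ a := by push_cast; rfl
        _ ≤ _ := by gcongr
  rw [Nat.card_divisors hn0]
  have hn' : (n : ℝ) ^ ε = ∏ p ∈ n.primeFactors, ((p:ℝ) ^ (n.factorization p)) ^ ε := by
    rw [Real.finsetProd_rpow]
    · congr 1
      conv_lhs => rw [← Nat.prod_factorization_pow_eq_self hn0]
      rw [Finsupp.prod]
      push_cast
      rfl
    · intros; positivity
  rw [hn']
  push_cast
  calc ∏ p ∈ n.primeFactors, ((n.factorization p : ℝ) + 1)
      ≤ ∏ p ∈ n.primeFactors, ((if p < P then c else 1) * ((p:ℝ) ^ (n.factorization p)) ^ ε) := by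
        apply Finset.prod_le_prod
        · intros; positivity
        · intro p hp
          have := key p (Nat.prime_of_mem_primeFactors hp) (n.factorization p)
          push_cast at this
          exact this
    _ = (∏ p ∈ n.primeFactors, (if p < P then c else 1)) *
          ∏ p ∈ n.primeFactors, ((p:ℝ) ^ (n.factorization p)) ^ ε := Finset.prod_mul_distrib
    _ ≤ _ := by
        apply mul_le_mul_of_nonneg_right _ (Finset.prod_nonneg (fun _ _ => by positivity))
        rw [← Finset.prod_filter, Finset.prod_const]
        apply pow_le_pow_right₀ hc1
        calc _ ≤ (Finset.range P).card := by
              apply Finset.card_le_card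
              intro p hp
              simp only [Finset.mem_filter] at hp
              simpa using hp.2
          _ = P := by simp

/-- `D` dominates divisor function and harmonic sums up to a power of `N`. -/
def Good (N : ℕ) (D : ℝ) : Prop :=
  1 ≤ D ∧ ∀ n : ℕ, n ≤ 10 ^ 6 * N ^ 10 →
    (n.divisors.card : ℝ) ≤ D ∧ ∑ i ∈ Finset.Icc 1 n, (1 / (i:ℝ)) ≤ D

lemma exists_good (ε : ℝ) (hε : 0 < ε) :
    ∃ K : ℝ, 1 ≤ K ∧ ∀ N : ℕ, 1 ≤ N → Good N (K * (N:ℝ) ^ ε) := by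
  obtain ⟨K, hK1, hK⟩ := divisor_bound (ε/10) (by positivity)
  have hX : ∃ K' : ℝ, 1 ≤ K' ∧ ∀ x : ℝ, 1 ≤ x → 1 + Real.log x ≤ K' * x ^ (ε/10) := by
    refine ⟨1 + 10/ε, by have : 0 < 10/ε := by positivity
                         linarith, ?_⟩
    intro x hx
    have h1 := Real.log_le_rpow_div (x := x) (by linarith) (ε := ε/10) (by positivity)
    have h2 : 1 ≤ x ^ (ε/10) := Real.one_le_rpow hx (by positivity)
    have h3 : x ^ (ε/10) / (ε/10) = 10/ε * x ^ (ε/10) := by field_simp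
    rw [h3] at h1
    linarith
  obtain ⟨K', hK'1, hK'⟩ := hX
  set B : ℝ := ((10:ℝ)^6) ^ (ε/10) with hB
  have hB1 : 1 ≤ B := Real.one_le_rpow (by norm_num) (by positivity)
  refine ⟨(K + K') * B, by nlinarith, ?_⟩
  intro N hN
  have hN1 : (1:ℝ) ≤ N := by exact_mod_cast hN
  have hNe : 1 ≤ (N:ℝ) ^ ε := Real.one_le_rpow hN1 hε.le
  have hXX : (((10:ℝ)^6) * (N:ℝ)^10) ^ (ε/10) = B * (N:ℝ) ^ ε := by
    rw [Real.mul_rpow (by positivity) (by positivity), ← Real.rpow_natCast (N:ℝ) 10,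
      ← Real.rpow_mul (by positivity)]
    congr 2
    push_cast
    ring
  have hBN : 1 ≤ B * (N:ℝ)^ε := by nlinarith
  refine ⟨by nlinarith, ?_⟩
  intro n hn
  rcases Nat.eq_zero_or_pos n with rfl | hn0
  · simp
    positivity
  have hnX : (n:ℝ) ≤ ((10:ℝ)^6) * (N:ℝ)^10 := by exact_mod_cast hn
  have hp : (n:ℝ) ^ (ε/10) ≤ B * (N:ℝ) ^ ε := by
    rw [← hXX]; gcongr
  have hn1 : (1:ℝ) ≤ n := by exact_mod_cast hn0
  constructor
  · calc (n.divisors.card : ℝ) ≤ K * (n:ℝ) ^ (ε/10) := hK n hn0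
      _ ≤ K * (B * (N:ℝ) ^ ε) := by gcongr
      _ ≤ _ := by nlinarith
  · have h1 := harmonic_le_one_add_log n
    have h2 : ((harmonic n : ℚ) : ℝ) = ∑ i ∈ Finset.Icc 1 n, (1 / (i:ℝ)) := by
      rw [harmonic_eq_sum_Icc]; push_cast; simp
    rw [← h2]
    calc _ ≤ _ := h1
      _ ≤ K' * (n:ℝ) ^ (ε/10) := hK' n hn1
      _ ≤ K' * (B * (N:ℝ) ^ ε) := by gcongr
      _ ≤ _ := by nlinarith

/-- `e(θ) = exp(2πiθ)`. -/
def ee (θ : ℝ) : ℂ := Complex.exp (Complex.I * ((2 * π * θ : ℝ) : ℂ))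

lemma ee_add (a b : ℝ) : ee (a + b) = ee a * ee b := by
  unfold ee
  rw [← Complex.exp_add]
  congr 1
  push_cast
  ring

lemma norm_ee (a : ℝ) : ‖ee a‖ = 1 := by
  unfold ee
  rw [mul_comm]
  exact Complex.norm_exp_ofReal_mul_I _

lemma ee_int (n : ℤ) : ee n = 1 := by
  unfold ee
  rw [Complex.exp_eq_one_iff]
  exact ⟨n, by push_cast; ring⟩

lemma ee_neg (a : ℝ) : ee (-a) = (starRingEnd ℂ) (ee a) := by
  unfold ee
  rw [← Complex.exp_conj]
  congr 1
  rw [map_mul, Complex.conj_I, Complex.conj_ofReal]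
  push_cast
  ring

lemma ee_nat_mul (n : ℕ) (a : ℝ) : ee (n * a) = ee a ^ n := by
  unfold ee
  rw [← Complex.exp_nat_mul]
  congr 1
  push_cast
  ring

/-- distance to nearest integer -/
def dst (x : ℝ) : ℝ := |x - round x|

lemma dst_nonneg (x : ℝ) : 0 ≤ dst x := abs_nonneg _

lemma norm_ee_sub_one (x : ℝ) : 4 * dst x ≤ ‖ee x - 1‖ := by
  have h1 : ee x = ee (x - round x) := by
    have : x = (x - round x) + ((round x : ℤ) : ℝ) := by ring
    conv_lhs => rw [this]
    rw [ee_add, ee_int, mul_one]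
  rw [h1]
  unfold dst
  set y := x - round x
  have hy : |y| ≤ 1/2 := abs_sub_round x
  unfold ee
  rw [Complex.norm_exp_I_mul_ofReal_sub_one]
  have e : 2 * π * y / 2 = π * y := by ring
  rw [e]
  have hpi := Real.pi_pos
  have habs : |π * y| = π * |y| := by rw [abs_mul, abs_of_pos hpi]
  have h2 := Real.mul_abs_le_abs_sin (x := π * y) (by rw [habs]; nlinarith)
  rw [habs] at h2
  have h3 : 2 / π * (π * |y|) = 2 * |y| := by field_simp
  rw [h3] at h2
  rw [norm_mul, Real.norm_eq_abs, Real.norm_eq_abs]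
  norm_num
  linarith

lemma geom_bound (L : ℕ) (x : ℝ) : ‖∑ i ∈ range L, ee x ^ i‖ * (2 * dst x) ≤ 1 := by
  have h := geom_sum_mul (ee x) L
  have h2 : ‖∑ i ∈ range L, ee x ^ i‖ * ‖ee x - 1‖ ≤ 2 := by
    rw [← norm_mul, h]
    calc ‖ee x ^ L - 1‖ ≤ ‖ee x ^ L‖ + ‖(1:ℂ)‖ := norm_sub_le _ _
      _ = 2 := by rw [norm_pow, norm_ee]; norm_num
  have h3 := norm_ee_sub_one x
  have h4 := mul_le_mul_of_nonneg_left h3 (norm_nonneg (∑ i ∈ range L, ee x ^ i))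
  linarith

lemma geom_bound2 (L : ℕ) (x : ℝ) : ‖∑ i ∈ range L, ee x ^ i‖ ≤ L := by
  calc _ ≤ ∑ i ∈ range L, ‖ee x ^ i‖ := norm_sum_le _ _
    _ = L := by simp [norm_ee]

/-- `min(M, 1/(2‖x‖))` -/
def mu (M x : ℝ) : ℝ := M / max 1 (2 * M * dst x)

lemma mu_nonneg (M x : ℝ) (hM : 0 ≤ M) : 0 ≤ mu M x := by
  unfold mu; positivity

lemma mu_le (M x : ℝ) (hM : 0 ≤ M) : mu M x ≤ M := by
  unfold mu
  apply div_le_self hM (le_max_left _ _)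

lemma mu_le2 (M x r : ℝ) (hM : 0 ≤ M) (hr : 0 < r) (h : r ≤ dst x) : mu M x ≤ 1 / (2 * r) := by
  unfold mu
  rw [div_le_div_iff₀ (by positivity) (by positivity)]
  have : 2 * M * dst x ≤ max 1 (2 * M * dst x) := le_max_right _ _
  nlinarith

lemma le_mu (M x s : ℝ) (h1 : s ≤ M) (h2 : s * (2 * dst x) ≤ 1) (hM : 0 ≤ M) : s ≤ mu M x := by
  unfold mu
  rw [le_div_iff₀ (by positivity)]
  rcases le_total 1 (2 * M * dst x) with h | h
  · rw [max_eq_right h]; nlinarith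
  · rw [max_eq_left h]; linarith

/-- differencing identity -/
lemma weyl_sq (f : ℕ → ℂ) (hf : ∀ A, ‖f A‖ = 1) (M : ℕ) :
    ‖∑ A ∈ range M, f A‖ ^ 2
      = M + 2 * (∑ A ∈ range M, ∑ B ∈ range A, f A * (starRingEnd ℂ) (f B)).re := by
  induction M with
  | zero => simp
  | succ M ih =>
    rw [Finset.sum_range_succ, Finset.sum_range_succ (fun A => ∑ B ∈ range A, f A * (starRingEnd ℂ) (f B))]
    set S := ∑ A ∈ range M, f A
    have h1 : ∑ B ∈ range M, f M * (starRingEnd ℂ) (f B) = f M * (starRingEnd ℂ) S := by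
      rw [← Finset.mul_sum, map_sum]
    rw [h1]
    have h2 : ‖S + f M‖ ^ 2 = ‖S‖ ^ 2 + ‖f M‖ ^ 2 + 2 * (f M * (starRingEnd ℂ) S).re := by
      rw [← Complex.normSq_eq_norm_sq, ← Complex.normSq_eq_norm_sq, ← Complex.normSq_eq_norm_sq,
        add_comm S, Complex.normSq_add]
      ring
    rw [h2, ih, hf]
    simp only [Complex.add_re]
    push_cast
    ring

lemma tri_reindex (g : ℕ → ℕ → ℂ) (M : ℕ) :
    ∑ A ∈ range M, ∑ B ∈ range A, g A B = ∑ d ∈ Icc 1 M, ∑ B ∈ range (M - d), g (B + d) B := by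
  rw [Finset.sum_sigma', Finset.sum_sigma']
  refine Finset.sum_bij' (fun x _ => ⟨x.1 - x.2, x.2⟩) (fun x _ => ⟨x.2 + x.1, x.2⟩) ?_ ?_ ?_ ?_ ?_
  · rintro ⟨A, B⟩ h
    simp only [Finset.mem_sigma, Finset.mem_range, Finset.mem_Icc] at h ⊢
    omega
  · rintro ⟨A, B⟩ h
    simp only [Finset.mem_sigma, Finset.mem_range, Finset.mem_Icc] at h ⊢
    omega
  · rintro ⟨A, B⟩ h
    simp only [Finset.mem_sigma, Finset.mem_range, Finset.mem_Icc] at h ⊢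
    simp only [Sigma.mk.injEq, heq_eq_eq, and_true]
    omega
  · rintro ⟨A, B⟩ h
    simp only [Finset.mem_sigma, Finset.mem_range, Finset.mem_Icc] at h ⊢
    simp only [Sigma.mk.injEq, heq_eq_eq, and_true]
    omega
  · rintro ⟨A, B⟩ h
    simp only [Finset.mem_sigma, Finset.mem_range, Finset.mem_Icc] at h ⊢
    congr 1
    omega

lemma weyl_bound (a c : ℝ) (M : ℕ) :
    ‖∑ A ∈ range M, ee (a * ((A:ℝ) + 1) ^ 2 + c)‖ ^ 2
      ≤ M + 2 * ∑ d ∈ Icc 1 M, mu M (2 * d * a) := by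
  rw [weyl_sq _ (fun _ => norm_ee _), tri_reindex]
  have : ‖∑ d ∈ Icc 1 M, ∑ B ∈ range (M - d),
      ee (a * (((B + d : ℕ):ℝ) + 1) ^ 2 + c) * (starRingEnd ℂ) (ee (a * ((B:ℝ) + 1) ^ 2 + c))‖
      ≤ ∑ d ∈ Icc 1 M, mu M (2 * d * a) := by
    refine (norm_sum_le _ _).trans (Finset.sum_le_sum ?_)
    intro d hd
    have e1 : ∀ B ∈ range (M - d),
        ee (a * (((B + d : ℕ):ℝ) + 1) ^ 2 + c) * (starRingEnd ℂ) (ee (a * ((B:ℝ) + 1) ^ 2 + c))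
        = ee (a * (2 * d + d ^ 2)) * ee (2 * d * a) ^ B := by
      intro B _
      rw [← ee_neg, ← ee_add, ← ee_nat_mul, ← ee_add]
      congr 1
      push_cast
      ring
    rw [Finset.sum_congr rfl e1, ← Finset.mul_sum, norm_mul, norm_ee, one_mul]
    apply le_mu
    · refine (geom_bound2 _ _).trans ?_
      exact_mod_cast Nat.sub_le _ _
    · exact geom_bound _ _
    · positivity
  have h2 := (Complex.re_le_norm _).trans this
  linarith

/-- Fejer counting -/
lemma fejer_count (θ : ℕ → ℝ) (M H : ℕ) (hH : 1 ≤ H) (δ : ℝ) (hδ : 0 ≤ δ) (hHδ : 7 * δ * H ≤ 1)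
    (S : Finset ℕ) (hS : S ⊆ range M) (hS2 : ∀ A ∈ S, ∃ P : ℤ, |θ A - P| ≤ δ) :
    (S.card : ℝ) * H ^ 2 / 4 ≤ 2 * H * ∑ k ∈ range H, ‖∑ A ∈ range M, ee (k * θ A)‖ := by
  have hH0 : (0:ℝ) < H := by exact_mod_cast hH
  have h1 : ∀ A ∈ S, (H:ℝ) ^ 2 / 4 ≤ ‖∑ h ∈ range H, ee (h * θ A)‖ ^ 2 := by
    intro A hA
    obtain ⟨P, hP⟩ := hS2 A hA
    have h2 : (H:ℝ) / 2 ≤ (∑ h ∈ range H, ee (h * θ A)).re := by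
      rw [Complex.re_sum]
      calc (H:ℝ)/2 = ∑ h ∈ range H, (1/2:ℝ) := by simp; ring
        _ ≤ _ := by
          apply Finset.sum_le_sum
          intro h hh
          have hh' : (h:ℝ) ≤ H := by exact_mod_cast (Finset.mem_range.1 hh).le
          have e : ee (h * θ A) = ee (h * (θ A - P)) := by
            have : h * θ A = h * (θ A - P) + (((h:ℤ) * P : ℤ) : ℝ) := by push_cast; ring
            rw [this, ee_add, ee_int, mul_one]
          rw [e]
          unfold ee
          rw [mul_comm Complex.I, Complex.exp_ofReal_mul_I_re]
          have h0 : (0:ℝ) ≤ h := by positivity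
          have hy : |2 * π * (h * (θ A - P))| ≤ 1 := by
            rw [abs_mul, abs_mul, abs_mul, abs_of_pos Real.pi_pos, abs_of_nonneg h0]
            norm_num
            have hpi : π < 3.15 := Real.pi_lt_d2
            have hz : (h:ℝ) * |θ A - P| ≤ H * δ := by gcongr
            have hz0 : 0 ≤ (h:ℝ) * |θ A - P| := by positivity
            nlinarith [Real.pi_pos]
          have hc := Real.one_sub_sq_div_two_le_cos (x := 2 * π * (h * (θ A - P)))
          have := abs_le_one_iff_mul_self_le_one.1 hy
          nlinarith
    have h3 := h2.trans (Complex.re_le_norm _)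
    nlinarith
  have h2 : (S.card : ℝ) * H ^ 2 / 4 ≤ ∑ A ∈ range M, ‖∑ h ∈ range H, ee (h * θ A)‖ ^ 2 := by
    calc (S.card : ℝ) * H ^ 2 / 4 = ∑ A ∈ S, (H:ℝ) ^ 2 / 4 := by simp; ring
      _ ≤ ∑ A ∈ S, ‖∑ h ∈ range H, ee (h * θ A)‖ ^ 2 := Finset.sum_le_sum h1
      _ ≤ _ := Finset.sum_le_sum_of_subset_of_nonneg hS (fun _ _ _ => by positivity)
  refine h2.trans ?_
  have h3 : ∀ A, (((‖∑ h ∈ range H, ee (h * θ A)‖ ^ 2 : ℝ)) : ℂ)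
      = ∑ h ∈ range H, ∑ h' ∈ range H, ee ((h:ℝ) * θ A - h' * θ A) := by
    intro A
    push_cast
    rw [← Complex.mul_conj', map_sum, Finset.sum_mul_sum]
    refine Finset.sum_congr rfl (fun h _ => Finset.sum_congr rfl (fun h' _ => ?_))
    rw [← ee_neg, ← ee_add, sub_eq_add_neg]
  set G : ℕ → ℝ := fun k => ‖∑ A ∈ range M, ee (k * θ A)‖ with hG
  have h4 : ((∑ A ∈ range M, ‖∑ h ∈ range H, ee (h * θ A)‖ ^ 2 : ℝ) : ℂ)
      = ∑ h ∈ range H, ∑ h' ∈ range H, ∑ A ∈ range M, ee ((h:ℝ) * θ A - h' * θ A) := by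
    push_cast
    have : ∀ A ∈ range M, ((‖∑ h ∈ range H, ee (h * θ A)‖:ℂ) ^ 2)
      = ∑ h ∈ range H, ∑ h' ∈ range H, ee ((h:ℝ) * θ A - h' * θ A) := by
      intro A _
      rw [← h3 A]; push_cast; rfl
    rw [Finset.sum_congr rfl this, Finset.sum_comm]
    refine Finset.sum_congr rfl (fun h _ => ?_)
    rw [Finset.sum_comm]
  have h5 : ∑ A ∈ range M, ‖∑ h ∈ range H, ee (h * θ A)‖ ^ 2
      ≤ ∑ h ∈ range H, ∑ h' ∈ range H, ‖∑ A ∈ range M, ee ((h:ℝ) * θ A - h' * θ A)‖ := by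
    have h6 : ∑ A ∈ range M, ‖∑ h ∈ range H, ee (h * θ A)‖ ^ 2
        = ‖((∑ A ∈ range M, ‖∑ h ∈ range H, ee (h * θ A)‖ ^ 2 : ℝ) : ℂ)‖ := by
      rw [Complex.norm_real, Real.norm_of_nonneg]
      exact Finset.sum_nonneg (fun _ _ => by positivity)
    rw [h6, h4]
    refine (norm_sum_le _ _).trans (Finset.sum_le_sum (fun h _ => norm_sum_le _ _))
  refine h5.trans ?_
  have hGnn : ∀ k, 0 ≤ G k := fun k => norm_nonneg _
  have h7 : ∀ h ∈ range H, ∑ h' ∈ range H, ‖∑ A ∈ range M, ee ((h:ℝ) * θ A - h' * θ A)‖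
      ≤ 2 * ∑ k ∈ range H, G k := by
    intro h hh
    refine sum_le_of_fiber (range H) (range H) (fun h' => (h - h') + (h' - h)) _ G 2 ?_
      (fun k _ => hGnn k) ?_ ?_
    · intro h' hh'
      simp only [Finset.mem_range] at *
      omega
    · intro k _
      rw [show (2:ℝ) = ((2:ℕ):ℝ) by norm_num, Nat.cast_le]
      · calc _ ≤ ({h - k, h + k} : Finset ℕ).card := by
              apply Finset.card_le_card
              intro x hx
              simp only [Finset.mem_filter, Finset.mem_insert, Finset.mem_singleton] at *
              omega
          _ ≤ 2 := Finset.card_le_two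
    · intro h' _
      simp only [hG]
      rcases le_total h' h with hle | hle
      · have e : (h - h') + (h' - h) = h - h' := by omega
        rw [e]
        apply le_of_eq
        congr 1
        refine Finset.sum_congr rfl (fun A _ => ?_)
        rw [Nat.cast_sub hle, sub_mul]
      · have e : (h - h') + (h' - h) = h' - h := by omega
        rw [e]
        apply le_of_eq
        rw [← RCLike.norm_conj, map_sum]
        congr 1
        refine Finset.sum_congr rfl (fun A _ => ?_)
        rw [Nat.cast_sub hle, ← ee_neg]
        congr 1
        ring
  calc _ ≤ ∑ h ∈ range H, 2 * ∑ k ∈ range H, G k := Finset.sum_le_sum h7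
    _ = _ := by simp; ring

lemma sum_Icc_range (f : ℕ → ℝ) (n : ℕ) : ∑ i ∈ Icc 1 n, f i = ∑ i ∈ range n, f (i + 1) := by
  induction n with
  | zero => simp
  | succ n ih => rw [Finset.sum_Icc_succ_top (by omega), ih, Finset.sum_range_succ]

lemma mu_sum (b M D : ℝ) (hb : 0 < b) (hM : 0 ≤ M) (X : ℕ) (hD0 : 0 ≤ D)
    (hD : ∑ i ∈ Icc 1 ⌊b/2⌋₊, (1/(i:ℝ)) ≤ D) :
    ∑ m ∈ Icc 1 X, mu M ((m:ℝ)/b) ≤ (X/b + 2) * (2 * M + b * D) := by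
  set J : ℤ := ⌊(X:ℝ)/b + 1/2⌋ with hJ
  set I : ℕ := ⌊b/2⌋₊ with hI
  have hJ0 : 0 ≤ J := Int.floor_nonneg.2 (by positivity)
  set t : Finset (ℤ × ℕ × Bool) := Icc 0 J ×ˢ (range (I+1) ×ˢ Finset.univ) with ht
  set G : ℤ × ℕ × Bool → ℝ := fun x => if x.2.1 = 0 then M else b / (2 * x.2.1) with hG
  set φ : ℕ → ℤ × ℕ × Bool := fun m =>
    (round ((m:ℝ)/b), ⌊|(m:ℝ) - round ((m:ℝ)/b) * b|⌋₊, decide (0 ≤ (m:ℝ) - round ((m:ℝ)/b) * b)) with hφ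
  have hdst : ∀ m : ℕ, dst ((m:ℝ)/b) = |(m:ℝ) - round ((m:ℝ)/b) * b| / b := by
    intro m
    unfold dst
    have : (m:ℝ)/b - round ((m:ℝ)/b) = ((m:ℝ) - round ((m:ℝ)/b) * b) / b := by field_simp
    rw [this, abs_div, abs_of_pos hb]
  have key : ∑ m ∈ Icc 1 X, mu M ((m:ℝ)/b) ≤ ∑ x ∈ t, G x := by
    apply sum_le_of_inj _ _ φ
    · intro m hm
      simp only [Finset.mem_Icc] at hm
      have hmX : (m:ℝ)/b ≤ X/b := by
        gcongr; exact_mod_cast hm.2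
      simp only [ht, hφ, Finset.mem_product, Finset.mem_Icc, Finset.mem_range, Finset.mem_univ, and_true]
      refine ⟨⟨?_, ?_⟩, ?_⟩
      · rw [round_eq]
        exact Int.floor_nonneg.2 (by positivity)
      · rw [round_eq]
        apply Int.floor_le_floor
        linarith
      · have h1 : |(m:ℝ) - round ((m:ℝ)/b) * b| ≤ b/2 := by
          have h2 := hdst m
          have h3 : dst ((m:ℝ)/b) ≤ 1/2 := abs_sub_round _
          rw [h2, div_le_iff₀ hb] at h3
          linarith
        have := Nat.floor_le_floor h1
        omega
    · intro m hm m' hm' h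
      simp only [hφ, Prod.mk.injEq, decide_eq_decide] at h
      obtain ⟨h1, h2, h3⟩ := h
      rw [← h1] at h2 h3
      set j := round ((m:ℝ)/b)
      set u := (m:ℝ) - j * b with hu
      set v := (m':ℝ) - j * b with hv
      have hlt : |u - v| < 1 := by
        have a1 := Nat.floor_le (abs_nonneg u)
        have a2 := Nat.lt_floor_add_one |u|
        have b1 := Nat.floor_le (abs_nonneg v)
        have b2 := Nat.lt_floor_add_one |v|
        rw [h2] at a1 a2
        rw [abs_lt]
        rcases le_or_gt 0 u with hu0 | hu0
        · rw [abs_of_nonneg hu0] at a1 a2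
          rw [abs_of_nonneg (h3.1 hu0)] at a1 a2 b1 b2
          constructor <;> linarith
        · have hv0 : v < 0 := by
            by_contra hc
            exact absurd (h3.2 (not_lt.1 hc)) (not_le.2 hu0)
          rw [abs_of_neg hu0] at a1 a2
          rw [abs_of_neg hv0] at a1 a2 b1 b2
          constructor <;> linarith
      have e : u - v = (((m:ℤ) - m' : ℤ) : ℝ) := by push_cast; ring
      rw [e] at hlt
      have : |(m:ℤ) - m'| < 1 := by exact_mod_cast hlt
      rw [Int.abs_lt_one_iff] at this
      omega
    · intro x _
      simp only [hG]
      split_ifs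
      · exact hM
      · positivity
    · intro m _
      simp only [hG, hφ]
      split_ifs with h
      · exact mu_le _ _ hM
      · have hi : (0:ℝ) < (⌊|(m:ℝ) - round ((m:ℝ)/b) * b|⌋₊ : ℕ) := by
          exact_mod_cast Nat.pos_of_ne_zero h
        refine (mu_le2 M _ ((⌊|(m:ℝ) - round ((m:ℝ)/b) * b|⌋₊ : ℕ) / b) hM (by positivity) ?_).trans ?_
        · rw [hdst]
          gcongr
          exact Nat.floor_le (abs_nonneg _)
        · apply le_of_eq
          field_simp
  refine key.trans ?_
  have h1 : ∑ x ∈ t, G x = ((J:ℝ) + 1) * (2 * (∑ i ∈ range (I+1), (if i = 0 then M else b / (2 * (i:ℝ))))) := by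
    rw [ht, Finset.sum_product]
    simp only [hG]
    rw [Finset.sum_const, Finset.sum_product]
    simp only [Finset.sum_const, Int.card_Icc, Finset.card_univ, Fintype.card_bool, nsmul_eq_mul]
    rw [← Finset.mul_sum]
    have : (((J + 1 - 0).toNat : ℕ) : ℝ) = (J:ℝ) + 1 := by
      have h0 : (((J + 1 - 0).toNat : ℕ) : ℤ) = J + 1 := by
        rw [Int.toNat_of_nonneg] <;> omega
      exact_mod_cast h0
    rw [this]
    push_cast
    ring
  have h2 : ∑ i ∈ range (I+1), (if i = 0 then M else b / (2 * (i:ℝ))) ≤ M + b / 2 * D := by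
    rw [Finset.sum_range_succ']
    simp only [if_true]
    have : ∑ i ∈ range I, (if i + 1 = 0 then M else b / (2 * ((i + 1 : ℕ):ℝ)))
        = b / 2 * ∑ i ∈ Icc 1 I, (1/(i:ℝ)) := by
      rw [sum_Icc_range, Finset.mul_sum]
      refine Finset.sum_congr rfl (fun i _ => ?_)
      rw [if_neg (by omega)]
      field_simp
    rw [this]
    have : b / 2 * ∑ i ∈ Icc 1 I, (1/(i:ℝ)) ≤ b / 2 * D := by gcongr
    linarith
  rw [h1]
  have h3 : (J:ℝ) + 1 ≤ X/b + 2 := by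
    have := Int.floor_le ((X:ℝ)/b + 1/2)
    linarith
  have h4 : (0:ℝ) ≤ (J:ℝ) + 1 := by
    have : (0:ℝ) ≤ J := by exact_mod_cast hJ0
    linarith
  have h5 : (0:ℝ) ≤ 2 * M + b * D := by positivity
  calc ((J:ℝ) + 1) * (2 * (∑ i ∈ range (I+1), (if i = 0 then M else b / (2 * (i:ℝ)))))
      ≤ ((J:ℝ) + 1) * (2 * M + b * D) := by
        apply mul_le_mul_of_nonneg_left _ h4
        linarith
    _ ≤ _ := mul_le_mul_of_nonneg_right h3 h5

def Aset (b δ : ℝ) (M : ℕ) : Finset ℕ :=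
  (Icc 1 M).filter (fun A => ∃ P : ℤ, |(A:ℝ)^2/b + b - P| ≤ δ)

def Rset (N : ℕ) (β η : ℝ) : Finset (ℕ × ℕ) :=
  ((Icc 1 N) ×ˢ (Icc 1 N)).filter (fun x => |√(x.1:ℝ) - √(x.2:ℝ) - β| ≤ η)

lemma R_key (N : ℕ) (β η : ℝ) (hβ : 0 < β) (hβN : β ≤ 2 * √N) (hη : 0 < η) (hη2 : 2 * η ≤ β)
    (m n : ℕ) (hm : m ≤ N) (hn : n ≤ N) (h : |√(m:ℝ) - √(n:ℝ) - β| ≤ η) :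
    n < m ∧ (m:ℝ) - n ≤ 3 * β * √N ∧
      |((m:ℝ)-n)^2/β^2 + β^2 - (2 * (m + n))| ≤ 20 * N * η / β := by
  have hm2 : √(m:ℝ) ≤ √N := Real.sqrt_le_sqrt (by exact_mod_cast hm)
  have hn2 : √(n:ℝ) ≤ √N := Real.sqrt_le_sqrt (by exact_mod_cast hn)
  have em : √(m:ℝ) ^ 2 = m := Real.sq_sqrt (by positivity)
  have en : √(n:ℝ) ^ 2 = n := Real.sq_sqrt (by positivity)
  have eN : √(N:ℝ) ^ 2 = N := Real.sq_sqrt (by positivity)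
  have m0 := Real.sqrt_nonneg (m:ℝ)
  have n0 := Real.sqrt_nonneg (n:ℝ)
  set x := √(m:ℝ)
  set y := √(n:ℝ)
  set z := √(N:ℝ)
  rw [abs_le] at h
  have hr1 : β/2 ≤ x - y := by linarith
  have hr2 : x - y ≤ 3/2 * β := by linarith
  have hxy : y < x := by linarith
  have hnm : (n:ℝ) < m := by rw [← em, ← en]; nlinarith
  refine ⟨by exact_mod_cast hnm, ?_, ?_⟩
  · rw [← em, ← en]
    have : x^2 - y^2 = (x - y) * (x + y) := by ring
    rw [this]
    have h2 : x + y ≤ 2 * z := by linarith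
    calc (x - y) * (x + y) ≤ (3/2 * β) * (2 * z) := by gcongr
      _ = _ := by ring
  · rw [← em, ← en, ← eN]
    have e : (x^2-y^2)^2/β^2 + β^2 - 2 * (x^2 + y^2)
        = ((x - y)^2 - β^2) * ((x + y)^2/β^2 - 1) := by
      field_simp
      ring
    rw [e, abs_mul]
    have h1 : |(x-y)^2 - β^2| ≤ 5/2 * β * η := by
      have : (x-y)^2 - β^2 = (x - y - β) * (x - y + β) := by ring
      rw [this, abs_mul, abs_of_nonneg (by linarith : 0 ≤ x - y + β)]
      calc |x - y - β| * (x - y + β) ≤ η * (5/2 * β) := by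
            gcongr
            · rw [abs_le]; exact h
            · linarith
        _ = _ := by ring
    have h2 : |(x + y)^2/β^2 - 1| ≤ 8 * z^2 / β^2 := by
      have hz : (x+y)^2 ≤ 4 * z^2 := by nlinarith
      have hb : β^2 ≤ 4 * z^2 := by nlinarith
      have a1 : (x+y)^2/β^2 ≤ 4 * z^2/β^2 := by gcongr
      have a2 : 1 ≤ 4 * z^2/β^2 := by rw [le_div_iff₀ (by positivity)]; linarith
      have a3 : 8 * z^2 / β^2 = 4 * z^2/β^2 + 4 * z^2/β^2 := by ring
      have a4 : 0 ≤ (x+y)^2/β^2 := by positivity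
      rw [abs_le]
      constructor <;> linarith
    calc _ ≤ (5/2 * β * η) * (8 * z^2 / β^2) := by gcongr
      _ = _ := by field_simp; ring

lemma R_le_A (N : ℕ) (β η : ℝ) (hβ : 0 < β) (hβN : β ≤ 2 * √N) (hη : 0 < η) (hη2 : 2 * η ≤ β) :
    ((Rset N β η).card : ℝ) ≤ (2 * (20 * N * η / β) + 1) *
      ((Aset (β^2) (20 * N * η / β) ⌊3 * β * √N⌋₊).card : ℝ) := by
  set δ := 20 * N * η / β with hδ
  have hδ0 : 0 ≤ δ := by positivity
  have key : ∀ x ∈ Rset N β η, x.2 < x.1 ∧ (x.1:ℝ) - x.2 ≤ 3 * β * √N ∧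
      |((x.1:ℝ)-x.2)^2/β^2 + β^2 - (2 * (x.1 + x.2))| ≤ δ := by
    intro x hx
    simp only [Rset, Finset.mem_filter, Finset.mem_product, Finset.mem_Icc] at hx
    exact R_key N β η hβ hβN hη hη2 x.1 x.2 hx.1.1.2 hx.1.2.2 hx.2
  apply card_le_of_fiber _ _ (fun x => x.1 - x.2)
  · intro x hx
    obtain ⟨h1, h2, h3⟩ := key x hx
    simp only [Aset, Finset.mem_filter, Finset.mem_Icc]
    refine ⟨⟨by omega, ?_⟩, 2 * (x.1 + x.2), ?_⟩
    · apply Nat.le_floor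
      rw [Nat.cast_sub h1.le]
      exact h2
    · rw [Nat.cast_sub h1.le]
      push_cast
      exact h3
  · intro A _
    set θ : ℝ := (A:ℝ)^2/β^2 + β^2 with hθ
    refine le_trans (card_le_of_inj _ (Icc ⌈θ - δ⌉ ⌊θ + δ⌋) (fun x => 2 * ((x.1:ℤ) + x.2)) ?_ ?_) ?_
    · · intro x hx
        simp only [Finset.mem_filter] at hx
        obtain ⟨h1, h2, h3⟩ := key x hx.1
        have : (A:ℝ) = (x.1:ℝ) - x.2 := by rw [← hx.2, Nat.cast_sub h1.le]
        rw [← this, abs_le] at h3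
        rw [Finset.mem_Icc, Int.ceil_le, Int.le_floor]
        push_cast
        constructor <;> linarith [h3.1, h3.2]
    · · intro x hx y hy hxy
        simp only [Finset.mem_filter] at hx hy
        have a1 := (key x hx.1).1
        have a2 := (key y hy.1).1
        have a3 := hx.2
        have a4 := hy.2
        ext <;> omega
    rw [Int.card_Icc]
    have h2 : ((⌊θ + δ⌋ + 1 - ⌈θ - δ⌉ : ℤ) : ℝ) ≤ 2 * δ + 1 := by
      have a1 := Int.floor_le (θ + δ)
      have a2 := Int.le_ceil (θ - δ)
      push_cast
      linarith
    rcases le_total 0 (⌊θ + δ⌋ + 1 - ⌈θ - δ⌉) with h | h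
    · have : (((⌊θ + δ⌋ + 1 - ⌈θ - δ⌉).toNat : ℕ) : ℤ) = ⌊θ + δ⌋ + 1 - ⌈θ - δ⌉ := Int.toNat_of_nonneg h
      have h3 : (((⌊θ + δ⌋ + 1 - ⌈θ - δ⌉).toNat : ℕ) : ℝ) = ((⌊θ + δ⌋ + 1 - ⌈θ - δ⌉ : ℤ) : ℝ) := by
        exact_mod_cast this
      rw [h3]
      exact h2
    · rw [Int.toNat_of_nonpos h]
      simp
      linarith

lemma weyl_arith (H N M b D : ℝ) (hH : 1 ≤ H) (hN : 1 ≤ N) (hM : 0 ≤ M) (hb : 0 < b) (hD : 1 ≤ D)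
    (hM6 : M ≤ 6 * N) (hMb : M ^ 2 ≤ 9 * b * N) (hbN : b ≤ 4 * N) :
    ((2 * H * M)/b + 2) * (2 * M + b * D) ≤ 80 * H * N * D := by
  have hHN : 0 < H * N := by positivity
  have hHND : H * N ≤ H * N * D := le_mul_of_one_le_right hHN.le hD
  have hN2 : N ≤ H * N := le_mul_of_one_le_left (by positivity) hH
  have hND : N * D ≤ H * N * D := mul_le_mul_of_nonneg_right hN2 (by positivity)
  have e1 : (2 * H * M)/b * (2 * M) ≤ 36 * (H * N) := by
    rw [div_mul_eq_mul_div, div_le_iff₀ hb]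
    calc 2 * H * M * (2 * M) = 4 * H * M ^ 2 := by ring
      _ ≤ 4 * H * (9 * b * N) := by gcongr
      _ = _ := by ring
  have e2 : (2 * H * M)/b * (b * D) = 2 * H * M * D := by field_simp
  have e3 : 2 * H * M * D ≤ 2 * H * (6 * N) * D := by gcongr
  have e6 : 2 * b * D ≤ 2 * (4 * N) * D := by gcongr
  have : ((2 * H * M)/b + 2) * (2 * M + b * D)
      = (2 * H * M)/b * (2 * M) + (2 * H * M)/b * (b * D) + 4 * M + 2 * b * D := by ring
  rw [this, e2]
  linarith

set_option maxHeartbeats 1000000 in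
lemma Aset_weyl (N : ℕ) (D : ℝ) (hN : 1 ≤ N) (hG : Good N D) (β δ : ℝ) (hβ : 0 < β)
    (hβN : β ≤ 2 * √N) (hδ : 0 < δ) (h7 : 7 * δ ≤ 1) (hδN : 1 ≤ δ * N ^ 2) :
    ((Aset (β^2) δ ⌊3 * β * √N⌋₊).card : ℝ) ≤ 112 * δ * (3 * β * √N) + 104 * D * √N := by
  obtain ⟨hD1, hG⟩ := hG
  have hN1 : (1:ℝ) ≤ N := by exact_mod_cast hN
  have eN : √(N:ℝ) ^ 2 = N := Real.sq_sqrt (by positivity)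
  have hz1 : 1 ≤ √(N:ℝ) := by rw [Real.one_le_sqrt]; exact hN1
  set z := √(N:ℝ) with hz
  set M := ⌊3 * β * z⌋₊ with hM
  set H := ⌊1/(7*δ)⌋₊ with hH
  set b := β^2 with hb
  have hb0 : 0 < b := by positivity
  have hbN : b ≤ 4 * N := by rw [hb, ← eN]; nlinarith
  have hM3 : (M:ℝ) ≤ 3 * β * z := Nat.floor_le (by positivity)
  have hM6 : (M:ℝ) ≤ 6 * N := by rw [← eN]; nlinarith
  have hMb : (M:ℝ)^2 ≤ 9 * b * N := by
    calc (M:ℝ)^2 ≤ (3 * β * z)^2 := by gcongr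
      _ = 9 * b * N := by rw [← eN, hb]; ring
  have h1le : 1 ≤ 1/(7*δ) := by rw [le_div_iff₀ (by positivity)]; linarith
  have hH1 : 1 ≤ H := Nat.le_floor (by simpa using h1le)
  have hH1' : (1:ℝ) ≤ H := by exact_mod_cast hH1
  have hHle : (H:ℝ) ≤ 1/(7*δ) := Nat.floor_le (by positivity)
  have hHδ : 7 * δ * H ≤ 1 := by
    rw [le_div_iff₀ (by positivity)] at hHle; linarith
  have hHge : 1 ≤ 14 * δ * H := by
    have := Nat.lt_floor_add_one (1/(7*δ))
    rw [← hH] at this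
    rw [div_lt_iff₀ (by positivity)] at this
    nlinarith
  have hHN : (H:ℝ) ≤ N^2 := by
    refine hHle.trans ?_
    rw [div_le_iff₀ (by positivity)]
    nlinarith
  set θ : ℕ → ℝ := fun A => ((A:ℝ)+1)^2/b + b with hθ
  set S := (range M).filter (fun A => ∃ P : ℤ, |θ A - P| ≤ δ) with hS
  have hAS : ((Aset b δ M).card : ℝ) ≤ S.card := by
    apply card_le_of_inj _ _ (fun A => A - 1)
    · intro A hA
      simp only [Aset, Finset.mem_filter, Finset.mem_Icc] at hA
      simp only [hS, Finset.mem_filter, Finset.mem_range]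
      refine ⟨by omega, ?_⟩
      obtain ⟨P, hP⟩ := hA.2
      refine ⟨P, ?_⟩
      simp only [hθ]
      rw [Nat.cast_sub hA.1.1]
      push_cast
      rw [sub_add_cancel]
      exact hP
    · intro A hA B hB hAB
      simp only [Aset, Finset.mem_filter, Finset.mem_Icc] at hA hB
      omega
  have hF := fejer_count θ M H hH1 δ hδ.le hHδ S (Finset.filter_subset _ _)
    (fun A hA => (Finset.mem_filter.1 hA).2)
  set G : ℕ → ℝ := fun k => ‖∑ A ∈ range M, ee (k * θ A)‖ with hGdef
  have hGnn : ∀ k, 0 ≤ G k := fun k => norm_nonneg _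
  have hGM : ∀ k, G k ≤ M := by
    intro k
    calc G k ≤ ∑ A ∈ range M, ‖ee (k * θ A)‖ := norm_sum_le _ _
      _ = M := by simp [norm_ee]
  have hsplit : ∑ k ∈ range H, G k ≤ M + ∑ k ∈ Icc 1 H, G k := by
    calc ∑ k ∈ range H, G k ≤ ∑ k ∈ range (H+1), G k := by
          apply Finset.sum_le_sum_of_subset_of_nonneg
          · intro x hx; simp at *; omega
          · intro k _ _; exact hGnn k
      _ = ∑ k ∈ Icc 1 H, G k + G 0 := by rw [Finset.sum_range_succ', sum_Icc_range]
      _ ≤ _ := by linarith [hGM 0]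
  have hG2 : ∀ k ∈ Icc 1 H, G k ^ 2 ≤ M + 2 * ∑ d ∈ Icc 1 M, mu M (((2 * k * d : ℕ):ℝ)/b) := by
    intro k _
    have := weyl_bound (k/b) (k*b) M
    have e : ∀ A : ℕ, (k:ℝ)/b * ((A:ℝ)+1)^2 + k * b = k * θ A := by
      intro A; simp only [hθ]; ring
    simp only [e] at this
    refine this.trans ?_
    apply le_of_eq
    congr 2
    refine Finset.sum_congr rfl (fun d _ => ?_)
    congr 1
    push_cast
    ring
  set X := 2 * H * M with hX
  have hXN : X ≤ 10^6 * N^10 := by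
    have : (X:ℝ) ≤ 10^6 * (N:ℝ)^10 := by
      rw [hX]
      push_cast
      have h3 : (N:ℝ)^3 ≤ N^10 := pow_le_pow_right₀ hN1 (by norm_num)
      calc 2 * (H:ℝ) * M ≤ 2 * N^2 * (6 * N) := by gcongr
        _ = 12 * N^3 := by ring
        _ ≤ _ := by nlinarith [pow_pos (lt_of_lt_of_le one_pos hN1) 3]
    exact_mod_cast this
  have hdbl : ∑ k ∈ Icc 1 H, ∑ d ∈ Icc 1 M, mu M (((2 * k * d : ℕ):ℝ)/b)
      ≤ D * ∑ m ∈ Icc 1 X, mu M ((m:ℝ)/b) := by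
    rw [← Finset.sum_product']
    apply sum_le_of_fiber _ _ (fun x => 2 * x.1 * x.2)
    · intro x hx
      simp only [Finset.mem_product, Finset.mem_Icc] at *
      refine ⟨?_, ?_⟩
      · have : 0 < 2 * x.1 * x.2 := by
          have := hx.1.1; have := hx.2.1; positivity
        omega
      · rw [hX]
        apply Nat.mul_le_mul (by omega) hx.2.2
    · intro m _
      exact mu_nonneg _ _ (by positivity)
    · intro m hm
      simp only [Finset.mem_Icc] at hm
      refine le_trans (card_le_of_inj _ (m.divisors) (fun x => x.1) ?_ ?_) (hG m (hm.2.trans hXN)).1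
      · intro x hx
        simp only [Finset.mem_filter, Finset.mem_product, Finset.mem_Icc, Nat.mem_divisors] at *
        exact ⟨⟨2 * x.2, by rw [← hx.2]; ring⟩, by omega⟩
      · intro x hx y hy hxy
        simp only [Finset.mem_filter, Finset.mem_product, Finset.mem_Icc] at *
        have h1 : 2 * x.1 * x.2 = 2 * x.1 * y.2 := by rw [hx.2, hxy, hy.2]
        have h2 : x.2 = y.2 := Nat.eq_of_mul_eq_mul_left (by omega) h1
        ext
        · exact hxy
        · exact h2
    · intro x _
      exact le_refl _
  have hfl : ⌊b/2⌋₊ ≤ 10^6 * N^10 := by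
    have h3 : (N:ℝ)^1 ≤ N^10 := pow_le_pow_right₀ hN1 (by norm_num)
    have : ((⌊b/2⌋₊ : ℕ):ℝ) ≤ 10^6 * (N:ℝ)^10 := (Nat.floor_le (by positivity)).trans (by nlinarith)
    exact_mod_cast this
  have hms := mu_sum b M D hb0 (by positivity) X (by linarith) (hG _ hfl).2
  have hbig : ((X:ℝ)/b + 2) * (2 * M + b * D) ≤ 80 * H * N * D := by
    rw [hX]
    push_cast
    exact weyl_arith H N M b D hH1' hN1 (by positivity) hb0 hD1 hM6 hMb hbN
  have hHND : 0 ≤ H * N * D := by positivity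
  have hsum2 : ∑ k ∈ Icc 1 H, G k ^ 2 ≤ 169 * H * N * D^2 := by
    calc ∑ k ∈ Icc 1 H, G k ^ 2
        ≤ ∑ k ∈ Icc 1 H, ((M:ℝ) + 2 * ∑ d ∈ Icc 1 M, mu M (((2 * k * d : ℕ):ℝ)/b)) :=
          Finset.sum_le_sum hG2
      _ = H * M + 2 * ∑ k ∈ Icc 1 H, ∑ d ∈ Icc 1 M, mu M (((2 * k * d : ℕ):ℝ)/b) := by
          rw [Finset.sum_add_distrib, ← Finset.mul_sum]; simp
      _ ≤ H * (6 * N) + 2 * (D * (80 * H * N * D)) := by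
          gcongr
          exact hdbl.trans (mul_le_mul_of_nonneg_left (hms.trans hbig) (by linarith))
      _ ≤ _ := by
          have : (H:ℝ) * N ≤ H * N * D^2 := by
            have : 1 ≤ D^2 := by nlinarith
            nlinarith [mul_pos (lt_of_lt_of_le one_pos hH1') (lt_of_lt_of_le one_pos hN1)]
          nlinarith
  have hsum1 : ∑ k ∈ Icc 1 H, G k ≤ 13 * H * D * z := by
    apply le_of_sq_le_sq _ (by positivity)
    have := sq_sum_le_card_mul_sum_sq (s := Icc 1 H) (f := G)
    simp only [Nat.card_Icc, Nat.add_sub_cancel] at this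
    calc _ ≤ _ := this
      _ ≤ (H:ℝ) * (169 * H * N * D^2) := by gcongr
      _ = _ := by rw [← eN]; ring
  refine hAS.trans ?_
  have hfin : (S.card:ℝ) * H^2/4 ≤ 2 * H * (M + 13 * H * D * z) := by
    refine hF.trans ?_
    gcongr
    exact hsplit.trans (by linarith)
  have hfin2 : (S.card:ℝ) * H ≤ 8 * M + 104 * H * D * z := by
    have : 0 < (H:ℝ) := by linarith
    have h9 : (H:ℝ) * ((S.card:ℝ) * H) ≤ H * (8 * M + 104 * H * D * z) := by linarith
    exact le_of_mul_le_mul_left h9 this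
  have hfin3 : 8 * (M:ℝ) ≤ 112 * δ * (3 * β * z) * H := by
    calc 8 * (M:ℝ) ≤ 8 * (3 * β * z) * (14 * δ * H) := by
          have : 8 * (M:ℝ) ≤ 8 * (3 * β * z) := by linarith
          have h0 : 0 ≤ 8 * (3 * β * z) := by positivity
          nlinarith
      _ = _ := by ring
  have : (S.card:ℝ) * H ≤ (112 * δ * (3 * β * z) + 104 * D * z) * H := by linarith
  exact le_of_mul_le_mul_right this (by linarith)

/-- Lemma A': counting pairs for large η. -/
lemma R_boundA (N : ℕ) (D : ℝ) (hN : 1 ≤ N) (hG : Good N D) (β η : ℝ) (hβ : 1 ≤ 2 * √N * β)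
    (hβN : β ≤ 2 * √N) (hη : 1 ≤ η * N^2) (hη2 : 4 * √N * η ≤ 1) :
    ((Rset N β η).card : ℝ) ≤ 20000 * (N * √N * η + D * √N) := by
  have hN1 : (1:ℝ) ≤ N := by exact_mod_cast hN
  have hD1 := hG.1
  have eN : √(N:ℝ) ^ 2 = N := Real.sq_sqrt (by positivity)
  have hz1 : 1 ≤ √(N:ℝ) := by rw [Real.one_le_sqrt]; exact hN1
  have hη0 : 0 < η := by
    by_contra hc
    nlinarith [pow_pos (lt_of_lt_of_le one_pos hN1) 2]
  have hβ0 : 0 < β := by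
    by_contra hc
    nlinarith
  have h2 : 2 * η ≤ β := by
    have : 2 * √N * (2 * η) ≤ 2 * √N * β := by linarith
    exact le_of_mul_le_mul_left this (by positivity)
  have h0 := R_le_A N β η hβ0 hβN hη0 h2
  set z := √(N:ℝ) with hz
  set δ := 20 * N * η / β with hδ
  have hδ0 : 0 < δ := by positivity
  have hδβ : δ * β = 20 * N * η := by rw [hδ]; field_simp
  have hδz : δ * (3 * β * z) = 60 * (N * z * η) := by
    calc δ * (3 * β * z) = 3 * z * (δ * β) := by ring
      _ = _ := by rw [hδβ]; ring
  rcases le_total (7 * δ) 1 with h7 | h7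
  · have hδN : 1 ≤ δ * N^2 := by
      have : β ≤ δ * N^2 * β := by
        calc β ≤ 2 * z := hβN
          _ ≤ 20 * N := by rw [← eN]; nlinarith
          _ ≤ 20 * N * (η * N^2) := by nlinarith
          _ = (δ * β) * N^2 := by rw [hδβ]; ring
          _ = _ := by ring
      nlinarith
    have h1 := Aset_weyl N D hN hG β δ hβ0 hβN hδ0 h7 hδN
    rw [← hz] at h1
    have h3 : 112 * δ * (3 * β * z) = 112 * 60 * (N * z * η) := by
      rw [mul_assoc, hδz]; ring
    rw [h3] at h1
    have h4 : 2 * δ + 1 ≤ 2 := by linarith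
    have h5 : 0 ≤ N * z * η := by positivity
    have h6 : 0 ≤ D * z := by positivity
    calc _ ≤ _ := h0
      _ ≤ 2 * (112 * 60 * (N * z * η) + 104 * D * z) := by gcongr
      _ ≤ _ := by nlinarith
  · have h1 : ((Aset (β^2) δ ⌊3 * β * z⌋₊).card : ℝ) ≤ 3 * β * z := by
      refine le_trans ?_ (Nat.floor_le (by positivity : 0 ≤ 3 * β * z))
      have : (Aset (β^2) δ ⌊3 * β * z⌋₊).card ≤ ⌊3 * β * z⌋₊ := by
        refine (Finset.card_filter_le _ _).trans ?_
        simp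
      exact_mod_cast this
    have h5 : 0 ≤ N * z * η := by positivity
    have h6 : 0 ≤ D * z := by positivity
    calc _ ≤ _ := h0
      _ ≤ (9 * δ) * (3 * β * z) := by gcongr; linarith
      _ = 9 * (60 * (N * z * η)) := by rw [← hδz]; ring
      _ ≤ _ := by nlinarith

lemma dst_le (x : ℝ) (n : ℤ) : dst x ≤ |x - n| := round_le x n

lemma P_count (N a : ℕ) (b ε₁ : ℝ) (ha : 1 ≤ a)
    (hsep : ∀ p : ℕ, 1 ≤ p → p < a → 2 * ε₁ < dst (p * b)) :
    (((Icc 1 N).filter (fun p : ℕ => ∃ g : ℤ, |p * b - g| ≤ ε₁)).card : ℝ) ≤ (N:ℝ)/a + 1 := by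
  have ha' : (0:ℝ) < a := by exact_mod_cast ha
  have h := card_le_of_inj ((Icc 1 N).filter (fun p : ℕ => ∃ g : ℤ, |p * b - g| ≤ ε₁)) (range (N/a + 1))
    (fun p => p / a) ?_ ?_
  · refine h.trans ?_
    rw [Finset.card_range]
    push_cast
    gcongr
    exact Nat.cast_div_le
  · intro p hp
    simp only [Finset.mem_filter, Finset.mem_Icc, Finset.mem_range] at *
    have := Nat.div_le_div_right (c := a) hp.1.2
    omega
  · have main : ∀ p q : ℕ, p < q → p / a = q / a → (∃ g : ℤ, |p * b - g| ≤ ε₁) →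
        (∃ g : ℤ, |q * b - g| ≤ ε₁) → False := by
      rintro p q hpq hdiv ⟨g, hg⟩ ⟨g', hg'⟩
      have h1 : q - p < a := by
        have e1 := Nat.div_add_mod p a
        have e2 := Nat.div_add_mod q a
        have e3 := Nat.mod_lt q (show 0 < a by omega)
        rw [hdiv] at e1
        omega
      have h2 := hsep (q - p) (by omega) h1
      have h3 := dst_le (((q - p : ℕ):ℝ) * b) (g' - g)
      rw [Nat.cast_sub hpq.le] at h2 h3
      have h4 : ((q:ℝ) - p) * b - ((g' - g : ℤ):ℝ) = (q * b - g') - (p * b - g) := by push_cast; ring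
      rw [h4] at h3
      have h5 := abs_sub (q * b - (g':ℝ)) (p * b - g)
      linarith
    intro p hp q hq hpq
    simp only [Finset.mem_filter, Finset.mem_Icc] at *
    rcases lt_trichotomy p q with h | h | h
    · exact (main p q h hpq hp.2 hq.2).elim
    · exact h
    · exact (main q p h hpq.symm hq.2 hp.2).elim

lemma card_sq_le (s : Finset ℕ) :
    (s.card : ℝ)^2 ≤ 1 + 4 * (((s ×ˢ s).filter (fun x => x.2 < x.1)).card : ℝ) := by
  set t := (s ×ˢ s).filter (fun x => x.2 < x.1) with ht
  have h1 : (s ×ˢ s).card ≤ s.card + (t.card + t.card) := by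
    have hsub : s ×ˢ s ⊆ (s.image (fun x => (x, x))) ∪ (t ∪ t.image Prod.swap) := by
      intro x hx
      have hx' := hx
      rw [Finset.mem_product] at hx'
      simp only [Finset.mem_union, Finset.mem_image, ht, Finset.mem_filter]
      rcases lt_trichotomy x.1 x.2 with h | h | h
      · right; right
        exact ⟨x.swap, ⟨by rw [Finset.mem_product]; exact ⟨hx'.2, hx'.1⟩, h⟩, Prod.swap_swap x⟩
      · left
        exact ⟨x.1, hx'.1, by ext <;> simp [h]⟩
      · right; left
        exact ⟨hx, h⟩
    refine (Finset.card_le_card hsub).trans ((Finset.card_union_le _ _).trans ?_)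
    have := Finset.card_union_le t (t.image Prod.swap)
    have h3 : (t.image Prod.swap).card ≤ t.card := Finset.card_image_le
    have h4 : (s.image (fun x => (x, x))).card ≤ s.card := Finset.card_image_le
    omega
  rw [Finset.card_product] at h1
  have h2 : (s.card:ℝ) * s.card ≤ s.card + (t.card + t.card) := by exact_mod_cast h1
  nlinarith [sq_nonneg ((s.card:ℝ) - 1)]

lemma pair_fiber (s : Finset ℕ) (g : ℕ) (hg : 1 ≤ g) (D : ℝ) (hD : (g.divisors.card:ℝ) ≤ D) :
    ((((s ×ˢ s).filter (fun x => x.2 < x.1)).filter (fun x => x.1^2 - x.2^2 = g)).card : ℝ) ≤ D := by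
  refine le_trans (card_le_of_inj _ g.divisors (fun x => x.1 - x.2) ?_ ?_) hD
  · intro x hx
    simp only [Finset.mem_filter, Nat.mem_divisors] at *
    refine ⟨⟨x.1 + x.2, ?_⟩, by omega⟩
    rw [← hx.2, Nat.sq_sub_sq]
    ring
  · intro x hx y hy hxy
    simp only [Finset.mem_filter] at *
    have h1 : (x.1 + x.2) * (x.1 - x.2) = (y.1 + y.2) * (x.1 - x.2) := by
      rw [← Nat.sq_sub_sq, hx.2]
      conv_rhs => rw [hxy]
      rw [← Nat.sq_sub_sq, hy.2]
    have h2 := Nat.eq_of_mul_eq_mul_right (by omega) h1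
    ext <;> omega

set_option maxHeartbeats 1000000 in
/-- Lemma B': counting pairs for small η. -/
lemma R_boundB (N a : ℕ) (D : ℝ) (hN : 1 ≤ N) (ha : 1 ≤ a) (hG : Good N D) (β η : ℝ)
    (hβ : 1 ≤ 2 * √N * β) (hβN : β ≤ 2 * √N) (hη0 : 0 < η) (hη : η * N^2 ≤ 1) (hη2 : 4 * √N * η ≤ 1)
    (hsep : ∀ p : ℕ, 1 ≤ p → p < a → 2 * (80 * N * √N * η) < dst (p * β^2)) :
    ((Rset N β η).card : ℝ)^2 ≤ 4 * 10^8 * (D * (1 + (N:ℝ)/a)) := by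
  have hN1 : (1:ℝ) ≤ N := by exact_mod_cast hN
  obtain ⟨hD1, hG⟩ := hG
  have eN : √(N:ℝ) ^ 2 = N := Real.sq_sqrt (by positivity)
  have hz1 : 1 ≤ √(N:ℝ) := by rw [Real.one_le_sqrt]; exact hN1
  have hβ0 : 0 < β := by
    by_contra hc
    nlinarith
  have h2 : 2 * η ≤ β := by
    have : 2 * √N * (2 * η) ≤ 2 * √N * β := by linarith
    exact le_of_mul_le_mul_left this (by positivity)
  have h0 := R_le_A N β η hβ0 hβN hη0 h2
  have ha' : (0:ℝ) < a := by exact_mod_cast ha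
  set z := √(N:ℝ) with hz
  set δ := 20 * N * η / β with hδ
  set b := β^2 with hb
  have hb0 : 0 < b := by positivity
  have hbN : b ≤ 4 * N := by rw [hb, ← eN]; nlinarith
  set ε₁ := 80 * N * z * η with hε₁
  have hδ0 : 0 < δ := by positivity
  have hδβ : δ * β = 20 * N * η := by rw [hδ]; field_simp
  have hzN : z ≤ N := by rw [← eN]; nlinarith
  have hNzη : N * z * η ≤ 1 := by
    calc N * z * η ≤ N * N * η := by gcongr
      _ = η * N^2 := by ring
      _ ≤ 1 := hη
  have hε80 : ε₁ ≤ 80 := by rw [hε₁]; linarith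
  have hε0 : 0 < ε₁ := by positivity
  have hδ40 : δ ≤ 40 := by
    rw [hδ, div_le_iff₀ hβ0]
    have : N * η * 1 ≤ N * η * (2 * z * β) := by gcongr
    have h3 : N * z * η * β ≤ 1 * β := by gcongr
    linarith
  have hδb : 2 * δ * b ≤ ε₁ := by
    calc 2 * δ * b = 2 * (δ * β) * β := by rw [hb]; ring
      _ = 40 * N * η * β := by rw [hδβ]; ring
      _ ≤ 40 * N * η * (2 * z) := by gcongr
      _ = ε₁ := by rw [hε₁]; ring
  set M := ⌊3 * β * z⌋₊ with hM
  have hM3 : (M:ℝ) ≤ 3 * β * z := Nat.floor_le (by positivity)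
  have hMb : (M:ℝ)^2 ≤ 9 * b * N := by
    calc (M:ℝ)^2 ≤ (3 * β * z)^2 := by gcongr
      _ = 9 * b * N := by rw [← eN, hb]; ring
  set s := Aset b δ M with hs
  set Ps := (Icc 1 (89 * N)).filter (fun p : ℕ => ∃ g : ℤ, |p * b - g| ≤ ε₁) with hP
  set Gs : Finset ℕ := Icc 1 80 ∪ Ps.biUnion (fun p => Icc ⌈p * b - ε₁⌉₊ ⌊p * b + ε₁⌋₊) with hGG
  have hPc : (Ps.card:ℝ) ≤ 89 * N / a + 1 := by
    have := P_count (89 * N) a b ε₁ ha hsep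
    push_cast at this
    exact this
  have hGc : (Gs.card:ℝ) ≤ 80 + 161 * (89 * N / a + 1) := by
    have h1 : Gs.card ≤ 80 + Ps.card * 161 := by
      refine (Finset.card_union_le _ _).trans ?_
      have : (Ps.biUnion (fun p => Icc ⌈p * b - ε₁⌉₊ ⌊p * b + ε₁⌋₊)).card ≤ Ps.card * 161 := by
        apply Finset.card_biUnion_le_card_mul
        intro p _
        rw [Nat.card_Icc]
        have h1 : ⌊p * b + ε₁⌋₊ ≤ ⌈p * b - ε₁⌉₊ + 160 := by
          have e1 : ((⌊p * b + ε₁⌋₊ : ℕ):ℝ) ≤ p * b + ε₁ := Nat.floor_le (by positivity)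
          have e2 := Nat.le_ceil (p * b - ε₁)
          have : ((⌊p * b + ε₁⌋₊ : ℕ):ℝ) ≤ (⌈p * b - ε₁⌉₊ : ℕ) + 160 := by linarith
          exact_mod_cast this
        omega
      simp only [Nat.card_Icc]
      omega
    have h2 : (Gs.card:ℝ) ≤ 80 + Ps.card * 161 := by exact_mod_cast h1
    linarith
  have hpairs : (((s ×ˢ s).filter (fun x => x.2 < x.1)).card : ℝ) ≤ D * Gs.card := by
    have hmain : ∀ x ∈ (s ×ˢ s).filter (fun x => x.2 < x.1),
        1 ≤ x.1^2 - x.2^2 ∧ ((x.1^2 - x.2^2 : ℕ):ℝ) ≤ 9 * b * N ∧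
        ∃ p : ℤ, |((x.1^2 - x.2^2 : ℕ):ℝ) - p * b| ≤ 2 * δ * b := by
      intro x hx
      simp only [hs, Aset, Finset.mem_filter, Finset.mem_product, Finset.mem_Icc] at hx
      obtain ⟨⟨⟨⟨h11, h12⟩, P1, hP1⟩, ⟨⟨h21, h22⟩, P2, hP2⟩⟩, hlt⟩ := hx
      have hsq : x.2^2 < x.1^2 := Nat.pow_lt_pow_left hlt (by norm_num)
      have hc : ((x.1^2 - x.2^2 : ℕ):ℝ) = (x.1:ℝ)^2 - (x.2:ℝ)^2 := by
        rw [Nat.cast_sub hsq.le]; push_cast; ring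
      refine ⟨by omega, ?_, P1 - P2, ?_⟩
      · rw [hc]
        have : (x.1:ℝ) ≤ M := by exact_mod_cast h12
        have : (x.1:ℝ)^2 ≤ M^2 := by gcongr
        nlinarith
      · rw [hc]
        have e : (x.1:ℝ)^2 - (x.2:ℝ)^2 - ((P1 - P2 : ℤ):ℝ) * b
            = (((x.1:ℝ)^2/b + b - P1) - ((x.2:ℝ)^2/b + b - P2)) * b := by
          push_cast; field_simp; ring
        rw [e, abs_mul, abs_of_pos hb0]
        gcongr
        refine (abs_sub _ _).trans ?_
        linarith
    apply card_le_of_fiber _ _ (fun x => x.1^2 - x.2^2)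
    · intro x hx
      obtain ⟨h1, h2, p, hp⟩ := hmain x hx
      set g := x.1^2 - x.2^2 with hg
      have hp' := abs_le.1 hp
      rw [hGG, Finset.mem_union]
      rcases le_or_gt p 0 with hp0 | hp0
      · left
        rw [Finset.mem_Icc]
        refine ⟨h1, ?_⟩
        have : (p:ℝ) ≤ 0 := by exact_mod_cast hp0
        have h3 : (g:ℝ) ≤ 80 := by nlinarith
        exact_mod_cast h3
      · right
        lift p to ℕ using hp0.le
        rw [Finset.mem_biUnion]
        have hp1 : 1 ≤ p := by omega
        push_cast at hp hp'
        refine ⟨p, ?_, ?_⟩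
        · rw [hP, Finset.mem_filter, Finset.mem_Icc]
          refine ⟨⟨hp1, ?_⟩, g, ?_⟩
          · have : (p:ℝ) * b ≤ (9 * N + 80) * b := by nlinarith
            have h4 := le_of_mul_le_mul_right this hb0
            have h5 : (p:ℝ) ≤ 89 * N := by linarith
            exact_mod_cast h5
          · rw [abs_sub_comm]
            push_cast
            exact hp.trans hδb
        · rw [Finset.mem_Icc, Nat.ceil_le]
          refine ⟨by linarith, Nat.le_floor (by linarith)⟩
    · intro g hg
      rcases Nat.eq_zero_or_pos g with h0 | h0
      · refine le_trans (le_of_eq ?_) (by linarith : (0:ℝ) ≤ D)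
        rw [Nat.cast_eq_zero, Finset.card_eq_zero]
        apply Finset.filter_eq_empty_iff.2
        intro x hx hxg
        have := (hmain x hx).1
        omega
      · refine pair_fiber s g h0 D (hG g ?_).1
        have hle : (g:ℝ) ≤ 10^6 * (N:ℝ)^10 := by
          rw [hGG, Finset.mem_union, Finset.mem_biUnion] at hg
          have hN10 : (N:ℝ)^2 ≤ N^10 := pow_le_pow_right₀ hN1 (by norm_num)
          have hNN : (1:ℝ) ≤ N^2 := by nlinarith
          rcases hg with hg | ⟨p, hp, hg⟩
          · have : (g:ℝ) ≤ 80 := by exact_mod_cast (Finset.mem_Icc.1 hg).2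
            nlinarith
          · have h1 := (Finset.mem_Icc.1 hg).2
            have h2 : (g:ℝ) ≤ p * b + ε₁ := (Nat.le_floor_iff (by positivity)).1 h1
            have h3 : (p:ℝ) ≤ 89 * N := by
              have := (Finset.mem_Icc.1 (Finset.mem_filter.1 hp).1).2
              exact_mod_cast this
            have h4 : (p:ℝ) * b ≤ (89 * N) * (4 * N) := by gcongr
            nlinarith
        exact_mod_cast hle
  have hsq := card_sq_le s
  have hR : ((Rset N β η).card : ℝ) ≤ 81 * s.card := by
    refine h0.trans ?_
    gcongr
    linarith
  have hNa : 0 ≤ (N:ℝ)/a := by positivity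
  have e89 : 89 * (N:ℝ) / a = 89 * (N/a) := by ring
  rw [e89] at hGc
  have hs2 : (s.card:ℝ)^2 ≤ 60000 * (D * (1 + (N:ℝ)/a)) := by
    have : D * (Gs.card:ℝ) ≤ D * (80 + 161 * (89 * (N/a) + 1)) := by gcongr
    have h5 : 0 ≤ D * (N/a) := by positivity
    nlinarith
  calc ((Rset N β η).card : ℝ)^2 ≤ (81 * s.card)^2 := by gcongr
    _ = 6561 * (s.card:ℝ)^2 := by ring
    _ ≤ 6561 * (60000 * (D * (1 + (N:ℝ)/a))) := by gcongr
    _ ≤ _ := by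
      have : 0 ≤ D * (1 + (N:ℝ)/a) := by positivity
      nlinarith

/-- generic weight `n^{-3/4}` -/
def ww (n : ℕ) : ℝ := (n:ℝ) ^ (-(3:ℝ)/4)

lemma ww_nonneg (n : ℕ) : 0 ≤ ww n := by unfold ww; positivity

lemma ww_eq (n : ℕ) (hn : 1 ≤ n) : ww n = 1 / (√(n:ℝ) * √(√(n:ℝ))) := by
  have h : (0:ℝ) < n := by exact_mod_cast hn
  unfold ww
  rw [Real.sqrt_eq_rpow, Real.sqrt_eq_rpow, ← Real.rpow_mul h.le, ← Real.rpow_add h, one_div,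
    ← Real.rpow_neg h.le]
  norm_num

lemma ww_mul (m n : ℕ) : ww (m * n) = ww m * ww n := by
  unfold ww
  push_cast
  rw [Real.mul_rpow (by positivity) (by positivity)]

/-- weight `d(n) n^{-3/4}` -/
def om (n : ℕ) : ℝ := (n.divisors.card : ℝ) * ww n

lemma om_nonneg (n : ℕ) : 0 ≤ om n := mul_nonneg (by positivity) (ww_nonneg n)

lemma sum_le_of_fiber_var {ι κ : Type*} [DecidableEq κ] (s : Finset ι) (t : Finset κ) (φ : ι → κ)
    (f : ι → ℝ) (g c : κ → ℝ) (hφ : ∀ i ∈ s, φ i ∈ t) (hg : ∀ k ∈ t, 0 ≤ g k)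
    (hcard : ∀ k ∈ t, ((s.filter (fun i => φ i = k)).card : ℝ) ≤ c k)
    (h : ∀ i ∈ s, f i ≤ g (φ i)) :
    ∑ i ∈ s, f i ≤ ∑ k ∈ t, c k * g k := by
  calc ∑ i ∈ s, f i ≤ ∑ i ∈ s, g (φ i) := Finset.sum_le_sum h
    _ = ∑ k ∈ t, ∑ i ∈ s.filter (fun i => φ i = k), g (φ i) :=
        (Finset.sum_fiberwise_of_maps_to hφ _).symm
    _ ≤ ∑ k ∈ t, c k * g k := by
        apply Finset.sum_le_sum
        intro k hk
        have : ∑ i ∈ s.filter (fun i => φ i = k), g (φ i)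
            = ((s.filter (fun i => φ i = k)).card : ℝ) * g k := by
          rw [Finset.sum_congr rfl (g := fun _ => g k)]
          · simp
          · intro i hi
            rw [(Finset.mem_filter.1 hi).2]
        rw [this]
        exact mul_le_mul_of_nonneg_right (hcard k hk) (hg k hk)

/-- the facts about the nearest integer `j` to `2a√ν` -/
lemma I_key (a ν : ℕ) (ha : 1 ≤ a) (hν : 1 ≤ ν) (hsq : ¬ IsSquare ν) (ε₂ : ℝ) (hε1 : ε₂ ≤ 1)
    (hd : dst (2 * a * √(ν:ℝ)) ≤ ε₂) :
    ∃ j : ℕ, round (2 * a * √(ν:ℝ)) = (j:ℤ) ∧ 1 ≤ j ∧ (j:ℝ) ≤ 3 * a * √(ν:ℝ) ∧ a * √(ν:ℝ) ≤ j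
      ∧ 1 ≤ 5 * ε₂ * j ∧ |(ν:ℝ) - (j:ℝ)^2/(4*a^2)| ≤ 5 * ε₂ * j / (4 * a^2) := by
  have ha' : (1:ℝ) ≤ a := by exact_mod_cast ha
  have hν' : (1:ℝ) ≤ ν := by exact_mod_cast hν
  have ex : √(ν:ℝ)^2 = ν := Real.sq_sqrt (by positivity)
  have hx1 : 1 ≤ √(ν:ℝ) := by rw [Real.one_le_sqrt]; exact hν'
  set x := √(ν:ℝ) with hx
  unfold dst at hd
  have hd' := abs_le.1 hd
  have hax : 1 ≤ a * x := by nlinarith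
  set r := round (2 * a * x) with hr
  have hr1 : (a:ℝ) * x ≤ r := by linarith [hd'.2]
  have hr2 : (r:ℝ) ≤ 3 * a * x := by linarith [hd'.1]
  have hrpos : (0:ℝ) < r := by linarith
  have hrpos' : 0 < r := by exact_mod_cast hrpos
  lift r to ℕ using hrpos'.le with j hj
  push_cast at hr1 hr2 hd hd' hrpos
  have hε0 : 0 ≤ ε₂ := (abs_nonneg _).trans hd
  have hprod : |4 * (a:ℝ)^2 * ν - (j:ℝ)^2| ≤ 5 * ε₂ * j := by
    have e : 4 * (a:ℝ)^2 * ν - (j:ℝ)^2 = (2 * a * x - j) * (2 * a * x + j) := by rw [← ex]; ring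
    rw [e, abs_mul, abs_of_nonneg (by positivity : 0 ≤ 2 * a * x + (j:ℝ))]
    calc |2 * a * x - j| * (2 * a * x + j) ≤ ε₂ * (5 * j) := by
          gcongr
          linarith
      _ = _ := by ring
  refine ⟨j, rfl, ?_, hr2, hr1, ?_, ?_⟩
  · exact_mod_cast hrpos'
  · have hne : (4 * (a:ℤ)^2 * ν - (j:ℤ)^2) ≠ 0 := by
      intro h0
      apply hsq
      have h1 : (2 * a)^2 * ν = j^2 := by
        have : ((2 * (a:ℤ))^2 * ν) = (j:ℤ)^2 := by linarith
        exact_mod_cast this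
      have h2 : (2 * a)^2 ∣ j^2 := ⟨ν, h1.symm⟩
      rw [Nat.pow_dvd_pow_iff (by norm_num)] at h2
      obtain ⟨c, rfl⟩ := h2
      refine ⟨c, ?_⟩
      have h3 : (2 * a)^2 * ν = (2 * a)^2 * (c * c) := by rw [h1]; ring
      exact Nat.eq_of_mul_eq_mul_left (by positivity) h3
    have h1 : (1:ℤ) ≤ |4 * (a:ℤ)^2 * ν - (j:ℤ)^2| := Int.one_le_abs hne
    have h2 : (1:ℝ) ≤ |4 * (a:ℝ)^2 * ν - (j:ℝ)^2| := by exact_mod_cast h1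
    linarith
  · have e : (ν:ℝ) - (j:ℝ)^2/(4*a^2) = (4 * (a:ℝ)^2 * ν - (j:ℝ)^2) / (4 * a^2) := by
      field_simp
    rw [e, abs_div, abs_of_pos (by positivity : (0:ℝ) < 4 * a^2)]
    gcongr

lemma card_near (s : Finset ℕ) (c r : ℝ) (hr : 0 ≤ r) (h : ∀ n ∈ s, |(n:ℝ) - c| ≤ r) :
    (s.card:ℝ) ≤ 1 + 2 * r := by
  rcases s.eq_empty_or_nonempty with rfl | hne
  · simp; positivity
  · set m := s.min' hne
    set M := s.max' hne
    have h1 : s.card ≤ M + 1 - m := by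
      rw [← Nat.card_Icc]
      apply Finset.card_le_card
      intro n hn
      rw [Finset.mem_Icc]
      exact ⟨Finset.min'_le _ _ hn, Finset.le_max' _ _ hn⟩
    have hm := abs_le.1 (h m (Finset.min'_mem _ _))
    have hM := abs_le.1 (h M (Finset.max'_mem _ _))
    have hle : m ≤ M := Finset.min'_le_max' _ hne
    have h2 : (s.card:ℝ) ≤ (M:ℝ) + 1 - m := by
      have : s.card + m ≤ M + 1 := by omega
      have : (s.card:ℝ) + m ≤ M + 1 := by exact_mod_cast this
      linarith
    linarith [hm.1, hM.2]

lemma I_sum (N a : ℕ) (D ε₂ : ℝ) (hN : 1 ≤ N) (ha : 1 ≤ a) (hε0 : 0 < ε₂) (hε1 : ε₂ ≤ 1)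
    (hD : ∑ i ∈ Icc 1 (3 * a * N), (1/(i:ℝ)) ≤ D) :
    ∑ ν ∈ (Icc 1 (N^2)).filter (fun ν : ℕ => ¬ IsSquare ν ∧ dst (2 * a * √(ν:ℝ)) ≤ ε₂), ww ν
      ≤ 23 * D * (a * √a * √ε₂ + ε₂ * √N) := by
  have ha' : (1:ℝ) ≤ a := by exact_mod_cast ha
  have hN' : (1:ℝ) ≤ N := by exact_mod_cast hN
  set S := (Icc 1 (N^2)).filter (fun ν : ℕ => ¬ IsSquare ν ∧ dst (2 * a * √(ν:ℝ)) ≤ ε₂) with hS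
  set t := (Icc 1 (3 * a * N)).filter (fun j : ℕ => 1 ≤ 5 * ε₂ * (j:ℝ)) with ht
  set φ : ℕ → ℕ := fun ν => (round (2 * a * √(ν:ℝ))).toNat with hφ
  set g : ℕ → ℝ := fun j => (3 * a / j) * √(3 * a / j) with hg
  have key : ∀ ν ∈ S, 1 ≤ φ ν ∧ (φ ν:ℝ) ≤ 3 * a * √(ν:ℝ) ∧ a * √(ν:ℝ) ≤ φ ν
      ∧ 1 ≤ 5 * ε₂ * φ ν ∧ |(ν:ℝ) - (φ ν:ℝ)^2/(4*a^2)| ≤ 5 * ε₂ * φ ν / (4 * a^2) := by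
    intro ν hν
    simp only [hS, Finset.mem_filter, Finset.mem_Icc] at hν
    obtain ⟨j, hj, h⟩ := I_key a ν ha hν.1.1 hν.2.1 ε₂ hε1 hν.2.2
    have : φ ν = j := by simp only [hφ, hj]; simp
    rw [this]
    exact h
  have h1 : ∑ ν ∈ S, ww ν ≤ ∑ j ∈ t, (1 + 2 * (5 * ε₂ * j / (4 * a^2))) * g j := by
    apply sum_le_of_fiber_var S t φ
    · intro ν hν
      obtain ⟨k1, k2, k3, k4, k5⟩ := key ν hν
      simp only [hS, Finset.mem_filter, Finset.mem_Icc] at hν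
      rw [ht, Finset.mem_filter, Finset.mem_Icc]
      refine ⟨⟨k1, ?_⟩, k4⟩
      have h2 : √(ν:ℝ) ≤ N := by
        rw [Real.sqrt_le_left (by positivity)]
        exact_mod_cast hν.1.2
      have : (φ ν:ℝ) ≤ 3 * a * N := k2.trans (by gcongr)
      exact_mod_cast this
    · intro j _
      simp only [hg]; positivity
    · intro j _
      apply card_near _ ((j:ℝ)^2/(4*a^2)) _ (by positivity)
      intro ν hν
      rw [Finset.mem_filter] at hν
      have := (key ν hν.1).2.2.2.2
      rw [hν.2] at this
      exact this
    · intro ν hν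
      obtain ⟨k1, k2, k3, k4, k5⟩ := key ν hν
      simp only [hS, Finset.mem_filter, Finset.mem_Icc] at hν
      have hφ0 : (0:ℝ) < φ ν := by exact_mod_cast k1
      have hν0 : (0:ℝ) < √(ν:ℝ) := by
        rw [Real.sqrt_pos]; exact_mod_cast hν.1.1
      have h3 : 1 / √(ν:ℝ) ≤ 3 * a / φ ν := by
        rw [div_le_div_iff₀ hν0 hφ0]; linarith
      rw [ww_eq ν hν.1.1]
      simp only [hg]
      have h4 : 1 / √(√(ν:ℝ)) = √(1 / √(ν:ℝ)) := by
        rw [Real.sqrt_div zero_le_one, Real.sqrt_one]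
      rw [← one_div_mul_one_div, h4]
      exact mul_le_mul h3 (Real.sqrt_le_sqrt h3) (Real.sqrt_nonneg _) (by positivity)
  refine h1.trans ?_
  have h2 : ∀ j ∈ t, (1 + 2 * (5 * ε₂ * j / (4 * a^2))) * g j
      ≤ (3 * a * √(3 * a) * √(5 * ε₂) + 45/2 * ε₂ * √N) * (1/(j:ℝ)) := by
    intro j hj
    rw [ht, Finset.mem_filter, Finset.mem_Icc] at hj
    have hj0 : (1:ℝ) ≤ j := by exact_mod_cast hj.1.1
    have hjN : (j:ℝ) ≤ 3 * a * N := by exact_mod_cast hj.1.2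
    have hsj : 0 < √(j:ℝ) := by rw [Real.sqrt_pos]; linarith
    have esj : √(j:ℝ) * √(j:ℝ) = j := Real.mul_self_sqrt (by linarith)
    have hgj : g j = 3 * a * √(3 * a) * (1 / √(j:ℝ)) * (1 / j) := by
      simp only [hg]
      rw [Real.sqrt_div (by positivity)]
      field_simp
    have h5 : 1 / √(j:ℝ) ≤ √(5 * ε₂) := by
      rw [div_le_iff₀ hsj, ← Real.sqrt_mul (by positivity), Real.one_le_sqrt]
      exact hj.2
    have h6 : (1 / √(j:ℝ)) * j ≤ √(3 * a) * √N := by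
      have : (1 / √(j:ℝ)) * j = √(j:ℝ) := by
        field_simp
        rw [sq, esj]
      rw [this, ← Real.sqrt_mul (by positivity)]
      exact Real.sqrt_le_sqrt hjN
    have e3a : √(3 * (a:ℝ)) * √(3 * (a:ℝ)) = 3 * a := Real.mul_self_sqrt (by positivity)
    rw [hgj]
    have hA : 3 * a * √(3 * a) * (1 / √(j:ℝ)) ≤ 3 * a * √(3 * a) * √(5 * ε₂) := by gcongr
    have hB : 2 * (5 * ε₂ * j / (4 * a^2)) * (3 * a * √(3 * a) * (1 / √(j:ℝ))) ≤ 45/2 * ε₂ * √N := by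
      calc 2 * (5 * ε₂ * j / (4 * a^2)) * (3 * a * √(3 * a) * (1 / √(j:ℝ)))
          = (5 * ε₂ / (2 * a^2)) * (3 * a * √(3 * a)) * ((1 / √(j:ℝ)) * j) := by ring
        _ ≤ (5 * ε₂ / (2 * a^2)) * (3 * a * √(3 * a)) * (√(3 * a) * √N) := by gcongr
        _ = (5 * ε₂ / (2 * a^2)) * (3 * a) * (√(3 * a) * √(3 * a)) * √N := by ring
        _ = _ := by rw [e3a]; field_simp; ring
    calc (1 + 2 * (5 * ε₂ * j / (4 * a^2))) * (3 * a * √(3 * a) * (1 / √(j:ℝ)) * (1 / j))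
        = (3 * a * √(3 * a) * (1 / √(j:ℝ)) + 2 * (5 * ε₂ * j / (4 * a^2)) * (3 * a * √(3 * a) * (1 / √(j:ℝ)))) * (1/j) := by ring
      _ ≤ _ := by gcongr
  calc _ ≤ ∑ j ∈ t, (3 * a * √(3 * a) * √(5 * ε₂) + 45/2 * ε₂ * √N) * (1/(j:ℝ)) := Finset.sum_le_sum h2
    _ ≤ ∑ j ∈ Icc 1 (3 * a * N), (3 * a * √(3 * a) * √(5 * ε₂) + 45/2 * ε₂ * √N) * (1/(j:ℝ)) := by
        apply Finset.sum_le_sum_of_subset_of_nonneg (Finset.filter_subset _ _)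
        intro j _ _
        positivity
    _ = (3 * a * √(3 * a) * √(5 * ε₂) + 45/2 * ε₂ * √N) * ∑ j ∈ Icc 1 (3 * a * N), (1/(j:ℝ)) := by
        rw [Finset.mul_sum]
    _ ≤ (3 * a * √(3 * a) * √(5 * ε₂) + 45/2 * ε₂ * √N) * D := by gcongr
    _ ≤ _ := by
        have hD0 : 0 ≤ D := le_trans (Finset.sum_nonneg (fun _ _ => by positivity)) hD
        have e : √(3 * (a:ℝ)) * √(5 * ε₂) ≤ 4 * (√a * √ε₂) := by
          rw [Real.sqrt_mul (by norm_num), Real.sqrt_mul (by norm_num)]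
          have h15 : √(3:ℝ) * √5 ≤ 4 := by
            rw [← Real.sqrt_mul (by norm_num), Real.sqrt_le_left (by norm_num)]
            norm_num
          have h0 : 0 ≤ √(a:ℝ) * √ε₂ := by positivity
          nlinarith
        have e1 : 3 * a * √(3 * a) * √(5 * ε₂) ≤ 12 * (a * √a * √ε₂) := by
          calc 3 * a * √(3 * a) * √(5 * ε₂) = 3 * a * (√(3 * (a:ℝ)) * √(5 * ε₂)) := by ring
            _ ≤ 3 * a * (4 * (√a * √ε₂)) := by gcongr
            _ = _ := by ring
        have e2 : 0 ≤ a * √a * √ε₂ := by positivity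
        have e3 : 0 ≤ ε₂ * √N := by positivity
        calc _ ≤ (12 * (a * √a * √ε₂) + 45/2 * ε₂ * √N) * D := by gcongr
          _ ≤ (23 * (a * √a * √ε₂ + ε₂ * √N)) * D := by
            apply mul_le_mul_of_nonneg_right _ hD0
            linarith
          _ = _ := by ring

lemma ww_le (N n : ℕ) (hn : 1 ≤ n) (hnN : n ≤ N) : ww n ≤ √(√(N:ℝ)) * (1/(n:ℝ)) := by
  have h0 : (0:ℝ) < n := by exact_mod_cast hn
  have h1 : 0 < √(n:ℝ) := Real.sqrt_pos.2 h0
  have h2 : 0 < √(√(n:ℝ)) := Real.sqrt_pos.2 h1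
  have e1 : √(n:ℝ) * √(n:ℝ) = n := Real.mul_self_sqrt h0.le
  have e2 : √(√(n:ℝ)) * √(√(n:ℝ)) = √(n:ℝ) := Real.mul_self_sqrt h1.le
  have h3 : √(√(n:ℝ)) ≤ √(√(N:ℝ)) := by
    apply Real.sqrt_le_sqrt; apply Real.sqrt_le_sqrt; exact_mod_cast hnN
  have h4 : ww n = √(√(n:ℝ)) * (1/(n:ℝ)) := by
    rw [ww_eq n hn]
    rw [mul_one_div, div_eq_div_iff (by positivity) h0.ne', one_mul]
    calc (n:ℝ) = √(n:ℝ) * √(n:ℝ) := e1.symm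
      _ = √(√(n:ℝ)) * √(√(n:ℝ)) * √(n:ℝ) := by rw [e2]
      _ = _ := by ring
  rw [h4]
  gcongr

lemma ww_le_one (n : ℕ) (hn : 1 ≤ n) : ww n ≤ 1 := by
  unfold ww
  apply Real.rpow_le_one_of_one_le_of_nonpos
  · exact_mod_cast hn
  · norm_num

lemma ww_sq_le (n : ℕ) (hn : 1 ≤ n) : ww n * ww n ≤ 1/(n:ℝ) := by
  have h0 : (1:ℝ) ≤ n := by exact_mod_cast hn
  have h1 : 1 ≤ √(n:ℝ) := Real.one_le_sqrt.2 h0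
  have e1 : √(n:ℝ) * √(n:ℝ) = n := Real.mul_self_sqrt (by linarith)
  have h2 : 1 ≤ √(√(n:ℝ)) := Real.one_le_sqrt.2 h1
  have h3 : ww n ≤ 1 / √(n:ℝ) := by
    rw [ww_eq n hn]
    apply one_div_le_one_div_of_le (by linarith)
    nlinarith
  calc ww n * ww n ≤ (1 / √(n:ℝ)) * (1 / √(n:ℝ)) := by
        gcongr
        exact ww_nonneg n
    _ = _ := by rw [one_div_mul_one_div, e1]

lemma good_small (N : ℕ) (n : ℕ) (hN : 1 ≤ N) (h : n ≤ 10^6 * N^2) : n ≤ 10^6 * N^10 :=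
  h.trans (Nat.mul_le_mul_left _ (Nat.pow_le_pow_right hN (by norm_num)))

lemma good_le (N n : ℕ) (hN : 1 ≤ N) (h : n ≤ N) : n ≤ 10^6 * N^10 := by
  apply good_small N n hN
  nlinarith

lemma om_le (N : ℕ) (D : ℝ) (hN : 1 ≤ N) (hG : Good N D) (n : ℕ) (hn : n ≤ N) :
    om n ≤ D * ww n :=
  mul_le_mul_of_nonneg_right (hG.2 n (good_le N n hN hn)).1 (ww_nonneg n)

lemma sum_om (N : ℕ) (D : ℝ) (hN : 1 ≤ N) (hG : Good N D) :
    ∑ n ∈ Icc 1 N, om n ≤ D^2 * √(√(N:ℝ)) := by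
  have hD : 0 ≤ D := by linarith [hG.1]
  calc ∑ n ∈ Icc 1 N, om n ≤ ∑ n ∈ Icc 1 N, (D * √(√(N:ℝ))) * (1/(n:ℝ)) := by
        apply Finset.sum_le_sum
        intro n hn
        rw [Finset.mem_Icc] at hn
        calc om n ≤ D * ww n := om_le N D hN hG n hn.2
          _ ≤ D * (√(√(N:ℝ)) * (1/(n:ℝ))) := by
              gcongr; exact ww_le N n hn.1 hn.2
          _ = _ := by ring
    _ = (D * √(√(N:ℝ))) * ∑ n ∈ Icc 1 N, (1/(n:ℝ)) := by rw [Finset.mul_sum]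
    _ ≤ (D * √(√(N:ℝ))) * D := by
        gcongr
        exact (hG.2 N (good_le N N hN le_rfl)).2
    _ = _ := by ring

lemma sum_om_sq (N : ℕ) (D : ℝ) (hN : 1 ≤ N) (hG : Good N D) :
    ∑ n ∈ Icc 1 N, om n * om n ≤ D^3 := by
  have hD : 0 ≤ D := by linarith [hG.1]
  calc ∑ n ∈ Icc 1 N, om n * om n ≤ ∑ n ∈ Icc 1 N, D^2 * (1/(n:ℝ)) := by
        apply Finset.sum_le_sum
        intro n hn
        rw [Finset.mem_Icc] at hn
        have := om_le N D hN hG n hn.2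
        calc om n * om n ≤ (D * ww n) * (D * ww n) :=
              mul_le_mul this this (om_nonneg n) ((om_nonneg n).trans this)
          _ = D^2 * (ww n * ww n) := by ring
          _ ≤ _ := by gcongr; exact ww_sq_le n hn.1
    _ = D^2 * ∑ n ∈ Icc 1 N, (1/(n:ℝ)) := by rw [Finset.mul_sum]
    _ ≤ D^2 * D := by
        gcongr
        exact (hG.2 N (good_le N N hN le_rfl)).2
    _ = _ := by ring

/-- all pairs -/
def P2 (N : ℕ) : Finset (ℕ × ℕ) := (Icc 1 N) ×ˢ (Icc 1 N)

lemma mem_P2 {N : ℕ} {x : ℕ × ℕ} : x ∈ P2 N ↔ (1 ≤ x.1 ∧ x.1 ≤ N) ∧ (1 ≤ x.2 ∧ x.2 ≤ N) := by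
  simp [P2]

lemma sum_omom (N : ℕ) (D : ℝ) (hN : 1 ≤ N) (hG : Good N D) :
    ∑ x ∈ P2 N, om x.1 * om x.2 ≤ D^4 * √(N:ℝ) := by
  have h := sum_om N D hN hG
  have h0 : 0 ≤ ∑ n ∈ Icc 1 N, om n := Finset.sum_nonneg (fun n _ => om_nonneg n)
  have e : √(√(N:ℝ)) * √(√(N:ℝ)) = √(N:ℝ) := Real.mul_self_sqrt (by positivity)
  unfold P2
  rw [Finset.sum_product, ← Finset.sum_mul_sum]
  calc _ ≤ (D^2 * √(√(N:ℝ))) * (D^2 * √(√(N:ℝ))) := mul_le_mul h h h0 (h0.trans h)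
    _ = D^4 * (√(√(N:ℝ)) * √(√(N:ℝ))) := by ring
    _ = _ := by rw [e]

/-- sums over pairs with product in `S` -/
lemma sum_omom_prod (N : ℕ) (D : ℝ) (hN : 1 ≤ N) (hG : Good N D) (S : Finset ℕ) :
    ∑ x ∈ (P2 N).filter (fun x => x.1 * x.2 ∈ S), om x.1 * om x.2
      ≤ D^3 * ∑ ν ∈ S.filter (fun ν => 1 ≤ ν ∧ ν ≤ N^2), ww ν := by
  have hD : 0 ≤ D := by linarith [hG.1]
  have := sum_le_of_fiber ((P2 N).filter (fun x => x.1 * x.2 ∈ S))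
    (S.filter (fun ν => 1 ≤ ν ∧ ν ≤ N^2)) (fun x => x.1 * x.2) (fun x => om x.1 * om x.2)
    (fun ν => D^2 * ww ν) D ?_ ?_ ?_ ?_
  · refine this.trans (le_of_eq ?_)
    rw [← Finset.mul_sum]; ring
  · intro x hx
    rw [Finset.mem_filter, mem_P2] at hx
    rw [Finset.mem_filter]
    refine ⟨hx.2, Nat.mul_pos hx.1.1.1 hx.1.2.1, ?_⟩
    rw [sq]
    exact Nat.mul_le_mul hx.1.1.2 hx.1.2.2
  · intro ν _
    have := ww_nonneg ν
    positivity
  · intro ν hν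
    rw [Finset.mem_filter] at hν
    refine le_trans (card_le_of_inj _ ν.divisors (fun x => x.1) ?_ ?_)
      (hG.2 ν (good_small N ν hN (by nlinarith [hν.2.2]))).1
    · intro x hx
      rw [Finset.mem_filter] at hx
      rw [Nat.mem_divisors]
      exact ⟨⟨x.2, hx.2.symm⟩, by omega⟩
    · intro x hx y hy hxy
      rw [Finset.mem_filter, Finset.mem_filter, mem_P2] at hx hy
      have h1 := hx.2
      have h2 := hy.2
      have hxy' : x.1 = y.1 := hxy
      have h3 : x.2 = y.2 := by
        have h4 : x.1 * x.2 = x.1 * y.2 := by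
          rw [show x.1 * x.2 = ν from h1]; rw [hxy']; exact h2.symm
        exact Nat.eq_of_mul_eq_mul_left (by have := hx.1.1.1.1; omega) h4
      exact Prod.ext hxy' h3
  · intro x hx
    rw [Finset.mem_filter, mem_P2] at hx
    have h1 := om_le N D hN hG x.1 hx.1.1.2
    have h2 := om_le N D hN hG x.2 hx.1.2.2
    calc om x.1 * om x.2 ≤ (D * ww x.1) * (D * ww x.2) := by
          gcongr
          · exact om_nonneg _
          · exact (om_nonneg _).trans h1
      _ = D^2 * ww (x.1 * x.2) := by rw [ww_mul]; ring

/-- spacing of square roots -/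
lemma sqrt_gap (N m n : ℕ) (hN : 1 ≤ N) (hm : m ≤ N) (hn : n ≤ N) (hmn : m ≠ n) :
    1 ≤ 2 * √(N:ℝ) * |√(m:ℝ) - √(n:ℝ)| := by
  have h1 : √(m:ℝ) ≤ √(N:ℝ) := Real.sqrt_le_sqrt (by exact_mod_cast hm)
  have h2 : √(n:ℝ) ≤ √(N:ℝ) := Real.sqrt_le_sqrt (by exact_mod_cast hn)
  have e1 : √(m:ℝ)^2 = m := Real.sq_sqrt (by positivity)
  have e2 : √(n:ℝ)^2 = n := Real.sq_sqrt (by positivity)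
  have h3 : (1:ℝ) ≤ |(m:ℝ) - n| := by
    have : (1:ℤ) ≤ |(m:ℤ) - n| := Int.one_le_abs (by omega)
    exact_mod_cast this
  have h4 : (m:ℝ) - n = (√(m:ℝ) + √(n:ℝ)) * (√(m:ℝ) - √(n:ℝ)) := by
    rw [← e1, ← e2]; ring_nf
    simp [Real.sq_sqrt]
  rw [h4, abs_mul, abs_of_nonneg (by positivity)] at h3
  refine h3.trans ?_
  gcongr
  linarith

lemma Rset_neg (N : ℕ) (β η : ℝ) : ((Rset N β η).card : ℝ) ≤ (Rset N (-β) η).card := by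
  apply card_le_of_inj _ _ (fun x => (x.2, x.1))
  · intro x hx
    simp only [Rset, Finset.mem_filter, Finset.mem_product] at hx ⊢
    refine ⟨⟨hx.1.2, hx.1.1⟩, ?_⟩
    rw [← abs_neg]
    convert hx.2 using 2
    ring
  · intro x _ y _ h
    simp only [Prod.mk.injEq] at h
    exact Prod.ext h.2 h.1

lemma Rset_zero (N : ℕ) (η : ℝ) (hN : 1 ≤ N) (hη2 : 4 * √(N:ℝ) * η ≤ 1) (x : ℕ × ℕ)
    (hx : x ∈ Rset N 0 η) : x.1 = x.2 := by
  by_contra hne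
  simp only [Rset, Finset.mem_filter, Finset.mem_product, Finset.mem_Icc, sub_zero] at hx
  have h := sqrt_gap N x.1 x.2 hN hx.1.1.2 hx.1.2.2 hne
  have hs : 0 ≤ √(N:ℝ) := Real.sqrt_nonneg _
  nlinarith [hx.2]

lemma Rset_zero_card (N : ℕ) (η : ℝ) (hN : 1 ≤ N) (hη2 : 4 * √(N:ℝ) * η ≤ 1) :
    ((Rset N 0 η).card : ℝ) ≤ N := by
  refine le_trans (card_le_of_inj _ (Icc 1 N) (fun x => x.1) ?_ ?_) (by simp)
  · intro x hx
    simp only [Rset, Finset.mem_filter, Finset.mem_product] at hx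
    exact hx.1.1
  · intro x hx y hy h
    have h1 := Rset_zero N η hN hη2 x hx
    have h2 := Rset_zero N η hN hη2 y hy
    exact Prod.ext h (by rw [← h1, ← h2]; exact h)

/-- the shift `β` -/
def bet (s t : ℝ) (x : ℕ × ℕ) : ℝ := s * √(x.1:ℝ) + t * √(x.2:ℝ)

def Sg (s : ℝ) : Prop := s = 1 ∨ s = -1

lemma Sg.neg {s : ℝ} (h : Sg s) : Sg (-s) := by
  rcases h with rfl | rfl
  · right; rfl
  · left; norm_num

lemma bet_neg (s t : ℝ) (x : ℕ × ℕ) : bet (-s) (-t) x = - bet s t x := by unfold bet; ring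

lemma bet_bounds (N : ℕ) (hN : 1 ≤ N) (s t : ℝ) (hs : Sg s) (ht : Sg t) (x : ℕ × ℕ) (hx : x ∈ P2 N)
    (h0 : bet s t x ≠ 0) : 1 ≤ 2 * √(N:ℝ) * |bet s t x| ∧ |bet s t x| ≤ 2 * √(N:ℝ) := by
  rw [mem_P2] at hx
  have h1 : √(x.1:ℝ) ≤ √(N:ℝ) := Real.sqrt_le_sqrt (by exact_mod_cast hx.1.2)
  have h2 : √(x.2:ℝ) ≤ √(N:ℝ) := Real.sqrt_le_sqrt (by exact_mod_cast hx.2.2)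
  have h3 : 1 ≤ √(x.1:ℝ) := Real.one_le_sqrt.2 (by exact_mod_cast hx.1.1)
  have h4 : 1 ≤ √(x.2:ℝ) := Real.one_le_sqrt.2 (by exact_mod_cast hx.2.1)
  have h5 : 1 ≤ √(N:ℝ) := h3.trans h1
  unfold bet at h0 ⊢
  constructor
  · rcases hs with rfl | rfl <;> rcases ht with rfl | rfl
    · rw [abs_of_nonneg (by linarith)]; nlinarith
    · have := sqrt_gap N x.1 x.2 hN hx.1.2 hx.2.2 (by
        intro h; apply h0; rw [h]; ring)
      convert this using 3
      ring
    · have := sqrt_gap N x.2 x.1 hN hx.2.2 hx.1.2 (by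
        intro h; apply h0; rw [h]; ring)
      convert this using 3
      ring
    · rw [abs_of_nonpos (by linarith)]; nlinarith
  · rcases hs with rfl | rfl <;> rcases ht with rfl | rfl <;> rw [abs_le] <;> constructor <;> linarith

lemma bet_zero (s t : ℝ) (hs : Sg s) (ht : Sg t) (x : ℕ × ℕ) (hx : 1 ≤ x.1)
    (h0 : bet s t x = 0) : x.1 = x.2 := by
  have h3 : 1 ≤ √(x.1:ℝ) := Real.one_le_sqrt.2 (by exact_mod_cast hx)
  have h4 : 0 ≤ √(x.2:ℝ) := Real.sqrt_nonneg _
  unfold bet at h0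
  have : √(x.1:ℝ) = √(x.2:ℝ) := by
    rcases hs with rfl | rfl <;> rcases ht with rfl | rfl <;> linarith
  rw [Real.sqrt_inj (by positivity) (by positivity)] at this
  exact_mod_cast this

lemma R_boundA' (N : ℕ) (D : ℝ) (hN : 1 ≤ N) (hG : Good N D) (s t η : ℝ) (hs : Sg s) (ht : Sg t)
    (hη : 1 ≤ η * N^2) (hη2 : 4 * √(N:ℝ) * η ≤ 1) (x : ℕ × ℕ) (hx : x ∈ P2 N)
    (h0 : bet s t x ≠ 0) :
    ((Rset N (bet s t x) η).card:ℝ) ≤ 20000*(N*√N*η + D*√N) := by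
  obtain ⟨h1, h2⟩ := bet_bounds N hN s t hs ht x hx h0
  rcases le_total 0 (bet s t x) with h | h
  · rw [abs_of_nonneg h] at h1 h2
    exact R_boundA N D hN hG _ η h1 h2 hη hη2
  · rw [abs_of_nonpos h] at h1 h2
    exact (Rset_neg N _ η).trans (R_boundA N D hN hG _ η h1 h2 hη hη2)

lemma QA (N : ℕ) (D : ℝ) (hN : 1 ≤ N) (hG : Good N D) (s t η : ℝ) (hs : Sg s) (ht : Sg t)
    (hη : 1 ≤ η * N^2) (hη2 : 4 * √(N:ℝ) * η ≤ 1) :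
    ∑ x ∈ P2 N, om x.1 * om x.2 * (Rset N (bet s t x) η).card
      ≤ 20001 * D^5 * (N^2 * η + N) := by
  have hD := hG.1
  have hη0 : 0 < η := by
    by_contra h
    push Not at h
    have : (0:ℝ) ≤ N^2 := by positivity
    nlinarith
  have eN : √(N:ℝ) * √(N:ℝ) = N := Real.mul_self_sqrt (by positivity)
  have key : ∀ x ∈ P2 N, om x.1 * om x.2 * (Rset N (bet s t x) η).card
      ≤ om x.1 * om x.2 * (20000*(N*√N*η + D*√N))
        + (if x.1 = x.2 then om x.1 * om x.2 * N else 0) := by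
    intro x hx
    have h1 : 0 ≤ om x.1 * om x.2 := mul_nonneg (om_nonneg _) (om_nonneg _)
    by_cases h0 : bet s t x = 0
    · rw [h0, if_pos (bet_zero s t hs ht x (mem_P2.1 hx).1.1 h0)]
      have h2 := Rset_zero_card N η hN hη2
      have h3 : 0 ≤ om x.1 * om x.2 * (20000*(N*√N*η + D*√N)) := by positivity
      have := mul_le_mul_of_nonneg_left h2 h1
      linarith
    · have := mul_le_mul_of_nonneg_left (R_boundA' N D hN hG s t η hs ht hη hη2 x hx h0) h1
      have h2 : 0 ≤ (if x.1 = x.2 then om x.1 * om x.2 * N else 0) := by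
        split_ifs
        · positivity
        · exact le_rfl
      linarith
  refine (Finset.sum_le_sum key).trans ?_
  rw [Finset.sum_add_distrib, ← Finset.sum_mul]
  have h1 : ∑ x ∈ P2 N, (if x.1 = x.2 then om x.1 * om x.2 * N else 0) ≤ D^3 * N := by
    unfold P2
    rw [Finset.sum_product]
    have : ∀ k ∈ Icc 1 N, ∑ l ∈ Icc 1 N, (if k = l then om k * om l * (N:ℝ) else 0)
        = om k * om k * N := by
      intro k hk
      rw [Finset.sum_ite_eq, if_pos hk]
    simp only
    rw [Finset.sum_congr rfl this, ← Finset.sum_mul]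
    exact mul_le_mul_of_nonneg_right (sum_om_sq N D hN hG) (by positivity)
  have h2 := mul_le_mul_of_nonneg_right (sum_omom N D hN hG)
    (by positivity : 0 ≤ 20000*(N*√(N:ℝ)*η + D*√N))
  have e : D^4 * √(N:ℝ) * (20000*(N*√(N:ℝ)*η + D*√N))
      = 20000 * (D^4 * (N^2 * η) + D^5 * N) := by
    calc _ = 20000 * (D^4 * (N * (√(N:ℝ) * √(N:ℝ)) * η) + D^5 * (√(N:ℝ) * √(N:ℝ))) := by ring
      _ = _ := by rw [eN]; ring
  rw [e] at h2
  have h3 : D^3 ≤ D^5 := pow_le_pow_right₀ hD (by norm_num)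
  have h4 : D^4 ≤ D^5 := pow_le_pow_right₀ hD (by norm_num)
  have h5 : D^3 * N ≤ D^5 * (N:ℝ) := by gcongr
  have h6 : D^4 * (N^2 * η) ≤ D^5 * ((N:ℝ)^2 * η) := by gcongr
  have h7 : 0 ≤ D^5 * ((N:ℝ)^2 * η) := by positivity
  linarith

lemma dst_neg (x : ℝ) : dst (-x) = dst x := by
  have h : ∀ y : ℝ, dst (-y) ≤ dst y := by
    intro y
    have := dst_le (-y) (-(round y))
    refine this.trans (le_of_eq ?_)
    unfold dst
    rw [← abs_neg]; congr 1; push_cast; ring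
  apply le_antisymm (h x)
  simpa using h (-x)

lemma dst_int_add (x : ℝ) (n : ℤ) : dst (n + x) = dst x := by
  unfold dst
  rw [round_intCast_add]; congr 1; push_cast; ring

lemma bet_dst (s t : ℝ) (hs : Sg s) (ht : Sg t) (x : ℕ × ℕ) (p : ℕ) :
    dst (p * (bet s t x)^2) = dst (2 * p * √((x.1 * x.2 : ℕ):ℝ)) := by
  have e1 : √(x.1:ℝ)^2 = x.1 := Real.sq_sqrt (by positivity)
  have e2 : √(x.2:ℝ)^2 = x.2 := Real.sq_sqrt (by positivity)
  have e3 : √((x.1 * x.2 : ℕ):ℝ) = √(x.1:ℝ) * √(x.2:ℝ) := by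
    push_cast
    rw [Real.sqrt_mul (by positivity)]
  have hss : s^2 = 1 := by rcases hs with rfl | rfl <;> norm_num
  have htt : t^2 = 1 := by rcases ht with rfl | rfl <;> norm_num
  have e4 : p * (bet s t x)^2 = ((p * (x.1 + x.2) : ℕ) : ℤ) + s * t * (2 * p * (√(x.1:ℝ) * √(x.2:ℝ))) := by
    unfold bet
    push_cast
    calc _ = p * (s^2 * √(x.1:ℝ)^2 + t^2 * √(x.2:ℝ)^2) + s * t * (2 * p * (√(x.1:ℝ) * √(x.2:ℝ))) := by ring
      _ = _ := by rw [e1, e2, hss, htt]; ring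
  rw [e4, dst_int_add, e3]
  rcases hs with rfl | rfl <;> rcases ht with rfl | rfl
  · norm_num
  · rw [← dst_neg]; congr 1; ring
  · rw [← dst_neg]; congr 1; ring
  · norm_num

lemma R_boundB' (N a : ℕ) (D : ℝ) (hN : 1 ≤ N) (ha : 1 ≤ a) (hG : Good N D) (s t η : ℝ)
    (hs : Sg s) (ht : Sg t) (hη0 : 0 < η)
    (hη : η * N^2 ≤ 1) (hη2 : 4 * √(N:ℝ) * η ≤ 1) (x : ℕ × ℕ) (hx : x ∈ P2 N)
    (h0 : bet s t x ≠ 0)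
    (hsep : ∀ p : ℕ, 1 ≤ p → p < a → 160*N*√(N:ℝ)*η < dst (2 * p * √((x.1 * x.2 : ℕ):ℝ)))
    (c B : ℝ) (hc : 0 ≤ c) (hB : 0 ≤ B) (hcB : 1 + (N:ℝ)/a ≤ c^2 * B^2) :
    ((Rset N (bet s t x) η).card:ℝ) ≤ 20000 * D * (c * B) := by
  obtain ⟨h1, h2⟩ := bet_bounds N hN s t hs ht x hx h0
  have hD := hG.1
  have key : ((Rset N (bet s t x) η).card:ℝ)^2 ≤ 4*10^8*(D*(1+(N:ℝ)/a)) := by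
    rcases le_total 0 (bet s t x) with h | h
    · rw [abs_of_nonneg h] at h1 h2
      refine R_boundB N a D hN ha hG _ η h1 h2 hη0 hη hη2 ?_
      intro p hp1 hp2
      rw [bet_dst s t hs ht]
      have := hsep p hp1 hp2
      linarith
    · rw [abs_of_nonpos h] at h1 h2
      have h3 := Rset_neg N (bet s t x) η
      have h4 := R_boundB N a D hN ha hG _ η h1 h2 hη0 hη hη2 (by
        intro p hp1 hp2
        rw [neg_sq, bet_dst s t hs ht]
        have := hsep p hp1 hp2
        linarith)
      refine le_trans ?_ h4
      gcongr
  apply le_of_sq_le_sq _ (by positivity)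
  refine key.trans ?_
  have : D ≤ D^2 := by nlinarith
  calc 4*10^8*(D*(1+(N:ℝ)/a)) ≤ 4*10^8*(D^2*(c^2*B^2)) := by gcongr
    _ = _ := by ring

lemma QB_point (N : ℕ) (D : ℝ) (hN : 1 ≤ N) (hG : Good N D) (s t q : ℝ)
    (hs : Sg s) (ht : Sg t) (hq : 0 < q) (hqN : q^2 * N ≤ 1) (hqN2 : 1 ≤ 16 * q * N)
    (hη2 : 4 * √(N:ℝ) * q^4 ≤ 1) (x : ℕ × ℕ) (hx : x ∈ P2 N) (h0 : bet s t x ≠ 0) :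
    ((Rset N (bet s t x) (q^4)).card:ℝ) ≤ 400000 * D *
      ((if IsSquare (x.1 * x.2) then √(N:ℝ) else 0) + N * q
        + ∑ a ∈ Icc 1 ⌊1/(N*q^2)⌋₊, (if (¬ IsSquare (x.1 * x.2) ∧
          dst (2 * a * √((x.1 * x.2 : ℕ):ℝ)) ≤ 160*N*√(N:ℝ)*q^4) then √(N:ℝ)/√(a:ℝ) else 0)) := by
  have hN' : (1:ℝ) ≤ N := by exact_mod_cast hN
  have hD := hG.1
  have hη : q^4 * (N:ℝ)^2 ≤ 1 := by
    have : q^4 * (N:ℝ)^2 = (q^2*N)^2 := by ring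
    rw [this]
    have h1 : 0 ≤ q^2 * N := by positivity
    nlinarith
  have eN : √(N:ℝ)^2 = N := Real.sq_sqrt (by positivity)
  have hsum : 0 ≤ ∑ a ∈ Icc 1 ⌊1/(N*q^2)⌋₊, (if (¬ IsSquare (x.1 * x.2) ∧
          dst (2 * a * √((x.1 * x.2 : ℕ):ℝ)) ≤ 160*N*√(N:ℝ)*q^4) then √(N:ℝ)/√(a:ℝ) else 0) := by
    apply Finset.sum_nonneg
    intro a _
    split_ifs
    · positivity
    · exact le_rfl
  have hq4 : 0 < q^4 := by positivity
  by_cases hsq : IsSquare (x.1 * x.2)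
  · have := R_boundB' N 1 D hN le_rfl hG s t (q^4) hs ht hq4 hη hη2 x hx h0 (by intro p h1 h2; omega)
      2 (√(N:ℝ)) (by norm_num) (by positivity) (by rw [eN]; push_cast; linarith)
    rw [if_pos hsq]
    refine this.trans ?_
    have h1 : 0 ≤ D * √(N:ℝ) := by positivity
    have h2 : 0 ≤ 400000 * D * (N * q) := by positivity
    have h3 := mul_nonneg (by positivity : 0 ≤ 400000 * D) hsum
    linarith
  · rw [if_neg hsq, zero_add]
    set α := 1/(N*q^2) with hα
    have hα1 : 1 ≤ α := by rw [hα, one_le_div (by positivity)]; linarith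
    have hα2 : α ≤ 256 * N := by
      rw [hα, div_le_iff₀ (by positivity)]
      nlinarith
    by_cases hbad : ∃ p : ℕ, 1 ≤ p ∧ p < ⌈α⌉₊ ∧ dst (2 * p * √((x.1 * x.2 : ℕ):ℝ)) ≤ 160*N*√(N:ℝ)*q^4
    · set a := Nat.find hbad with ha
      obtain ⟨ha1, ha2, ha3⟩ := Nat.find_spec hbad
      rw [← ha] at ha1 ha2 ha3
      have ha1' : (1:ℝ) ≤ a := by exact_mod_cast ha1
      have haα : (a:ℝ) < α := Nat.lt_ceil.1 ha2
      have hamem : a ∈ Icc 1 ⌊α⌋₊ := by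
        rw [Finset.mem_Icc]
        exact ⟨ha1, Nat.le_floor haα.le⟩
      have hea : √(a:ℝ)^2 = a := Real.sq_sqrt (by positivity)
      have := R_boundB' N a D hN ha1 hG s t (q^4) hs ht hq4 hη hη2 x hx h0 (by
        intro p hp1 hp2
        have h := Nat.find_min hbad hp2
        by_contra hcon
        push Not at hcon
        exact h ⟨hp1, hp2.trans ha2, hcon⟩) 20 (√(N:ℝ)/√(a:ℝ)) (by norm_num) (by positivity) (by
          rw [div_pow, eN, hea]
          have : 1 ≤ 256 * ((N:ℝ) / a) := by
            rw [← mul_div_assoc, one_le_div (by positivity)]; linarith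
          have h5 : 0 ≤ (N:ℝ)/a := by positivity
          linarith)
      refine this.trans ?_
      have h1 := Finset.single_le_sum (f := fun a : ℕ => (if (¬ IsSquare (x.1 * x.2) ∧
          dst (2 * a * √((x.1 * x.2 : ℕ):ℝ)) ≤ 160*N*√(N:ℝ)*q^4) then √(N:ℝ)/√(a:ℝ) else 0)) (by
          intro a _
          split_ifs
          · positivity
          · exact le_rfl) hamem
      rw [if_pos ⟨hsq, ha3⟩] at h1
      have h2 : 0 ≤ 400000 * D * (N * q) := by positivity
      have h3 := mul_le_mul_of_nonneg_left h1 (by positivity : 0 ≤ 400000 * D)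
      linarith
    · push Not at hbad
      have hA1 : 1 ≤ ⌈α⌉₊ := Nat.one_le_ceil_iff.2 (by linarith)
      have hAα : α ≤ ⌈α⌉₊ := Nat.le_ceil _
      have := R_boundB' N ⌈α⌉₊ D hN hA1 hG s t (q^4) hs ht hq4 hη hη2 x hx h0 hbad
        20 (N*q) (by norm_num) (by positivity) (by
          have h1 : (N:ℝ)/⌈α⌉₊ ≤ N / α := by gcongr
          have h2 : (N:ℝ)/α = (N*q)^2 := by rw [hα]; field_simp
          have h3 : 1 ≤ 256 * ((N:ℝ)*q)^2 := by nlinarith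
          rw [h2] at h1
          linarith)
      refine this.trans ?_
      have h3 := mul_nonneg (by positivity : 0 ≤ 400000 * D) hsum
      linarith

lemma sum_sq_part (N : ℕ) (D : ℝ) (hN : 1 ≤ N) (hG : Good N D) :
    ∑ x ∈ P2 N, om x.1 * om x.2 * (if IsSquare (x.1 * x.2) then √(N:ℝ) else 0)
      ≤ D^4 * √(N:ℝ) := by
  have hD := hG.1
  have h1 := sum_omom_prod N D hN hG ((Icc 1 (N^2)).filter (fun ν => IsSquare ν))
  have h2 : ∑ ν ∈ ((Icc 1 (N^2)).filter (fun ν => IsSquare ν)).filter (fun ν => 1 ≤ ν ∧ ν ≤ N^2), ww ν ≤ D := by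
    refine le_trans ?_ (hG.2 N (good_le N N hN le_rfl)).2
    apply sum_le_of_inj _ _ Nat.sqrt
    · intro ν hν
      simp only [Finset.mem_filter, Finset.mem_Icc] at hν ⊢
      obtain ⟨r, rfl⟩ := hν.1.2
      rw [Nat.sqrt_eq]
      have := hν.2
      constructor <;> nlinarith
    · intro ν hν μ hμ h
      simp only [Finset.mem_filter, Finset.mem_Icc] at hν hμ
      obtain ⟨r, rfl⟩ := hν.1.2
      obtain ⟨r', rfl⟩ := hμ.1.2
      rw [Nat.sqrt_eq, Nat.sqrt_eq] at h
      rw [h]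
    · intro k _; positivity
    · intro ν hν
      simp only [Finset.mem_filter, Finset.mem_Icc] at hν
      obtain ⟨r, rfl⟩ := hν.1.2
      rw [Nat.sqrt_eq, ww_mul]
      apply ww_sq_le
      by_contra h
      have : r = 0 := by omega
      subst this
      simp at hν
  have e : ∑ x ∈ P2 N, om x.1 * om x.2 * (if IsSquare (x.1 * x.2) then √(N:ℝ) else 0)
      = (∑ x ∈ (P2 N).filter (fun x => x.1 * x.2 ∈ (Icc 1 (N^2)).filter (fun ν => IsSquare ν)), om x.1 * om x.2) * √(N:ℝ) := by
    rw [Finset.sum_mul, Finset.sum_filter]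
    apply Finset.sum_congr rfl
    intro x hx
    rw [mem_P2] at hx
    have hm : x.1 * x.2 ∈ Icc 1 (N^2) := by
      rw [Finset.mem_Icc, sq]
      exact ⟨Nat.mul_pos hx.1.1 hx.2.1, Nat.mul_le_mul hx.1.2 hx.2.2⟩
    simp only [Finset.mem_filter, hm, true_and]
    split_ifs <;> simp
  rw [e]
  gcongr
  refine h1.trans ?_
  calc D^3 * _ ≤ D^3 * D := by gcongr
    _ = _ := by ring

lemma sum_nsq_part (N a : ℕ) (D ε₂ : ℝ) (hN : 1 ≤ N) (hG : Good N D) (ha : 1 ≤ a)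
    (haN : a ≤ 256 * N) (hε0 : 0 < ε₂) (hε1 : ε₂ ≤ 1) :
    ∑ x ∈ P2 N, om x.1 * om x.2 * (if (¬ IsSquare (x.1 * x.2) ∧
          dst (2 * a * √((x.1 * x.2 : ℕ):ℝ)) ≤ ε₂) then √(N:ℝ)/√(a:ℝ) else 0)
      ≤ 23 * D^4 * (√(N:ℝ) * a * √ε₂ + ε₂ * N) := by
  have hD := hG.1
  have ha' : (1:ℝ) ≤ a := by exact_mod_cast ha
  set S := (Icc 1 (N^2)).filter (fun ν : ℕ => ¬ IsSquare ν ∧ dst (2 * a * √(ν:ℝ)) ≤ ε₂) with hS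
  have h1 := sum_omom_prod N D hN hG S
  have h2 : ∑ ν ∈ S.filter (fun ν => 1 ≤ ν ∧ ν ≤ N^2), ww ν ≤ 23 * D * (a * √a * √ε₂ + ε₂ * √N) := by
    refine le_trans ?_ (I_sum N a D ε₂ hN ha hε0 hε1 (hG.2 _ (good_small N _ hN (by nlinarith))).2)
    apply Finset.sum_le_sum_of_subset_of_nonneg (Finset.filter_subset _ _)
    intro _ _ _
    exact ww_nonneg _
  have e : ∑ x ∈ P2 N, om x.1 * om x.2 * (if (¬ IsSquare (x.1 * x.2) ∧
          dst (2 * a * √((x.1 * x.2 : ℕ):ℝ)) ≤ ε₂) then √(N:ℝ)/√(a:ℝ) else 0)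
      = (∑ x ∈ (P2 N).filter (fun x => x.1 * x.2 ∈ S), om x.1 * om x.2) * (√(N:ℝ)/√(a:ℝ)) := by
    rw [Finset.sum_mul, Finset.sum_filter]
    apply Finset.sum_congr rfl
    intro x hx
    rw [mem_P2] at hx
    have hm : x.1 * x.2 ∈ Icc 1 (N^2) := by
      rw [Finset.mem_Icc, sq]
      exact ⟨Nat.mul_pos hx.1.1 hx.2.1, Nat.mul_le_mul hx.1.2 hx.2.2⟩
    simp only [hS, Finset.mem_filter, hm, true_and]
    split_ifs <;> simp
  rw [e]
  have hsa : 1 ≤ √(a:ℝ) := Real.one_le_sqrt.2 ha'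
  have esN : √(N:ℝ) * √(N:ℝ) = N := Real.mul_self_sqrt (by positivity)
  calc (∑ x ∈ (P2 N).filter (fun x => x.1 * x.2 ∈ S), om x.1 * om x.2) * (√(N:ℝ)/√(a:ℝ))
      ≤ (D^3 * (23 * D * (a * √a * √ε₂ + ε₂ * √N))) * (√(N:ℝ)/√(a:ℝ)) := by
        gcongr
        exact h1.trans (by gcongr)
    _ = 23 * D^4 * (√(N:ℝ) * a * √ε₂ + ε₂ * (√(N:ℝ) * √(N:ℝ)) / √(a:ℝ)) := by
        field_simp
    _ ≤ _ := by
        rw [esN]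
        gcongr
        rw [div_le_iff₀ (by linarith)]
        have : 0 ≤ ε₂ * (N:ℝ) := by positivity
        nlinarith

lemma nsq_empty (N a : ℕ) (ε₂ q : ℝ) (hN : 1 ≤ N) (ha : 1 ≤ a) (hε1 : ε₂ ≤ 1) (hε0 : 0 ≤ ε₂)
    (hq : 0 < q)
    (haα : (a:ℝ) * (N * q^2) ≤ 1) (x : ℕ × ℕ) (hx : x ∈ P2 N)
    (h : ¬ IsSquare (x.1 * x.2) ∧ dst (2 * a * √((x.1 * x.2 : ℕ):ℝ)) ≤ ε₂) :
    q^2 ≤ 15 * ε₂ := by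
  rw [mem_P2] at hx
  obtain ⟨j, _, h1, h2, h3, h4, _⟩ := I_key a (x.1 * x.2) ha (Nat.mul_pos hx.1.1 hx.2.1) h.1 ε₂ hε1 h.2
  have h5 : √((x.1 * x.2 : ℕ):ℝ) ≤ N := by
    rw [Real.sqrt_le_left (by positivity), sq]
    exact_mod_cast Nat.mul_le_mul hx.1.2 hx.2.2
  have h6 : (j:ℝ) ≤ 3 * a * N := h2.trans (by gcongr)
  have h7 : (1:ℝ) ≤ 5 * ε₂ * (3 * a * N) := h4.trans (by gcongr)
  have h8 : q^2 * 1 ≤ q^2 * (5 * ε₂ * (3 * a * N)) := by gcongr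
  have h9 : 0 ≤ 15 * ε₂ := by positivity
  have h10 := mul_le_mul_of_nonneg_left haα h9
  linarith

lemma QB_real (w q : ℝ) (hw : 1 ≤ w) (hq : 0 < q) (h : 1 ≤ 2400 * (w^6 * q^2)) :
    1 / (w^3 * q^2) ≤ 117649 * (w^6 * q) := by
  rw [div_le_iff₀ (by positivity)]
  have h1 : 1 ≤ 49 * (w^3 * q) := by
    by_contra hc
    push Not at hc
    have : 0 < w^3 * q := by positivity
    nlinarith
  have h2 : 1 ≤ (49 * (w^3 * q))^3 := one_le_pow₀ h1
  nlinarith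

lemma QB_third (N : ℕ) (D : ℝ) (hN : 1 ≤ N) (hG : Good N D) (q : ℝ)
    (hq : 0 < q) (hq1 : q ≤ 1) (hqN2 : 1 ≤ 16 * q * N)
    (hε1 : 160*N*√(N:ℝ)*q^4 ≤ 1) :
    ∑ a ∈ Icc 1 ⌊1/(N*q^2)⌋₊, ∑ x ∈ P2 N, om x.1 * om x.2 * (if (¬ IsSquare (x.1 * x.2) ∧
          dst (2 * a * √((x.1 * x.2 : ℕ):ℝ)) ≤ 160*N*√(N:ℝ)*q^4) then √(N:ℝ)/√(a:ℝ) else 0)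
      ≤ 4 * 10^7 * D^4 * (N * √(N:ℝ) * q) := by
  have hN' : (1:ℝ) ≤ N := by exact_mod_cast hN
  have hD := hG.1
  set ε₂ := 160*N*√(N:ℝ)*q^4 with hε
  have hs0 : 0 < √(N:ℝ) := Real.sqrt_pos.2 (by linarith)
  have hε0 : 0 < ε₂ := by positivity
  obtain ⟨w, hw1, hw2⟩ : ∃ w : ℝ, 1 ≤ w ∧ w^2 = √(N:ℝ) :=
    ⟨√(√(N:ℝ)), Real.one_le_sqrt.2 (Real.one_le_sqrt.2 hN'), Real.sq_sqrt hs0.le⟩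
  have hw4 : w^4 = N := by
    have : w^4 = (w^2)^2 := by ring
    rw [this, hw2, Real.sq_sqrt (by linarith)]
  have hw0 : 0 < w := by linarith
  set α := 1/(N*q^2) with hα
  have hα0 : 0 < α := by positivity
  have hα2 : α ≤ 256 * N := by
    rw [hα, div_le_iff₀ (by positivity)]
    nlinarith
  have haα : ∀ a ∈ Icc 1 ⌊α⌋₊, 1 ≤ a ∧ (a:ℝ) ≤ α := by
    intro a ha
    rw [Finset.mem_Icc] at ha
    exact ⟨ha.1, (Nat.le_floor_iff hα0.le).1 ha.2⟩
  by_cases hbig : 1 ≤ 2400 * (w^6 * q^2)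
  · have h1 : ∀ a ∈ Icc 1 ⌊α⌋₊, ∑ x ∈ P2 N, om x.1 * om x.2 * (if (¬ IsSquare (x.1 * x.2) ∧
          dst (2 * a * √((x.1 * x.2 : ℕ):ℝ)) ≤ ε₂) then √(N:ℝ)/√(a:ℝ) else 0)
        ≤ 23 * D^4 * (√(N:ℝ) * α * √ε₂ + ε₂ * N) := by
      intro a ha
      obtain ⟨ha1, ha2⟩ := haα a ha
      have ha3 : a ≤ 256 * N := by
        have := ha2.trans hα2
        exact_mod_cast this
      refine (sum_nsq_part N a D ε₂ hN hG ha1 ha3 hε0 hε1).trans ?_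
      gcongr
    refine (Finset.sum_le_sum h1).trans ?_
    rw [Finset.sum_const, Nat.card_Icc, Nat.add_sub_cancel, nsmul_eq_mul]
    have h2 : (⌊α⌋₊:ℝ) ≤ α := Nat.floor_le hα0.le
    have h3 : √ε₂ ≤ 13 * (w^3 * q^2) := by
      rw [Real.sqrt_le_left (by positivity), hε, ← hw2, ← hw4]
      have : 0 ≤ w^6 * q^4 := by positivity
      nlinarith
    have h4 := QB_real w q hw1 hq hbig
    have e1 : α * (w^2 * α * (13 * (w^3 * q^2))) = 13 * (1/(w^3*q^2)) := by
      rw [hα, ← hw4]; field_simp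
    have e2 : α * (ε₂ * N) = 160 * (w^6 * q^2) := by
      rw [hα, hε, ← hw2, ← hw4]; field_simp
    have h5 : w^6 * q^2 ≤ w^6 * q := by
      gcongr
      nlinarith
    calc (⌊α⌋₊:ℝ) * (23 * D^4 * (√(N:ℝ) * α * √ε₂ + ε₂ * N))
        ≤ α * (23 * D^4 * (w^2 * α * (13 * (w^3 * q^2)) + ε₂ * N)) := by
          rw [← hw2]; gcongr
      _ = 23 * D^4 * (α * (w^2 * α * (13 * (w^3 * q^2))) + α * (ε₂ * N)) := by ring
      _ ≤ 23 * D^4 * (13 * (117649 * (w^6 * q)) + 160 * (w^6 * q)) := by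
          rw [e1, e2]; gcongr
      _ = 35180731 * D^4 * (w^4 * w^2 * q) := by ring
      _ ≤ 4 * 10^7 * D^4 * (N * √(N:ℝ) * q) := by
          rw [hw4, hw2]
          have : 0 ≤ D^4 * (N * √(N:ℝ) * q) := by positivity
          nlinarith
  · push Not at hbig
    have : ∑ a ∈ Icc 1 ⌊α⌋₊, ∑ x ∈ P2 N, om x.1 * om x.2 * (if (¬ IsSquare (x.1 * x.2) ∧
          dst (2 * a * √((x.1 * x.2 : ℕ):ℝ)) ≤ ε₂) then √(N:ℝ)/√(a:ℝ) else 0) = 0 := by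
      apply Finset.sum_eq_zero
      intro a ha
      apply Finset.sum_eq_zero
      intro x hx
      obtain ⟨ha1, ha2⟩ := haα a ha
      rw [if_neg, mul_zero]
      intro hc
      have h1 : (a:ℝ) * (N * q^2) ≤ 1 := by
        rwa [hα, le_div_iff₀ (by positivity)] at ha2
      have h2 := nsq_empty N a ε₂ q hN ha1 hε1 hε0.le hq h1 x hx hc
      rw [hε, ← hw2, ← hw4] at h2
      have h3 : q^2 * (2400 * (w^6 * q^2)) < q^2 * 1 := by gcongr
      nlinarith
    rw [this]
    positivity

lemma QB (N : ℕ) (D : ℝ) (hN : 1 ≤ N) (hG : Good N D) (s t q : ℝ)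
    (hs : Sg s) (ht : Sg t) (hq : 0 < q) (hqN : q^2 * N ≤ 1) (hqN2 : 1 ≤ 16 * q * N)
    (hη2 : 4 * √(N:ℝ) * q^4 ≤ 1) :
    ∑ x ∈ (P2 N).filter (fun x => bet s t x ≠ 0), om x.1 * om x.2 * (Rset N (bet s t x) (q^4)).card
      ≤ 10^14 * D^5 * (N * √(N:ℝ) * q) := by
  have hN' : (1:ℝ) ≤ N := by exact_mod_cast hN
  have hD := hG.1
  have hs0 : 0 < √(N:ℝ) := Real.sqrt_pos.2 (by linarith)
  have eN : √(N:ℝ) * √(N:ℝ) = N := Real.mul_self_sqrt (by linarith)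
  have hq1 : q ≤ 1 := by
    by_contra hc
    push Not at hc
    nlinarith
  have hs1 : 1 ≤ √(N:ℝ) := Real.one_le_sqrt.2 hN'
  have hom : ∀ x : ℕ × ℕ, 0 ≤ om x.1 * om x.2 := fun x => mul_nonneg (om_nonneg _) (om_nonneg _)
  have h45 : D^4 ≤ D^5 := pow_le_pow_right₀ hD (by norm_num)
  by_cases hε1 : 160*N*√(N:ℝ)*q^4 ≤ 1
  · set F : ℕ × ℕ → ℝ := fun x => (if IsSquare (x.1 * x.2) then √(N:ℝ) else 0) + N * q
        + ∑ a ∈ Icc 1 ⌊1/(N*q^2)⌋₊, (if (¬ IsSquare (x.1 * x.2) ∧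
          dst (2 * a * √((x.1 * x.2 : ℕ):ℝ)) ≤ 160*N*√(N:ℝ)*q^4) then √(N:ℝ)/√(a:ℝ) else 0) with hF
    have hF0 : ∀ x, 0 ≤ F x := by
      intro x
      simp only [hF]
      apply add_nonneg
      · apply add_nonneg
        · split_ifs <;> positivity
        · positivity
      · apply Finset.sum_nonneg
        intro a _
        split_ifs <;> positivity
    have h1 : ∑ x ∈ (P2 N).filter (fun x => bet s t x ≠ 0), om x.1 * om x.2 * (Rset N (bet s t x) (q^4)).card
        ≤ ∑ x ∈ P2 N, om x.1 * om x.2 * (400000 * D * F x) := by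
      refine le_trans (Finset.sum_le_sum (g := fun x => om x.1 * om x.2 * (400000 * D * F x)) ?_) ?_
      · intro x hx
        rw [Finset.mem_filter] at hx
        exact mul_le_mul_of_nonneg_left
          (QB_point N D hN hG s t q hs ht hq hqN hqN2 hη2 x hx.1 hx.2) (hom x)
      · apply Finset.sum_le_sum_of_subset_of_nonneg (Finset.filter_subset _ _)
        intro x _ _
        exact mul_nonneg (hom x) (mul_nonneg (by positivity) (hF0 x))
    refine h1.trans ?_
    have h2 : ∑ x ∈ P2 N, om x.1 * om x.2 * (400000 * D * F x)
        = 400000 * D * (∑ x ∈ P2 N, om x.1 * om x.2 * (if IsSquare (x.1 * x.2) then √(N:ℝ) else 0)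
          + (∑ x ∈ P2 N, om x.1 * om x.2) * (N * q)
          + ∑ a ∈ Icc 1 ⌊1/(N*q^2)⌋₊, ∑ x ∈ P2 N, om x.1 * om x.2 * (if (¬ IsSquare (x.1 * x.2) ∧
          dst (2 * a * √((x.1 * x.2 : ℕ):ℝ)) ≤ 160*N*√(N:ℝ)*q^4) then √(N:ℝ)/√(a:ℝ) else 0)) := by
      rw [Finset.sum_comm, Finset.sum_mul, ← Finset.sum_add_distrib, ← Finset.sum_add_distrib,
        Finset.mul_sum]
      apply Finset.sum_congr rfl
      intro x _
      rw [← Finset.mul_sum]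
      simp only [hF]
      ring
    rw [h2]
    have h3 := sum_sq_part N D hN hG
    have h4 := mul_le_mul_of_nonneg_right (sum_omom N D hN hG) (by positivity : 0 ≤ (N:ℝ) * q)
    have h5 := QB_third N D hN hG q hq hq1 hqN2 hε1
    have h6 : √(N:ℝ) ≤ 16 * (N * √(N:ℝ) * q) := by
      have := mul_le_mul_of_nonneg_left hqN2 hs0.le
      linarith
    have h7 : D^4 * √(N:ℝ) ≤ D^4 * (16 * (N * √(N:ℝ) * q)) := by gcongr
    have h8 : 0 ≤ D^4 * (N * √(N:ℝ) * q) := by positivity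
    calc _ ≤ 400000 * D * (D^4 * √(N:ℝ) + D^4 * √(N:ℝ) * (N * q) + 4 * 10^7 * D^4 * (N * √(N:ℝ) * q)) := by
          gcongr
      _ ≤ 400000 * D * (5 * 10^7 * (D^4 * (N * √(N:ℝ) * q))) := by
          gcongr
          linarith
      _ = 2 * 10^13 * D^5 * (N * √(N:ℝ) * q) := by ring
      _ ≤ _ := by gcongr; norm_num
  · push Not at hε1
    have hcard : ∀ x, ((Rset N (bet s t x) (q^4)).card : ℝ) ≤ N^2 := by
      intro x
      have : (Rset N (bet s t x) (q^4)).card ≤ N^2 := by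
        refine (Finset.card_filter_le _ _).trans ?_
        rw [Finset.card_product, Nat.card_Icc, Nat.add_sub_cancel, sq]
      exact_mod_cast this
    have h1 : ∑ x ∈ (P2 N).filter (fun x => bet s t x ≠ 0), om x.1 * om x.2 * (Rset N (bet s t x) (q^4)).card
        ≤ ∑ x ∈ P2 N, om x.1 * om x.2 * (N:ℝ)^2 := by
      refine le_trans (Finset.sum_le_sum (g := fun x => om x.1 * om x.2 * (N:ℝ)^2) ?_) ?_
      · intro x hx
        exact mul_le_mul_of_nonneg_left (hcard x) (hom x)
      · apply Finset.sum_le_sum_of_subset_of_nonneg (Finset.filter_subset _ _)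
        intro x _ _
        exact mul_nonneg (hom x) (by positivity)
    refine h1.trans ?_
    rw [← Finset.sum_mul]
    have h4 := mul_le_mul_of_nonneg_right (sum_omom N D hN hG) (by positivity : 0 ≤ (N:ℝ)^2)
    refine h4.trans ?_
    -- `√N ≤ 160`
    have hsN : √(N:ℝ) ≤ 160 := by
      have h5 : q^4 * (N:ℝ)^2 ≤ 1 := by
        have : q^4 * (N:ℝ)^2 = (q^2*N)^2 := by ring
        rw [this]
        have h1 : 0 ≤ q^2 * N := by positivity
        nlinarith
      have h6 : √(N:ℝ) * 1 ≤ √(N:ℝ) * (160*N*√(N:ℝ)*q^4) := by gcongr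
      have h7 : √(N:ℝ) * (160*N*√(N:ℝ)*q^4) = 160 * (q^4 * (N * (√(N:ℝ) * √(N:ℝ)))) := by ring
      rw [h7, eN] at h6
      nlinarith
    have hN2 : (N:ℝ) ≤ 25600 := by rw [← eN]; nlinarith
    have h8 : (N:ℝ) ≤ 1.1 * 10^10 * q := by
      have : (N:ℝ) * 1 ≤ N * (16 * q * N) := by gcongr
      have h9 : (N:ℝ) * N ≤ 25600 * 25600 := by gcongr
      have h10 : 16 * q * (N * N) ≤ 16 * q * (25600 * 25600) := by gcongr
      nlinarith
    calc D^4 * √(N:ℝ) * (N:ℝ)^2 = D^4 * (N * √(N:ℝ)) * N := by ring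
      _ ≤ D^4 * (N * √(N:ℝ)) * (1.1 * 10^10 * q) := by gcongr
      _ = 1.1 * 10^10 * D^4 * (N * √(N:ℝ) * q) := by ring
      _ ≤ _ := by gcongr; norm_num

lemma abs_prod7 (S z₁ z₂ z₃ z₄ z₅ z₆ z₇ : ℝ) (h₁ : |z₁| ≤ S) (h₂ : |z₂| ≤ S) (h₃ : |z₃| ≤ S)
    (h₄ : |z₄| ≤ S) (h₅ : |z₅| ≤ S) (h₆ : |z₆| ≤ S) (h₇ : |z₇| ≤ S) :
    |z₁ * z₂ * z₃ * z₄ * z₅ * z₆ * z₇| ≤ S^7 := by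
  have h0 : 0 ≤ S := (abs_nonneg _).trans h₁
  rw [abs_mul, abs_mul, abs_mul, abs_mul, abs_mul, abs_mul]
  have : S^7 = S * S * S * S * S * S * S := by ring
  rw [this]
  gcongr

set_option maxHeartbeats 1000000 in
lemma lemC_real (s a b c d : ℝ) (n₁ n₂ n₃ n₄ : ℕ) (ea : a^2 = n₁) (eb : b^2 = n₂) (ec : c^2 = n₃)
    (ed : d^2 = n₄) (hs : 1 ≤ s) (ha : |a| ≤ s) (hb : |b| ≤ s) (hc : |c| ≤ s) (hd : |d| ≤ s)
    (ha1 : 1 ≤ |a|) (hb1 : 1 ≤ |b|) (hc1 : 1 ≤ |c|) (hd1 : 1 ≤ |d|)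
    (hbc : b + c ≠ 0 → 1 ≤ 2 * s * |b + c|) (hbd : b + d ≠ 0 → 1 ≤ 2 * s * |b + d|)
    (hcd : c + d ≠ 0 → 1 ≤ 2 * s * |c + d|) (h0 : a + b + c + d ≠ 0) :
    1 ≤ 16384 * s^8 * |a + b + c + d| := by
  set P := (a+b+c+d)*((a+b+c-d)*(a+b-c+d)*(a+b-c-d)*(a-b+c+d)*(a-b+c-d)*(a-b-c+d)*(a-b-c-d)) with hP
  have eP : P = (((((n₁:ℤ)^2+n₂^2+n₃^2+n₄^2 - 2*(n₁*n₂+n₁*n₃+n₁*n₄+n₂*n₃+n₂*n₄+n₃*n₄))^2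
      - 64*n₁*n₂*n₃*n₄ : ℤ)) : ℝ) := by
    push_cast
    rw [← ea, ← eb, ← ec, ← ed, hP]
    ring
  have hs8 : s ≤ s^8 := le_self_pow₀ hs (by norm_num)
  have habs := abs_nonneg (a + b + c + d)
  have small : 1 ≤ s * |a+b+c+d| → 1 ≤ 16384 * s^8 * |a + b + c + d| := by
    intro h
    have : s * |a+b+c+d| ≤ s^8 * |a+b+c+d| := by gcongr
    nlinarith
  by_cases hP0 : P = 0
  · apply small
    have key : a + b + c + d = 2*d ∨ a + b + c + d = 2*c ∨ a+b+c+d = 2*(c+d) ∨ a+b+c+d = 2*b ∨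
        a+b+c+d = 2*(b+d) ∨ a+b+c+d = 2*(b+c) ∨ a+b+c+d = 2*a := by
      rw [hP] at hP0
      simp only [mul_eq_zero, h0, false_or] at hP0
      rcases hP0 with (((((h | h) | h) | h) | h) | h) | h
      · left; linarith
      · right; left; linarith
      · right; right; left; linarith
      · right; right; right; left; linarith
      · right; right; right; right; left; linarith
      · right; right; right; right; right; left; linarith
      · right; right; right; right; right; right; linarith
    have single : ∀ z : ℝ, 1 ≤ |z| → a+b+c+d = 2*z → 1 ≤ s * |a+b+c+d| := by
      intro z hz h
      rw [h, abs_mul, abs_two]; nlinarith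
    have double : ∀ z : ℝ, (z ≠ 0 → 1 ≤ 2 * s * |z|) → a+b+c+d = 2*z → 1 ≤ s * |a+b+c+d| := by
      intro z hz h
      have hz0 : z ≠ 0 := by
        rintro rfl
        apply h0; rw [h]; ring
      have := hz hz0
      rw [h, abs_mul, abs_two]; linarith
    rcases key with h | h | h | h | h | h | h
    · exact single _ hd1 h
    · exact single _ hc1 h
    · exact double _ hcd h
    · exact single _ hb1 h
    · exact double _ hbd h
    · exact double _ hbc h
    · exact single _ ha1 h
  · have hP1 : 1 ≤ |P| := by
      rw [eP] at hP0 ⊢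
      have h1 : ∀ z : ℤ, (z:ℝ) ≠ 0 → (1:ℝ) ≤ |(z:ℝ)| := by
        intro z hz
        have : z ≠ 0 := by rintro rfl; simp at hz
        exact_mod_cast Int.one_le_abs this
      exact h1 _ hP0
    rw [abs_le] at ha hb hc hd
    have f : ∀ z : ℝ, -(4*s) ≤ z → z ≤ 4*s → |z| ≤ 4*s := fun z h1 h2 => abs_le.2 ⟨h1, h2⟩
    have g : |(a+b+c-d)*(a+b-c+d)*(a+b-c-d)*(a-b+c+d)*(a-b+c-d)*(a-b-c+d)*(a-b-c-d)| ≤ (4*s)^7 := by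
      have e1 := f (a+b+c-d) (by linarith) (by linarith)
      have e2 := f (a+b-c+d) (by linarith) (by linarith)
      have e3 := f (a+b-c-d) (by linarith) (by linarith)
      have e4 := f (a-b+c+d) (by linarith) (by linarith)
      have e5 := f (a-b+c-d) (by linarith) (by linarith)
      have e6 := f (a-b-c+d) (by linarith) (by linarith)
      have e7 := f (a-b-c-d) (by linarith) (by linarith)
      exact abs_prod7 _ _ _ _ _ _ _ _ e1 e2 e3 e4 e5 e6 e7
    rw [hP, abs_mul] at hP1
    have h7 : s^7 ≤ s^8 := pow_le_pow_right₀ hs (by norm_num)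
    calc 1 ≤ _ := hP1
      _ ≤ |a+b+c+d| * (4*s)^7 := by gcongr
      _ = 16384 * s^7 * |a+b+c+d| := by ring
      _ ≤ _ := by gcongr

/-- boxes -/
def Box (N : ℕ) : Finset (ℕ × ℕ × ℕ × ℕ) := Icc 1 N ×ˢ Icc 1 N ×ˢ Icc 1 N ×ˢ Icc 1 N

def vec (x : ℕ × ℕ × ℕ × ℕ) : Fin 4 → ℕ := ![x.1, x.2.1, x.2.2.1, x.2.2.2]

def Del (e : Fin 4 → ℝ) (x : ℕ × ℕ × ℕ × ℕ) : ℝ := ∑ i, e i * √(vec x i:ℝ)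

def Om (x : ℕ × ℕ × ℕ × ℕ) : ℝ := ∏ i, om (vec x i)

lemma Om_nonneg (x : ℕ × ℕ × ℕ × ℕ) : 0 ≤ Om x := Finset.prod_nonneg (fun _ _ => om_nonneg _)

lemma mem_Box {N : ℕ} {x : ℕ × ℕ × ℕ × ℕ} : x ∈ Box N ↔ ∀ i, 1 ≤ vec x i ∧ vec x i ≤ N := by
  simp [Box, vec, Fin.forall_fin_succ]

lemma vec_inj {x y : ℕ × ℕ × ℕ × ℕ} (h : ∀ i, vec x i = vec y i) : x = y := by
  have h0 := h 0
  have h1 := h 1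
  have h2 := h 2
  have h3 := h 3
  simp [vec] at h0 h1 h2 h3
  exact Prod.ext h0 (Prod.ext h1 (Prod.ext h2 h3))

lemma Del_perm (e : Fin 4 → ℝ) (x : ℕ × ℕ × ℕ × ℕ) (σ : Equiv.Perm (Fin 4)) :
    Del e x = e (σ 0) * √(vec x (σ 0):ℝ) + e (σ 1) * √(vec x (σ 1):ℝ)
      + e (σ 2) * √(vec x (σ 2):ℝ) + e (σ 3) * √(vec x (σ 3):ℝ) := by
  unfold Del
  rw [← Equiv.sum_comp σ, Fin.sum_univ_four]

lemma Om_perm (x : ℕ × ℕ × ℕ × ℕ) (σ : Equiv.Perm (Fin 4)) :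
    Om x = om (vec x (σ 0)) * om (vec x (σ 1)) * om (vec x (σ 2)) * om (vec x (σ 3)) := by
  unfold Om
  rw [← Equiv.prod_comp σ, Fin.prod_univ_four]

lemma lemC (N : ℕ) (hN : 1 ≤ N) (e : Fin 4 → ℝ) (he : ∀ i, Sg (e i)) (x : ℕ × ℕ × ℕ × ℕ)
    (hx : x ∈ Box N) (h0 : Del e x ≠ 0) : 1 ≤ 16384 * (N:ℝ)^4 * |Del e x| := by
  rw [mem_Box] at hx
  have hN' : (1:ℝ) ≤ N := by exact_mod_cast hN
  have hab : ∀ i, |e i * √(vec x i:ℝ)| = √(vec x i:ℝ) := by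
    intro i
    rw [abs_mul, abs_of_nonneg (Real.sqrt_nonneg _)]
    rcases he i with h | h <;> rw [h] <;> simp
  have h1 : ∀ i, |e i * √(vec x i:ℝ)| ≤ √(N:ℝ) := by
    intro i
    rw [hab]
    exact Real.sqrt_le_sqrt (by exact_mod_cast (hx i).2)
  have h2 : ∀ i, 1 ≤ |e i * √(vec x i:ℝ)| := by
    intro i
    rw [hab]
    exact Real.one_le_sqrt.2 (by exact_mod_cast (hx i).1)
  have h3 : ∀ i, (e i * √(vec x i:ℝ))^2 = (vec x i:ℕ) := by
    intro i
    rw [mul_pow, Real.sq_sqrt (by positivity)]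
    rcases he i with h | h <;> rw [h] <;> simp
  have h4 : ∀ i j, e i * √(vec x i:ℝ) + e j * √(vec x j:ℝ) ≠ 0 →
      1 ≤ 2 * √(N:ℝ) * |e i * √(vec x i:ℝ) + e j * √(vec x j:ℝ)| := by
    intro i j h
    exact (bet_bounds N hN (e i) (e j) (he i) (he j) (vec x i, vec x j)
      (mem_P2.2 ⟨hx i, hx j⟩) h).1
  have eD : Del e x = e 0 * √(vec x 0:ℝ) + e 1 * √(vec x 1:ℝ)
      + e 2 * √(vec x 2:ℝ) + e 3 * √(vec x 3:ℝ) := by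
    unfold Del
    rw [Fin.sum_univ_four]
  rw [eD] at h0 ⊢
  have := lemC_real (√(N:ℝ)) _ _ _ _ _ _ _ _ (h3 0) (h3 1) (h3 2) (h3 3) (Real.one_le_sqrt.2 hN')
    (h1 0) (h1 1) (h1 2) (h1 3) (h2 0) (h2 1) (h2 2) (h2 3) (h4 1 2) (h4 1 3) (h4 2 3) h0
  have e8 : √(N:ℝ)^8 = (N:ℝ)^4 := by
    calc √(N:ℝ)^8 = (√(N:ℝ)^2)^4 := by ring
      _ = _ := by rw [Real.sq_sqrt (by positivity)]
  rwa [e8] at this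

lemma exists_perm (i j : Fin 4) (h : i ≠ j) : ∃ σ : Equiv.Perm (Fin 4), σ 0 = i ∧ σ 1 = j := by
  revert i j
  decide

/-- selection of a top index and of a large index of opposite sign -/
lemma select (N : ℕ) (hN : 1 ≤ N) (e : Fin 4 → ℝ) (he : ∀ i, Sg (e i)) (x : ℕ × ℕ × ℕ × ℕ)
    (η : ℝ) (hη2 : 4 * √(N:ℝ) * η ≤ 1)
    (hmax : ∃ i, N < 2 * vec x i) (hd : |Del e x| ≤ η) :
    ∃ σ : Equiv.Perm (Fin 4), N ≤ 64 * vec x (σ 0) ∧ N ≤ 64 * vec x (σ 1) ∧ e (σ 1) = - e (σ 0) := by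
  obtain ⟨i, hi⟩ := hmax
  have hN' : (1:ℝ) ≤ N := by exact_mod_cast hN
  have hs1 : 1 ≤ √(N:ℝ) := Real.one_le_sqrt.2 hN'
  suffices h : ∃ j, e j = - e i ∧ N ≤ 64 * vec x j by
    obtain ⟨j, h1, h2⟩ := h
    have hij : i ≠ j := by
      rintro rfl
      rcases he i with h | h <;> rw [h] at h1 <;> norm_num at h1
    obtain ⟨σ, h3, h4⟩ := exists_perm i j hij
    refine ⟨σ, ?_, ?_, ?_⟩
    · rw [h3]; omega
    · rw [h4]; exact h2
    · rw [h3, h4]; exact h1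
  by_contra hcon
  push Not at hcon
  have hlow : ∀ j, -(√(N:ℝ)/8) ≤ e i * e j * √(vec x j:ℝ) := by
    intro j
    have hv : 0 ≤ √(vec x j:ℝ) := Real.sqrt_nonneg _
    by_cases hj : e j = - e i
    · have h1 := hcon j hj
      have h2 : e i * e j = -1 := by
        rw [hj]; rcases he i with h | h <;> rw [h] <;> norm_num
      rw [h2]
      have h3 : √(vec x j:ℝ) ≤ √(N:ℝ)/8 := by
        rw [Real.sqrt_le_left (by positivity), div_pow, Real.sq_sqrt (by positivity)]
        have : (64:ℝ) * vec x j < N := by exact_mod_cast h1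
        linarith
      linarith
    · have h2 : e i * e j = 1 := by
        rcases he i with h | h <;> rcases he j with h' | h' <;>
          first
          | (rw [h, h']; norm_num; done)
          | (exfalso; apply hj; simp [h, h']; done)
      rw [h2]; linarith
  have htop : 7/10 * √(N:ℝ) ≤ e i * e i * √(vec x i:ℝ) := by
    have h2 : e i * e i = 1 := by
      rcases he i with h | h <;> rw [h] <;> norm_num
    rw [h2, one_mul]
    apply Real.le_sqrt_of_sq_le
    rw [mul_pow, Real.sq_sqrt (by positivity)]
    have : (N:ℝ) < 2 * vec x i := by exact_mod_cast hi
    linarith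
  have hη : η ≤ √(N:ℝ)/4 := by nlinarith
  have hsum : e i * Del e x = e i * e 0 * √(vec x 0:ℝ) + e i * e 1 * √(vec x 1:ℝ)
      + e i * e 2 * √(vec x 2:ℝ) + e i * e 3 * √(vec x 3:ℝ) := by
    unfold Del
    rw [Fin.sum_univ_four]; ring
  have hup : e i * Del e x ≤ η := by
    rw [abs_le] at hd
    rcases he i with h | h <;> rw [h] <;> linarith [hd.1, hd.2]
  have l0 := hlow 0
  have l1 := hlow 1
  have l2 := hlow 2
  have l3 := hlow 3
  fin_cases i <;> simp only [Fin.zero_eta, Fin.mk_one, Fin.reduceFinMk] at * <;> linarith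

lemma ww_big (N m : ℕ) (hN : 1 ≤ N) (h : N ≤ 64 * m) : ww m * √(√(N:ℝ)) * √(N:ℝ) ≤ 8 * √8 := by
  have hN' : (1:ℝ) ≤ N := by exact_mod_cast hN
  have hm : 1 ≤ m := by omega
  have hm' : (0:ℝ) < m := by exact_mod_cast hm
  have h1 : √(N:ℝ) ≤ 8 * √(m:ℝ) := by
    rw [Real.sqrt_le_left (by positivity), mul_pow, Real.sq_sqrt (by positivity)]
    have : (N:ℝ) ≤ 64 * m := by exact_mod_cast h
    linarith
  have h2 : √(√(N:ℝ)) ≤ √8 * √(√(m:ℝ)) := by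
    rw [← Real.sqrt_mul (by norm_num)]
    exact Real.sqrt_le_sqrt h1
  have h3 : 0 < √(m:ℝ) := Real.sqrt_pos.2 hm'
  have h4 : 0 < √(√(m:ℝ)) := Real.sqrt_pos.2 h3
  rw [ww_eq m hm]
  calc 1 / (√(m:ℝ) * √(√(m:ℝ))) * √(√(N:ℝ)) * √(N:ℝ)
      ≤ 1 / (√(m:ℝ) * √(√(m:ℝ))) * (√8 * √(√(m:ℝ))) * (8 * √(m:ℝ)) := by gcongr
    _ = _ := by field_simp

lemma omom_big (N : ℕ) (D : ℝ) (hN : 1 ≤ N) (hG : Good N D) (m n : ℕ) (hm : m ≤ N) (hn : n ≤ N)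
    (h1 : N ≤ 64 * m) (h2 : N ≤ 64 * n) : om m * om n ≤ 512 * D^2 / (N * √(N:ℝ)) := by
  have hN' : (1:ℝ) ≤ N := by exact_mod_cast hN
  have hD := hG.1
  have a1 := om_le N D hN hG m hm
  have a2 := om_le N D hN hG n hn
  have b1 := ww_big N m hN h1
  have b2 := ww_big N n hN h2
  have hs : 0 < √(N:ℝ) := Real.sqrt_pos.2 (by linarith)
  have e1 : √(N:ℝ) * √(N:ℝ) = N := Real.mul_self_sqrt (by linarith)
  have e2 : √(√(N:ℝ)) * √(√(N:ℝ)) = √(N:ℝ) := Real.mul_self_sqrt hs.le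
  have e3 : √(8:ℝ) * √8 = 8 := Real.mul_self_sqrt (by norm_num)
  have hw1 := ww_nonneg m
  have hw2 := ww_nonneg n
  rw [le_div_iff₀ (by positivity)]
  calc om m * om n * (N * √(N:ℝ)) ≤ (D * ww m) * (D * ww n) * (N * √(N:ℝ)) := by
        gcongr
        exact om_nonneg n
    _ = D^2 * ((ww m * √(√(N:ℝ)) * √(N:ℝ)) * (ww n * √(√(N:ℝ)) * √(N:ℝ))) := by
        calc _ = D^2 * (ww m * ww n * (N * √(N:ℝ))) := by ring
          _ = D^2 * (ww m * ww n * ((√(N:ℝ) * √(N:ℝ)) * (√(√(N:ℝ)) * √(√(N:ℝ))))) := by rw [e1, e2]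
          _ = _ := by ring
    _ ≤ D^2 * ((8 * √8) * (8 * √8)) := by gcongr
    _ = D^2 * (64 * (√(8:ℝ) * √8)) := by ring
    _ = _ := by rw [e3]; ring

/-- the dyadic-type sum; `nz` says whether zero values of `Δ` are excluded -/
def Wset (nz : Prop) (N : ℕ) (e : Fin 4 → ℝ) (η : ℝ) : Finset (ℕ × ℕ × ℕ × ℕ) :=
  (Box N).filter (fun x => (∃ i, N < 2 * vec x i) ∧ |Del e x| ≤ η ∧ (nz → Del e x ≠ 0))

lemma W_sigma (nz : Prop) (N : ℕ) (D : ℝ) (hN : 1 ≤ N) (hG : Good N D) (e : Fin 4 → ℝ)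
    (he : ∀ i, Sg (e i)) (η : ℝ) (hη2 : 4 * √(N:ℝ) * η ≤ 1) (σ : Equiv.Perm (Fin 4)) (B : ℝ)
    (hσ : e (σ 1) = - e (σ 0))
    (hB : ∀ s t, Sg s → Sg t → ∑ y ∈ (P2 N).filter (fun y => nz → bet s t y ≠ 0),
        om y.1 * om y.2 * (Rset N (bet s t y) η).card ≤ B) :
    ∑ x ∈ (Wset nz N e η).filter (fun x => N ≤ 64 * vec x (σ 0) ∧ N ≤ 64 * vec x (σ 1)), Om x
      ≤ 512 * D^2 / (N * √(N:ℝ)) * B := by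
  have hN' : (1:ℝ) ≤ N := by exact_mod_cast hN
  set s := - (e (σ 0) * e (σ 2)) with hs
  set t := - (e (σ 0) * e (σ 3)) with ht
  have hprod : ∀ a b : ℝ, Sg a → Sg b → Sg (-(a * b)) := by
    intro a b ha hb
    rcases ha with rfl | rfl <;> rcases hb with rfl | rfl <;> simp [Sg]
  have hss : Sg s := hprod _ _ (he _) (he _)
  have hst : Sg t := hprod _ _ (he _) (he _)
  have h1 := hB s t hss hst
  set K := 512 * D^2 / (N * √(N:ℝ)) with hK
  have hK0 : 0 ≤ K := by positivity
  set tt := ((P2 N).filter (fun y => nz → bet s t y ≠ 0)).sigma (fun y => Rset N (bet s t y) η) with htt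
  have e0 : e (σ 0) * e (σ 0) = 1 := by rcases he (σ 0) with h | h <;> rw [h] <;> norm_num
  have hrel : ∀ x : ℕ × ℕ × ℕ × ℕ, e (σ 0) * Del e x
      = √(vec x (σ 0):ℝ) - √(vec x (σ 1):ℝ) - bet s t (vec x (σ 2), vec x (σ 3)) := by
    intro x
    rw [Del_perm e x σ, hσ]
    unfold bet
    simp only [hs, ht]
    linear_combination (√(vec x (σ 0):ℝ) - √(vec x (σ 1):ℝ)) * e0
  have hstep : ∑ x ∈ (Wset nz N e η).filter (fun x => N ≤ 64 * vec x (σ 0) ∧ N ≤ 64 * vec x (σ 1)), Om x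
      ≤ ∑ p ∈ tt, K * (om p.1.1 * om p.1.2) := by
    apply sum_le_of_inj _ _ (fun x => (⟨(vec x (σ 2), vec x (σ 3)), (vec x (σ 0), vec x (σ 1))⟩ : Σ _ : ℕ × ℕ, ℕ × ℕ))
    · intro x hx
      rw [Wset, Finset.mem_filter, Finset.mem_filter, mem_Box] at hx
      obtain ⟨⟨hbox, _, hd, hnz⟩, _⟩ := hx
      have hR : (vec x (σ 0), vec x (σ 1)) ∈ Rset N (bet s t (vec x (σ 2), vec x (σ 3))) η := by
        simp only [Rset, Finset.mem_filter, Finset.mem_product, Finset.mem_Icc]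
        refine ⟨⟨hbox _, hbox _⟩, ?_⟩
        rw [← hrel, abs_mul]
        have : |e (σ 0)| = 1 := by rcases he (σ 0) with h | h <;> rw [h] <;> simp
        rw [this, one_mul]
        exact hd
      rw [htt, Finset.mem_sigma, Finset.mem_filter]
      refine ⟨⟨mem_P2.2 ⟨hbox _, hbox _⟩, ?_⟩, hR⟩
      intro hn hb
      simp only at hb
      rw [hb] at hR
      have h3 := Rset_zero N η hN hη2 _ hR
      simp only at h3
      apply hnz hn
      have h4 := hrel x
      rw [hb, h3] at h4
      have : e (σ 0) * (e (σ 0) * Del e x) = 0 := by rw [h4]; ring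
      rw [← mul_assoc, e0, one_mul] at this
      exact this
    · intro x _ y _ h
      simp only [Sigma.mk.injEq, Prod.mk.injEq, heq_eq_eq] at h
      apply vec_inj
      have key : ∀ i : Fin 4, vec x (σ i) = vec y (σ i) := by
        intro i
        fin_cases i
        · exact h.2.1
        · exact h.2.2
        · exact h.1.1
        · exact h.1.2
      intro i
      have := key (σ.symm i)
      simpa using this
    · intro p _
      exact mul_nonneg hK0 (mul_nonneg (om_nonneg _) (om_nonneg _))
    · intro x hx
      rw [Wset, Finset.mem_filter, Finset.mem_filter, mem_Box] at hx
      obtain ⟨⟨hbox, _⟩, hl1, hl2⟩ := hx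
      have := omom_big N D hN hG _ _ (hbox (σ 0)).2 (hbox (σ 1)).2 hl1 hl2
      rw [Om_perm x σ]
      calc om (vec x (σ 0)) * om (vec x (σ 1)) * om (vec x (σ 2)) * om (vec x (σ 3))
          = om (vec x (σ 0)) * om (vec x (σ 1)) * (om (vec x (σ 2)) * om (vec x (σ 3))) := by ring
        _ ≤ _ := mul_le_mul_of_nonneg_right this (mul_nonneg (om_nonneg _) (om_nonneg _))
  refine hstep.trans ?_
  rw [htt, Finset.sum_sigma]
  simp only [Finset.sum_const, nsmul_eq_mul]
  refine le_trans (le_of_eq ?_) (mul_le_mul_of_nonneg_left h1 hK0)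
  rw [Finset.mul_sum]
  apply Finset.sum_congr rfl
  intro y _
  ring

lemma W_small (nz : Prop) (N : ℕ) (D : ℝ) (hN : 1 ≤ N) (hG : Good N D) (e : Fin 4 → ℝ)
    (he : ∀ i, Sg (e i)) (η : ℝ) (hη2 : 4 * √(N:ℝ) * η ≤ 1) (B : ℝ) (hB0 : 0 ≤ B)
    (hB : ∀ s t, Sg s → Sg t → ∑ y ∈ (P2 N).filter (fun y => nz → bet s t y ≠ 0),
        om y.1 * om y.2 * (Rset N (bet s t y) η).card ≤ B) :
    ∑ x ∈ Wset nz N e η, Om x ≤ 24 * (512 * D^2 / (N * √(N:ℝ)) * B) := by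
  have hK0 : 0 ≤ 512 * D^2 / (N * √(N:ℝ)) * B := by positivity
  have h1 : ∀ x ∈ Wset nz N e η, Om x ≤ ∑ σ : Equiv.Perm (Fin 4),
      if (N ≤ 64 * vec x (σ 0) ∧ N ≤ 64 * vec x (σ 1)) ∧ e (σ 1) = - e (σ 0) then Om x else 0 := by
    intro x hx
    rw [Wset, Finset.mem_filter] at hx
    obtain ⟨σ, h1, h2, h3⟩ := select N hN e he x η hη2 hx.2.1 hx.2.2.1
    refine le_trans (le_of_eq ?_) (Finset.single_le_sum (f := fun σ : Equiv.Perm (Fin 4) =>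
      if (N ≤ 64 * vec x (σ 0) ∧ N ≤ 64 * vec x (σ 1)) ∧ e (σ 1) = - e (σ 0) then Om x else 0) ?_
      (Finset.mem_univ σ))
    · rw [if_pos ⟨⟨h1, h2⟩, h3⟩]
    · intro σ _
      split_ifs
      · exact Om_nonneg x
      · exact le_rfl
  refine (Finset.sum_le_sum h1).trans ?_
  rw [Finset.sum_comm]
  have h2 : ∀ σ ∈ (Finset.univ : Finset (Equiv.Perm (Fin 4))), ∑ x ∈ Wset nz N e η,
      (if (N ≤ 64 * vec x (σ 0) ∧ N ≤ 64 * vec x (σ 1)) ∧ e (σ 1) = - e (σ 0) then Om x else 0)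
      ≤ 512 * D^2 / (N * √(N:ℝ)) * B := by
    intro σ _
    by_cases hσ : e (σ 1) = - e (σ 0)
    · simp only [hσ, and_true]
      rw [← Finset.sum_filter]
      exact W_sigma nz N D hN hG e he η hη2 σ B hσ hB
    · simp only [hσ, and_false, if_false, Finset.sum_const_zero]
      exact hK0
  refine (Finset.sum_le_sum h2).trans ?_
  rw [Finset.sum_const, Finset.card_univ, Fintype.card_perm, Fintype.card_fin, nsmul_eq_mul]
  norm_num [Nat.factorial]

lemma fiber_count (N : ℕ) (s : Finset ℕ) (c η : ℝ) (hs : ∀ n ∈ s, n ≤ N)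
    (h : ∀ n ∈ s, |√(n:ℝ) - c| ≤ η) (hη : 1 ≤ 4 * √(N:ℝ) * η) : (s.card:ℝ) ≤ 12 * √(N:ℝ) * η := by
  rcases s.eq_empty_or_nonempty with rfl | ⟨m, hm⟩
  · simp; linarith
  · have hr : 0 ≤ 4 * √(N:ℝ) * η := by linarith
    have := card_near s m (4 * √(N:ℝ) * η) hr (by
      intro n hn
      have h1 := h n hn
      have h2 := h m hm
      have e1 : √(m:ℝ)^2 = m := Real.sq_sqrt (by positivity)
      have e2 : √(n:ℝ)^2 = n := Real.sq_sqrt (by positivity)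
      have h3 : √(m:ℝ) ≤ √(N:ℝ) := Real.sqrt_le_sqrt (by exact_mod_cast hs m hm)
      have h4 : √(n:ℝ) ≤ √(N:ℝ) := Real.sqrt_le_sqrt (by exact_mod_cast hs n hn)
      have h5 : (n:ℝ) - m = (√(n:ℝ) + √(m:ℝ)) * (√(n:ℝ) - √(m:ℝ)) := by
        linear_combination e1 - e2
      have h6 : |√(n:ℝ) - √(m:ℝ)| ≤ 2 * η := by
        rw [abs_le] at *
        constructor <;> linarith [h1.1, h1.2, h2.1, h2.2]
      rw [h5, abs_mul, abs_of_nonneg (by positivity)]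
      calc (√(n:ℝ) + √(m:ℝ)) * |√(n:ℝ) - √(m:ℝ)| ≤ (√(N:ℝ) + √(N:ℝ)) * (2 * η) := by gcongr
        _ = _ := by ring)
    linarith

lemma W_large (nz : Prop) (N : ℕ) (D : ℝ) (hN : 1 ≤ N) (hG : Good N D) (e : Fin 4 → ℝ)
    (he : ∀ i, Sg (e i)) (η : ℝ) (hη : 1 ≤ 4 * √(N:ℝ) * η) :
    ∑ x ∈ Wset nz N e η, Om x ≤ 24 * (300 * D^7 * (η * √(N:ℝ))) := by
  have hN' : (1:ℝ) ≤ N := by exact_mod_cast hN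
  have hD := hG.1
  have hs0 : 0 < √(N:ℝ) := Real.sqrt_pos.2 (by linarith)
  have hw0 : 0 < √(√(N:ℝ)) := Real.sqrt_pos.2 hs0
  have ew : √(√(N:ℝ)) * √(√(N:ℝ)) = √(N:ℝ) := Real.mul_self_sqrt hs0.le
  have h1 : ∀ x ∈ Wset nz N e η, Om x ≤ ∑ σ : Equiv.Perm (Fin 4),
      if N < 2 * vec x (σ 0) then Om x else 0 := by
    intro x hx
    rw [Wset, Finset.mem_filter] at hx
    obtain ⟨i, hi⟩ := hx.2.1
    obtain ⟨σ, hσ⟩ : ∃ σ : Equiv.Perm (Fin 4), σ 0 = i := ⟨Equiv.swap 0 i, by simp⟩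
    refine le_trans (le_of_eq ?_) (Finset.single_le_sum (f := fun σ : Equiv.Perm (Fin 4) =>
      if N < 2 * vec x (σ 0) then Om x else 0) ?_ (Finset.mem_univ σ))
    · rw [hσ, if_pos hi]
    · intro σ _
      split_ifs
      · exact Om_nonneg x
      · exact le_rfl
  refine (Finset.sum_le_sum h1).trans ?_
  rw [Finset.sum_comm]
  have h2 : ∀ σ ∈ (Finset.univ : Finset (Equiv.Perm (Fin 4))), ∑ x ∈ Wset nz N e η,
      (if N < 2 * vec x (σ 0) then Om x else 0) ≤ 300 * D^7 * (η * √(N:ℝ)) := by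
    intro σ _
    rw [← Finset.sum_filter]
    set g : ℕ × ℕ × ℕ → ℝ := fun p => 23 * D / (√(√(N:ℝ)) * √(N:ℝ)) * (om p.1 * (om p.2.1 * om p.2.2)) with hg
    have h3 := sum_le_of_fiber ((Wset nz N e η).filter (fun x => N < 2 * vec x (σ 0)))
      (Icc 1 N ×ˢ Icc 1 N ×ˢ Icc 1 N) (fun x => (vec x (σ 1), vec x (σ 2), vec x (σ 3))) Om g
      (12 * √(N:ℝ) * η) ?_ ?_ ?_ ?_
    · refine h3.trans ?_
      have h4 := sum_om N D hN hG
      have h0 : 0 ≤ ∑ n ∈ Icc 1 N, om n := Finset.sum_nonneg (fun n _ => om_nonneg n)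
      have h5 : ∑ p ∈ Icc 1 N ×ˢ Icc 1 N ×ˢ Icc 1 N, g p
          = 23 * D / (√(√(N:ℝ)) * √(N:ℝ)) * ((∑ n ∈ Icc 1 N, om n) * ((∑ n ∈ Icc 1 N, om n) * (∑ n ∈ Icc 1 N, om n))) := by
        simp only [hg]
        have inner : ∑ p ∈ Icc 1 N ×ˢ Icc 1 N, om p.1 * om p.2
            = (∑ n ∈ Icc 1 N, om n) * (∑ n ∈ Icc 1 N, om n) := by
          rw [Finset.sum_product, Finset.sum_mul_sum]
        rw [← Finset.mul_sum, Finset.sum_product]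
        simp only [← Finset.mul_sum, inner, ← Finset.sum_mul]
      rw [h5]
      have hη0 : 0 ≤ η := by
        by_contra hc
        push Not at hc
        nlinarith
      calc 12 * √(N:ℝ) * η * (23 * D / (√(√(N:ℝ)) * √(N:ℝ)) * ((∑ n ∈ Icc 1 N, om n) * ((∑ n ∈ Icc 1 N, om n) * (∑ n ∈ Icc 1 N, om n))))
          ≤ 12 * √(N:ℝ) * η * (23 * D / (√(√(N:ℝ)) * √(N:ℝ)) * ((D^2 * √(√(N:ℝ))) * ((D^2 * √(√(N:ℝ))) * (D^2 * √(√(N:ℝ)))))) := by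
            gcongr
        _ = 12 * √(N:ℝ) * η * (23 * D^7 * ((√(√(N:ℝ)) * √(√(N:ℝ))) * √(√(N:ℝ))/ (√(√(N:ℝ)) * √(N:ℝ)))) := by ring
        _ = 276 * D^7 * (η * √(N:ℝ)) := by
            rw [ew]; field_simp; ring
        _ ≤ _ := by gcongr; norm_num
    · intro x hx
      rw [Wset, Finset.mem_filter, Finset.mem_filter, mem_Box] at hx
      simp only [Finset.mem_product, Finset.mem_Icc]
      exact ⟨hx.1.1 _, hx.1.1 _, hx.1.1 _⟩
    · intro p _
      simp only [hg]
      have a1 := om_nonneg p.1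
      have a2 := om_nonneg p.2.1
      have a3 := om_nonneg p.2.2
      positivity
    · intro p _
      rw [← Finset.card_image_of_injOn (f := fun x => vec x (σ 0))]
      · apply fiber_count N _ (-(e (σ 0)) * (e (σ 1) * √(p.1:ℝ) + e (σ 2) * √(p.2.1:ℝ) + e (σ 3) * √(p.2.2:ℝ))) η _ _ hη
        · intro n hn
          obtain ⟨x, hx, rfl⟩ := Finset.mem_image.1 hn
          rw [Wset, Finset.mem_filter, Finset.mem_filter, Finset.mem_filter, mem_Box] at hx
          exact (hx.1.1.1 _).2
        · intro n hn
          obtain ⟨x, hx, rfl⟩ := Finset.mem_image.1 hn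
          rw [Wset, Finset.mem_filter, Finset.mem_filter, Finset.mem_filter, mem_Box] at hx
          have h5 := hx.1.1.2.2.1
          have h6 := hx.2
          rw [← h6]
          rw [Del_perm e x σ] at h5
          have : |e (σ 0)| = 1 := by rcases he (σ 0) with h | h <;> rw [h] <;> simp
          rw [← one_mul |_|, ← this, ← abs_mul] at h5
          have e0 : e (σ 0) * e (σ 0) = 1 := by rcases he (σ 0) with h | h <;> rw [h] <;> norm_num
          refine le_trans (le_of_eq (congrArg _ ?_)) h5
          linear_combination (-√(vec x (σ 0):ℝ)) * e0
      · intro x hx y hy h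
        have hx := (Finset.mem_filter.1 (Finset.mem_coe.1 hx)).2
        have hy := (Finset.mem_filter.1 (Finset.mem_coe.1 hy)).2
        rw [← hy] at hx
        simp only [Prod.mk.injEq] at hx
        apply vec_inj
        have key : ∀ i : Fin 4, vec x (σ i) = vec y (σ i) := by
          intro i
          fin_cases i
          · exact h
          · exact hx.1
          · exact hx.2.1
          · exact hx.2.2
        intro i
        have := key (σ.symm i)
        simpa using this
    · intro x hx
      rw [Wset, Finset.mem_filter, Finset.mem_filter, mem_Box] at hx
      rw [Om_perm x σ]
      have a0 := om_le N D hN hG _ (hx.1.1 (σ 0)).2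
      have b0 := ww_big N (vec x (σ 0)) hN (by omega)
      have e8 : 8 * √(8:ℝ) ≤ 23 := by
        have : √(8:ℝ) ≤ 2.85 := by rw [Real.sqrt_le_left (by norm_num)]; norm_num
        linarith
      have c0 : om (vec x (σ 0)) ≤ 23 * D / (√(√(N:ℝ)) * √(N:ℝ)) := by
        rw [le_div_iff₀ (by positivity)]
        calc om (vec x (σ 0)) * (√(√(N:ℝ)) * √(N:ℝ)) ≤ D * ww (vec x (σ 0)) * (√(√(N:ℝ)) * √(N:ℝ)) := by gcongr
          _ = D * (ww (vec x (σ 0)) * √(√(N:ℝ)) * √(N:ℝ)) := by ring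
          _ ≤ D * 23 := by gcongr; linarith
          _ = _ := by ring
      have a1 := om_nonneg (vec x (σ 1))
      have a2 := om_nonneg (vec x (σ 2))
      have a3 := om_nonneg (vec x (σ 3))
      simp only [hg]
      calc _ = om (vec x (σ 0)) * (om (vec x (σ 1)) * (om (vec x (σ 2)) * om (vec x (σ 3)))) := by ring
        _ ≤ _ := by gcongr
  refine (Finset.sum_le_sum h2).trans ?_
  rw [Finset.sum_const, Finset.card_univ, Fintype.card_perm, Fintype.card_fin, nsmul_eq_mul]
  norm_num [Nat.factorial]

lemma om_sub_sum (N : ℕ) (p : ℕ × ℕ → Prop) [DecidablePred p] (f : ℕ × ℕ → ℝ) (hf : ∀ y, 0 ≤ f y) :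
    ∑ y ∈ (P2 N).filter p, f y ≤ ∑ y ∈ P2 N, f y :=
  Finset.sum_le_sum_of_subset_of_nonneg (Finset.filter_subset _ _) (fun y _ _ => hf y)

lemma Wset_mono (nz : Prop) (N : ℕ) (e : Fin 4 → ℝ) (η η' : ℝ) (h : η ≤ η') :
    ∑ x ∈ Wset nz N e η, Om x ≤ ∑ x ∈ Wset nz N e η', Om x := by
  apply Finset.sum_le_sum_of_subset_of_nonneg
  · intro x hx
    simp only [Wset, Finset.mem_filter] at hx ⊢
    exact ⟨hx.1, hx.2.1, hx.2.2.1.trans h, hx.2.2.2⟩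
  · intro x _ _
    exact Om_nonneg x

lemma W_mid (nz : Prop) (N : ℕ) (D : ℝ) (hN : 1 ≤ N) (hG : Good N D) (e : Fin 4 → ℝ)
    (he : ∀ i, Sg (e i)) (η : ℝ) (hη2 : 4 * √(N:ℝ) * η ≤ 1) (hη : 1 ≤ η * (N:ℝ)^2) :
    ∑ x ∈ Wset nz N e η, Om x ≤ 10^9 * D^7 * (η * √(N:ℝ) + 1/√(N:ℝ)) := by
  have hD : 1 ≤ D := hG.1
  have hN' : (1:ℝ) ≤ N := by exact_mod_cast hN
  have hs : 0 < √(N:ℝ) := Real.sqrt_pos.mpr (by linarith)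
  have hss : √(N:ℝ)^2 = N := Real.sq_sqrt (by linarith)
  have hη0 : 0 < η := by
    by_contra h
    push Not at h
    nlinarith [sq_nonneg (N:ℝ)]
  have := W_small nz N D hN hG e he η hη2 (20001*D^5*((N:ℝ)^2*η+N)) (by positivity) (by
    intro s t hs ht
    refine le_trans (om_sub_sum N _ _ ?_) (QA N D hN hG s t η hs ht hη hη2)
    intro y
    have := om_nonneg y.1
    have := om_nonneg y.2
    positivity)
  refine this.trans ?_
  have e1 : 24 * (512 * D ^ 2 / (↑N * √↑N) * (20001 * D ^ 5 * ((N:ℝ) ^ 2 * η + ↑N)))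
      = 245772288 * D^7 * (η * √(N:ℝ) + 1/√(N:ℝ)) := by
    have : η * √(N:ℝ) + 1/√(N:ℝ) = (N:ℝ)*(η * N + 1)/(N * √(N:ℝ)) := by
      field_simp
      rw [hss]
    rw [this]
    ring
  rw [e1]
  gcongr
  norm_num

theorem W_star (N : ℕ) (D : ℝ) (hN : 1 ≤ N) (hG : Good N D) (e : Fin 4 → ℝ)
    (he : ∀ i, Sg (e i)) (q : ℝ) (hq : 0 < q) :
    ∑ x ∈ Wset True N e (q^4), Om x ≤ 10^19 * D^7 * (q^4 * √(N:ℝ) + q) := by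
  have hD : 1 ≤ D := hG.1
  have hN' : (1:ℝ) ≤ N := by exact_mod_cast hN
  have hs : 0 < √(N:ℝ) := Real.sqrt_pos.mpr (by linarith)
  have hss : √(N:ℝ)^2 = N := Real.sq_sqrt (by linarith)
  rcases le_total 1 (4 * √(N:ℝ) * q^4) with ha | ha
  · refine (W_large True N D hN hG e he (q^4) ha).trans ?_
    have : 0 ≤ D^7 * (q^4 * √(N:ℝ)) := by positivity
    have h2 : 0 ≤ D^7 * q := by positivity
    nlinarith
  rcases le_total 1 (q^4 * (N:ℝ)^2) with hb | hb
  · refine (W_mid True N D hN hG e he (q^4) ha hb).trans ?_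
    have h1 : 1 ≤ √(N:ℝ) * q := by
      by_contra h
      push Not at h
      have h2 : (√(N:ℝ) * q)^4 < 1 := pow_lt_one₀ (by positivity) h (by norm_num)
      have : (√(N:ℝ) * q)^4 = q^4 * (√(N:ℝ)^2)^2 := by ring
      rw [this, hss] at h2
      linarith
    have h2 : 1/√(N:ℝ) ≤ q := by
      rw [div_le_iff₀ hs]; linarith
    gcongr
    · norm_num
    · norm_num
  rcases le_total 1 (16 * q * (N:ℝ)) with hc | hc
  · have h1 : q^2 * (N:ℝ) ≤ 1 := by
      have h0 : 0 ≤ q^2 * (N:ℝ) := by positivity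
      nlinarith
    have := W_small True N D hN hG e he (q^4) ha (10^14*D^5*(N*√(N:ℝ)*q)) (by positivity) (by
      intro s t hs ht
      have h := QB N D hN hG s t q hs ht hq h1 hc ha
      simpa using h)
    refine this.trans ?_
    have e1 : 24 * (512 * D ^ 2 / (↑N * √↑N) * (10^14 * D ^ 5 * (N*√(N:ℝ)*q)))
      = 24*512*10^14 * D^7 * q := by
      field_simp
    rw [e1]
    have : 0 ≤ D^7 * (q^4 * √(N:ℝ)) := by positivity
    have h2 : 0 ≤ D^7 * q := by positivity
    nlinarith
  · have : Wset True N e (q^4) = ∅ ∨ 16 * q * (N:ℝ) = 1 := by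
      by_cases h1 : 16 * q * (N:ℝ) = 1
      · right; exact h1
      left
      have hc' : 16 * q * (N:ℝ) < 1 := lt_of_le_of_ne hc h1
      rw [Finset.eq_empty_iff_forall_notMem]
      intro x hx
      simp only [Wset, Finset.mem_filter] at hx
      have h := lemC N hN e he x hx.1 (hx.2.2.2 trivial)
      have h3 : 16384*(N:ℝ)^4*|Del e x| ≤ 16384 * (N:ℝ)^4 * q^4 := by
        gcongr; exact hx.2.2.1
      have h4 : (16 * q * (N:ℝ))^4 < 1 := pow_lt_one₀ (by positivity) hc' (by norm_num)
      have h5 : 0 ≤ (N:ℝ)^4 * q^4 := by positivity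
      nlinarith
    rcases this with h | h
    · rw [h]; simp; positivity
    · have h1 : q^2 * (N:ℝ) ≤ 1 := by
        have h0 : 0 ≤ q^2 * (N:ℝ) := by positivity
        nlinarith
      have := W_small True N D hN hG e he (q^4) ha (10^14*D^5*(N*√(N:ℝ)*q)) (by positivity) (by
        intro s t hs ht
        have h := QB N D hN hG s t q hs ht hq h1 h.ge ha
        simpa using h)
      refine this.trans ?_
      have e1 : 24 * (512 * D ^ 2 / (↑N * √↑N) * (10^14 * D ^ 5 * (N*√(N:ℝ)*q)))
        = 24*512*10^14 * D^7 * q := by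
        field_simp
      rw [e1]
      have : 0 ≤ D^7 * (q^4 * √(N:ℝ)) := by positivity
      have h2 : 0 ≤ D^7 * q := by positivity
      nlinarith

theorem W_zero (N : ℕ) (D : ℝ) (hN : 1 ≤ N) (hG : Good N D) (e : Fin 4 → ℝ)
    (he : ∀ i, Sg (e i)) :
    ∑ x ∈ Wset False N e 0, Om x ≤ 10^10 * D^7 / √(N:ℝ) := by
  have hD : 1 ≤ D := hG.1
  have hN' : (1:ℝ) ≤ N := by exact_mod_cast hN
  have hs : 0 < √(N:ℝ) := Real.sqrt_pos.mpr (by linarith)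
  have hss : √(N:ℝ)^2 = N := Real.sq_sqrt (by linarith)
  have hs1 : 1 ≤ √(N:ℝ) := by rw [Real.one_le_sqrt]; exact hN'
  rcases le_or_gt N 2 with h | h
  · refine (Wset_mono False N e 0 1 (by norm_num)).trans ?_
    refine (W_large False N D hN hG e he 1 (by linarith)).trans ?_
    have h2 : (N:ℝ) ≤ 2 := by exact_mod_cast h
    rw [le_div_iff₀ hs]
    have : 0 < D^7 := by positivity
    have e1 : 24 * (300 * D ^ 7 * (1 * √(N:ℝ))) * √(N:ℝ) = 7200 * D^7 * √(N:ℝ)^2 := by ring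
    rw [e1, hss]
    nlinarith
  · have h3 : (3:ℝ) ≤ N := by exact_mod_cast h
    have hs3 : 1.7 ≤ √(N:ℝ) := by
      apply Real.le_sqrt_of_sq_le; norm_num; linarith
    refine (Wset_mono False N e 0 (1/(N:ℝ)^2) (by positivity)).trans ?_
    refine (W_mid False N D hN hG e he (1/(N:ℝ)^2) ?_ ?_).trans ?_
    · rw [mul_one_div, div_le_one (by positivity)]
      have : (N:ℝ)^2 = √(N:ℝ) * (√(N:ℝ) * N) := by nlinarith
      rw [this]
      nlinarith [mul_le_mul hs3 h3 (by norm_num) (by positivity)]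
    · field_simp; norm_num
    · have h4 : 1/(N:ℝ)^2 * √(N:ℝ) ≤ 1/√(N:ℝ) := by
        rw [one_div_mul_eq_div, div_le_div_iff₀ (by positivity) hs, ← sq, hss]
        nlinarith
      calc _ ≤ 10^9 * D^7 * (1/√(N:ℝ) + 1/√(N:ℝ)) := by gcongr
        _ = (2*10^9 * D^7) / √(N:ℝ) := by ring
        _ ≤ _ := by gcongr; norm_num

lemma dyadic (x : ℕ × ℕ × ℕ × ℕ) (hx : ∀ i, 1 ≤ vec x i) :
    ∃ j : ℕ, x ∈ Box (2^j) ∧ ∃ i, 2^j < 2 * vec x i := by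
  obtain ⟨i, -, hi⟩ := Finset.exists_max_image (Finset.univ : Finset (Fin 4)) (vec x) ⟨0, by simp⟩
  refine ⟨Nat.clog 2 (vec x i), ?_, i, ?_⟩
  · rw [mem_Box]
    intro k
    exact ⟨hx k, (hi k (by simp)).trans (Nat.le_pow_clog (by norm_num) _)⟩
  · rcases (hx i).eq_or_lt with h | h
    · rw [← h]; simp
    · have h1 := Nat.pow_pred_clog_lt_self (b := 2) (by norm_num) (x := vec x i) h
      have h2 : 0 < Nat.clog 2 (vec x i) := Nat.clog_pos (by norm_num) h
      obtain ⟨k, hk⟩ : ∃ k, Nat.clog 2 (vec x i) = k + 1 := ⟨_, (Nat.succ_pred_eq_of_pos h2).symm⟩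
      rw [hk] at h1 ⊢
      simp only [Nat.pred_succ] at h1
      rw [pow_succ]; omega

theorem zero_tail : ∃ C > 0, ∀ e : Fin 4 → ℝ, (∀ i, Sg (e i)) → ∀ Y : ℕ, 1 ≤ Y →
    ∀ S : Finset (ℕ × ℕ × ℕ × ℕ), (∀ x ∈ S, (∀ i, 1 ≤ vec x i) ∧ Del e x = 0 ∧ ∃ i, Y ≤ vec x i) →
      ∑ x ∈ S, Om x ≤ C * (Y:ℝ)^(-(1:ℝ)/6) := by
  obtain ⟨K, hK, hgood⟩ := exists_good (1/28) (by norm_num)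
  set ρ : ℝ := (2:ℝ)^(-(1:ℝ)/12) with hρ
  have hρ0 : 0 < ρ := by positivity
  have hρ1 : ρ < 1 := Real.rpow_lt_one_of_one_lt_of_neg (by norm_num) (by norm_num)
  refine ⟨10^10 * K^7 * (1-ρ)⁻¹, ?_, ?_⟩
  · have : 0 < (1-ρ)⁻¹ := inv_pos.mpr (by linarith)
    positivity
  intro e he Y hY S hS
  have hY' : (1:ℝ) ≤ Y := by exact_mod_cast hY
  choose! jf hjf using fun x (hx : x ∈ S) => dyadic x (hS x hx).1
  set J := S.sup jf with hJ
  have term : ∀ j : ℕ, Y ≤ 2^j → ∑ x ∈ Wset False (2^j) e 0, Om x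
      ≤ 10^10 * K^7 * (Y:ℝ)^(-(1:ℝ)/6) * ρ^j := by
    intro j hj
    have h1 : 1 ≤ 2^j := Nat.one_le_two_pow
    refine (W_zero (2^j) _ h1 (hgood (2^j) h1) e he).trans ?_
    have e2 : ((2^j : ℕ):ℝ) = (2:ℝ)^(j:ℝ) := by push_cast; rw [Real.rpow_natCast]
    have e3 : ((2^j : ℕ):ℝ)^((1:ℝ)/28 * 7) / √((2^j : ℕ):ℝ) = ((2^j : ℕ):ℝ)^(-(1:ℝ)/6) * ρ^j := by
      rw [Real.sqrt_eq_rpow, ← Real.rpow_sub (by positivity), hρ, ← Real.rpow_natCast _ j,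
        ← Real.rpow_mul (by norm_num), e2, ← Real.rpow_mul (by norm_num), ← Real.rpow_mul (by norm_num),
        ← Real.rpow_add (by norm_num)]
      congr 1
      ring
    have e4 : (K * ((2^j : ℕ):ℝ)^((1:ℝ)/28))^7 = K^7 * ((2^j : ℕ):ℝ)^((1:ℝ)/28 * 7) := by
      rw [mul_pow, Real.rpow_mul (by positivity)]
      norm_cast
    rw [e4]
    have e5 : 10^10 * (K^7 * ((2^j : ℕ):ℝ)^((1:ℝ)/28 * 7)) / √((2^j : ℕ):ℝ) =
      10^10 * K^7 * (((2^j : ℕ):ℝ)^((1:ℝ)/28 * 7) / √((2^j : ℕ):ℝ)) := by ring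
    rw [e5, e3]
    have h6 : ((2^j : ℕ):ℝ)^(-(1:ℝ)/6) ≤ (Y:ℝ)^(-(1:ℝ)/6) :=
      Real.rpow_le_rpow_of_nonpos (by linarith) (by exact_mod_cast hj) (by norm_num)
    rw [← mul_assoc]
    gcongr
  have step : ∀ x ∈ S, Om x ≤ ∑ j ∈ Finset.range (J+1),
      (if Y ≤ 2^j ∧ x ∈ Wset False (2^j) e 0 then Om x else 0) := by
    intro x hx
    have hj : jf x ∈ Finset.range (J+1) := by
      rw [Finset.mem_range]
      have : jf x ≤ J := Finset.le_sup hx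
      omega
    obtain ⟨hb, i, hi⟩ := hjf x hx
    have hc : Y ≤ 2^(jf x) ∧ x ∈ Wset False (2^(jf x)) e 0 := by
      obtain ⟨k, hk⟩ := (hS x hx).2.2
      constructor
      · exact hk.trans ((mem_Box.mp hb k).2)
      · simp only [Wset, Finset.mem_filter]
        refine ⟨hb, ⟨i, hi⟩, ?_, fun h => h.elim⟩
        rw [(hS x hx).2.1]; simp
    refine le_trans (le_of_eq ?_) (Finset.single_le_sum (f := fun j =>
      (if Y ≤ 2^j ∧ x ∈ Wset False (2^j) e 0 then Om x else 0)) ?_ hj)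
    · simp only [if_pos hc]
    · intro j _
      split_ifs
      · exact Om_nonneg x
      · exact le_rfl
  calc ∑ x ∈ S, Om x ≤ ∑ x ∈ S, ∑ j ∈ Finset.range (J+1),
      (if Y ≤ 2^j ∧ x ∈ Wset False (2^j) e 0 then Om x else 0) := Finset.sum_le_sum step
    _ = ∑ j ∈ Finset.range (J+1), ∑ x ∈ S,
      (if Y ≤ 2^j ∧ x ∈ Wset False (2^j) e 0 then Om x else 0) := Finset.sum_comm
    _ ≤ ∑ j ∈ Finset.range (J+1), 10^10 * K^7 * (Y:ℝ)^(-(1:ℝ)/6) * ρ^j := by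
      apply Finset.sum_le_sum
      intro j _
      by_cases hj : Y ≤ 2^j
      · refine le_trans ?_ (term j hj)
        simp only [hj, true_and]
        rw [← Finset.sum_filter]
        apply Finset.sum_le_sum_of_subset_of_nonneg
        · intro x hx
          exact (Finset.mem_filter.mp hx).2
        · intro x _ _; exact Om_nonneg x
      · simp only [hj, false_and, if_false, Finset.sum_const_zero]
        positivity
    _ = 10^10 * K^7 * (Y:ℝ)^(-(1:ℝ)/6) * ∑ j ∈ Finset.range (J+1), ρ^j := by
      rw [Finset.mul_sum]
    _ ≤ 10^10 * K^7 * (Y:ℝ)^(-(1:ℝ)/6) * (1-ρ)⁻¹ := by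
      gcongr
      rw [← tsum_geometric_of_lt_one hρ0.le hρ1]
      exact (summable_geometric_of_lt_one hρ0.le hρ1).sum_le_tsum _ (fun _ _ => by positivity)
    _ = _ := by ring

lemma card_dA (n : ℕ) : (Nat.divisorsAntidiagonal n).card = n.divisors.card := by
  rw [← Nat.map_div_right_divisors, Finset.card_map]

/-- Phase combination. -/
def Phi (M₁ M₂ ℓ₁ ℓ₂ : ℕ) (e : Fin 4 → ℝ) (p₁ p₂ p₃ p₄ : ℕ × ℕ) : ℝ :=
  e 0 * phase M₁ M₂ ℓ₁ ℓ₂ p₁ + e 1 * phase M₁ M₂ ℓ₁ ℓ₂ p₂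
    + e 2 * phase M₁ M₂ ℓ₁ ℓ₂ p₃ + e 3 * phase M₁ M₂ ℓ₁ ℓ₂ p₄

/-- Sum over factorisations. -/
def dsum (x : ℕ × ℕ × ℕ × ℕ) (f : ℕ × ℕ → ℕ × ℕ → ℕ × ℕ → ℕ × ℕ → ℝ) : ℝ :=
  ∑ p₁ ∈ Nat.divisorsAntidiagonal x.1, ∑ p₂ ∈ Nat.divisorsAntidiagonal x.2.1,
    ∑ p₃ ∈ Nat.divisorsAntidiagonal x.2.2.1, ∑ p₄ ∈ Nat.divisorsAntidiagonal x.2.2.2, f p₁ p₂ p₃ p₄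

/-- Weight. -/
def w4 (x : ℕ × ℕ × ℕ × ℕ) : ℝ := ww x.1 * ww x.2.1 * ww x.2.2.1 * ww x.2.2.2

lemma w4_nonneg (x : ℕ × ℕ × ℕ × ℕ) : 0 ≤ w4 x := by
  have := ww_nonneg x.1
  have := ww_nonneg x.2.1
  have := ww_nonneg x.2.2.1
  have := ww_nonneg x.2.2.2
  unfold w4; positivity

lemma dsum_abs (x : ℕ × ℕ × ℕ × ℕ) (f : ℕ × ℕ → ℕ × ℕ → ℕ × ℕ → ℕ × ℕ → ℝ) (B : ℝ)
    (h : ∀ p₁ p₂ p₃ p₄, |f p₁ p₂ p₃ p₄| ≤ B) :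
    |w4 x * dsum x f| ≤ Om x * B := by
  have h1 : |dsum x f| ≤ (x.1.divisors.card : ℝ) * ((x.2.1.divisors.card : ℝ) *
      ((x.2.2.1.divisors.card : ℝ) * ((x.2.2.2.divisors.card : ℝ) * B))) := by
    unfold dsum
    have bd : ∀ (n : ℕ) (g : ℕ × ℕ → ℝ) (b : ℝ), (∀ p, |g p| ≤ b) →
        |∑ p ∈ Nat.divisorsAntidiagonal n, g p| ≤ (n.divisors.card : ℝ) * b := by
      intro n g b hg
      refine (Finset.abs_sum_le_sum_abs _ _).trans ?_
      refine (Finset.sum_le_sum (fun p _ => hg p)).trans ?_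
      rw [Finset.sum_const, card_dA, nsmul_eq_mul]
    apply bd; intro p₁
    apply bd; intro p₂
    apply bd; intro p₃
    apply bd; intro p₄
    exact h _ _ _ _
  rw [abs_mul, abs_of_nonneg (w4_nonneg x)]
  refine (mul_le_mul_of_nonneg_left h1 (w4_nonneg x)).trans (le_of_eq ?_)
  simp only [Om, om, w4, vec, Fin.prod_univ_four]
  simp
  ring

lemma w4_eq (x : ℕ × ℕ × ℕ × ℕ) :
    ((x.1 : ℝ) * x.2.1 * x.2.2.1 * x.2.2.2) ^ (-(3:ℝ)/4) = w4 x := by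
  unfold w4 ww
  rw [Real.mul_rpow (by positivity) (by positivity), Real.mul_rpow (by positivity) (by positivity),
    Real.mul_rpow (by positivity) (by positivity)]

/-- Terms of the singular series. -/
def zt (M₁ M₂ ℓ₁ ℓ₂ : ℕ) (e : Fin 4 → ℝ) (x : ℕ × ℕ × ℕ × ℕ) : ℝ :=
  if (∀ i, 1 ≤ vec x i) ∧ Del e x = 0 then
    w4 x * dsum x (fun p₁ p₂ p₃ p₄ => Real.cos (2 * π * Phi M₁ M₂ ℓ₁ ℓ₂ e p₁ p₂ p₃ p₄)) else 0

lemma s4_eq (M₁ M₂ ℓ₁ ℓ₂ : ℕ) (e₂ e₃ e₄ : ℝ) :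
    s4 M₁ M₂ ℓ₁ ℓ₂ e₂ e₃ e₄ = ∑' x, zt M₁ M₂ ℓ₁ ℓ₂ ![1, e₂, e₃, e₄] x := by
  unfold s4
  congr 1
  funext x
  unfold zt
  have hiff : ((∀ i, 1 ≤ vec x i) ∧ Del ![1, e₂, e₃, e₄] x = 0) ↔
      (0 < x.1 ∧ 0 < x.2.1 ∧ 0 < x.2.2.1 ∧ 0 < x.2.2.2 ∧
        Real.sqrt x.1 + e₂ * Real.sqrt x.2.1 + e₃ * Real.sqrt x.2.2.1
          + e₄ * Real.sqrt x.2.2.2 = 0) := by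
    simp [Del, Fin.sum_univ_four, vec, Fin.forall_fin_succ, Nat.one_le_iff_ne_zero, Nat.pos_iff_ne_zero, and_assoc]
  simp only [hiff]
  split_ifs
  · rw [w4_eq]
    simp [dsum, Phi]
  · rfl

lemma zt_abs (M₁ M₂ ℓ₁ ℓ₂ : ℕ) (e : Fin 4 → ℝ) (x : ℕ × ℕ × ℕ × ℕ) :
    |zt M₁ M₂ ℓ₁ ℓ₂ e x| ≤ if (∀ i, 1 ≤ vec x i) ∧ Del e x = 0 then Om x else 0 := by
  unfold zt
  split_ifs
  · have := dsum_abs x (fun p₁ p₂ p₃ p₄ => Real.cos (2 * π * Phi M₁ M₂ ℓ₁ ℓ₂ e p₁ p₂ p₃ p₄)) 1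
      (fun _ _ _ _ => Real.abs_cos_le_one _)
    simpa using this
  · simp

theorem s4_tail : ∃ C > 0, ∀ (M₁ M₂ ℓ₁ ℓ₂ : ℕ) (e : Fin 4 → ℝ), (∀ i, Sg (e i)) → ∀ Y : ℕ, 1 ≤ Y →
    |∑' x, zt M₁ M₂ ℓ₁ ℓ₂ e x - ∑ x ∈ Box Y, zt M₁ M₂ ℓ₁ ℓ₂ e x| ≤ C * (Y:ℝ)^(-(1:ℝ)/6) := by
  obtain ⟨C, hC, h⟩ := zero_tail
  refine ⟨C, hC, ?_⟩
  intro M₁ M₂ ℓ₁ ℓ₂ e he Y hY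
  have gen : ∀ Z : ℕ, 1 ≤ Z → ∀ S : Finset (ℕ × ℕ × ℕ × ℕ),
      (∀ x ∈ S, (∀ i, 1 ≤ vec x i) → ∃ i, Z ≤ vec x i) →
      ∑ x ∈ S, |zt M₁ M₂ ℓ₁ ℓ₂ e x| ≤ C * (Z:ℝ)^(-(1:ℝ)/6) := by
    intro Z hZ S hS
    refine (Finset.sum_le_sum (fun x _ => zt_abs M₁ M₂ ℓ₁ ℓ₂ e x)).trans ?_
    rw [← Finset.sum_filter]
    apply h e he Z hZ
    intro x hx
    rw [Finset.mem_filter] at hx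
    exact ⟨hx.2.1, hx.2.2, hS x hx.1 hx.2.1⟩
  have hsum : Summable (fun x => zt M₁ M₂ ℓ₁ ℓ₂ e x) := by
    apply Summable.of_abs
    apply summable_of_sum_le (c := C * ((1:ℕ):ℝ)^(-(1:ℝ)/6)) (fun x => abs_nonneg _)
    intro S
    exact gen 1 le_rfl S (fun x _ hx => ⟨0, hx 0⟩)
  have ht := (hsum.hasSum.sub_const (∑ x ∈ Box Y, zt M₁ M₂ ℓ₁ ℓ₂ e x)).abs
  refine le_of_tendsto ht ?_
  filter_upwards [Filter.eventually_ge_atTop (Box Y)] with S hS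
  rw [← Finset.sum_sdiff hS, add_sub_cancel_right]
  refine (Finset.abs_sum_le_sum_abs _ _).trans (gen Y hY _ ?_)
  intro x hx hpos
  by_contra hc
  push Not at hc
  rw [Finset.mem_sdiff] at hx
  exact hx.2 (mem_Box.mpr (fun i => ⟨hpos i, (hc i).le⟩))

lemma Good.mono {N N' : ℕ} {D : ℝ} (h : Good N' D) (hN : N ≤ N') : Good N D :=
  ⟨h.1, fun n hn => h.2 n (hn.trans (by gcongr))⟩

lemma Good.log {N : ℕ} {D : ℝ} (h : Good N D) (k : ℕ) (hk : 2^k ≤ 10^6*N^10) : (k:ℝ) + 1 ≤ D := by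
  have := (h.2 _ hk).1
  rw [Nat.divisors_prime_pow Nat.prime_two, Finset.card_map, Finset.card_range] at this
  exact_mod_cast this

lemma clog_bound (m : ℕ) (hm : 1 ≤ m) : 2^(Nat.clog 2 m) ≤ 2 * m := by
  rcases hm.eq_or_lt with h | h
  · rw [← h]; simp
  · have h1 := Nat.pow_pred_clog_lt_self (b := 2) (by norm_num) (x := m) h
    have h2 : 0 < Nat.clog 2 m := Nat.clog_pos (by norm_num) h
    obtain ⟨k, hk⟩ : ∃ k, Nat.clog 2 m = k + 1 := ⟨_, (Nat.succ_pred_eq_of_pos h2).symm⟩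
    rw [hk] at h1 ⊢
    simp only [Nat.pred_succ] at h1
    rw [pow_succ]; omega

theorem V_bound (Y : ℕ) (D : ℝ) (hY : 1 ≤ Y) (hG : Good (2*Y) D) (e : Fin 4 → ℝ)
    (he : ∀ i, Sg (e i)) (q : ℝ) (hq : 0 < q) :
    ∑ x ∈ (Box Y).filter (fun x => Del e x ≠ 0 ∧ |Del e x| ≤ q^4), Om x
      ≤ 10^20 * D^8 * (q^4 * √(Y:ℝ) + q) := by
  have hD : 1 ≤ D := hG.1
  set J := Nat.clog 2 Y with hJ
  have hJ2 : 2^J ≤ 2 * Y := clog_bound Y hY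
  have hYJ : Y ≤ 2^J := Nat.le_pow_clog (by norm_num) _
  have hJD : (J:ℝ) + 1 ≤ D := hG.log J (by
    have : 2 * Y ≤ (2*Y)^10 := Nat.le_self_pow (by norm_num) _
    omega)
  have term : ∀ j ∈ Finset.range (J+1), ∑ x ∈ Wset True (2^j) e (q^4), Om x
      ≤ 10^19 * D^7 * (2 * (q^4 * √(Y:ℝ) + q)) := by
    intro j hj
    rw [Finset.mem_range] at hj
    have h1 : 1 ≤ 2^j := Nat.one_le_two_pow
    have h2 : 2^j ≤ 2 * Y := (Nat.pow_le_pow_right (by norm_num) (by omega)).trans hJ2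
    refine (W_star (2^j) D h1 (hG.mono h2) e he q hq).trans ?_
    have h3 : √((2^j:ℕ):ℝ) ≤ 2 * √(Y:ℝ) := by
      rw [Real.sqrt_le_left (by positivity), mul_pow, Real.sq_sqrt (by positivity)]
      have : ((2^j:ℕ):ℝ) ≤ 2 * Y := by exact_mod_cast h2
      have h4 : (0:ℝ) ≤ Y := by positivity
      linarith
    have h5 : q^4 * √((2^j:ℕ):ℝ) + q ≤ 2 * (q^4 * √(Y:ℝ) + q) := by
      have : q^4 * √((2^j:ℕ):ℝ) ≤ q^4 * (2 * √(Y:ℝ)) := by gcongr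
      linarith
    gcongr
  have step : ∀ x ∈ (Box Y).filter (fun x => Del e x ≠ 0 ∧ |Del e x| ≤ q^4),
      Om x ≤ ∑ j ∈ Finset.range (J+1), (if x ∈ Wset True (2^j) e (q^4) then Om x else 0) := by
    intro x hx
    rw [Finset.mem_filter] at hx
    have hb := mem_Box.mp hx.1
    obtain ⟨j, hj, i, hi⟩ := dyadic x (fun i => (hb i).1)
    have hjJ : j ∈ Finset.range (J+1) := by
      rw [Finset.mem_range]
      have h1 : 2^j < 2^(J+1) := by
        have := (hb i).2
        rw [pow_succ]; omega
      exact (Nat.pow_lt_pow_iff_right (by norm_num)).mp h1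
    have hc : x ∈ Wset True (2^j) e (q^4) := by
      simp only [Wset, Finset.mem_filter]
      exact ⟨hj, ⟨i, hi⟩, hx.2.2, fun _ => hx.2.1⟩
    refine le_trans (le_of_eq ?_) (Finset.single_le_sum (f := fun j =>
      (if x ∈ Wset True (2^j) e (q^4) then Om x else 0)) ?_ hjJ)
    · simp only [if_pos hc]
    · intro j _
      split_ifs
      · exact Om_nonneg x
      · exact le_rfl
  refine (Finset.sum_le_sum step).trans ?_
  rw [Finset.sum_comm]
  have : ∀ j ∈ Finset.range (J+1), ∑ x ∈ (Box Y).filter (fun x => Del e x ≠ 0 ∧ |Del e x| ≤ q^4),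
      (if x ∈ Wset True (2^j) e (q^4) then Om x else 0) ≤ 10^19 * D^7 * (2 * (q^4 * √(Y:ℝ) + q)) := by
    intro j hj
    refine le_trans ?_ (term j hj)
    rw [← Finset.sum_filter]
    apply Finset.sum_le_sum_of_subset_of_nonneg
    · intro x hx
      exact (Finset.mem_filter.mp hx).2
    · intro x _ _; exact Om_nonneg x
  refine (Finset.sum_le_sum this).trans ?_
  rw [Finset.sum_const, Finset.card_range, nsmul_eq_mul]
  push_cast
  calc ((J:ℝ)+1) * (10^19 * D^7 * (2 * (q^4 * √(Y:ℝ) + q)))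
      ≤ D * (10^19 * D^7 * (2 * (q^4 * √(Y:ℝ) + q))) := by gcongr
    _ = 2*10^19 * D^8 * (q^4 * √(Y:ℝ) + q) := by ring
    _ ≤ _ := by gcongr; norm_num

lemma Del_le (Y : ℕ) (e : Fin 4 → ℝ) (he : ∀ i, Sg (e i)) (x : ℕ × ℕ × ℕ × ℕ) (hx : x ∈ Box Y) :
    |Del e x| ≤ 4 * √(Y:ℝ) := by
  unfold Del
  refine (Finset.abs_sum_le_sum_abs _ _).trans ?_
  have : ∀ i ∈ (Finset.univ : Finset (Fin 4)), |e i * √(vec x i:ℝ)| ≤ √(Y:ℝ) := by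
    intro i _
    have h1 : |e i| = 1 := by
      rcases he i with h | h <;> rw [h] <;> simp
    rw [abs_mul, h1, one_mul, abs_of_nonneg (Real.sqrt_nonneg _)]
    exact Real.sqrt_le_sqrt (by exact_mod_cast (mem_Box.mp hx i).2)
  refine (Finset.sum_le_sum this).trans ?_
  simp

theorem NZ_bound (Y : ℕ) (D : ℝ) (hY : 1 ≤ Y) (hG : Good (2*Y) D) (e : Fin 4 → ℝ)
    (he : ∀ i, Sg (e i)) (v A : ℝ) (hv : 0 < v) (hvY : 1 / v^4 ≤ 2 * Y) (hA : 0 ≤ A)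
    (m : ℕ × ℕ × ℕ × ℕ → ℝ) (h1 : ∀ x, m x ≤ A) (h2 : ∀ x, m x * |Del e x| ≤ A * v^4) :
    ∑ x ∈ (Box Y).filter (fun x => Del e x ≠ 0), Om x * m x
      ≤ 10^21 * D^9 * A * (v^4 * √(Y:ℝ) + v) := by
  have hD : 1 ≤ D := hG.1
  have hY' : (1:ℝ) ≤ Y := by exact_mod_cast hY
  set I := Nat.clog 2 (8 * Y^2) with hI
  have hYI : 8 * Y^2 ≤ 2^I := Nat.le_pow_clog (by norm_num) _
  have hID : (I:ℝ) + 1 ≤ D := by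
    apply hG.log
    refine (clog_bound _ (by have := Nat.one_le_pow 2 Y hY; omega)).trans ?_
    have : (2*Y)^2 ≤ (2*Y)^10 := Nat.pow_le_pow_right (by omega) (by norm_num)
    nlinarith
  have step : ∀ x ∈ (Box Y).filter (fun x => Del e x ≠ 0),
      Om x * m x ≤ ∑ i ∈ Finset.range (I+1),
        (if |Del e x| ≤ 2^i * v^4 then Om x * (2*A/2^i) else 0) := by
    intro x hx
    rw [Finset.mem_filter] at hx
    set z := |Del e x| / v^4 with hz
    have hz0 : 0 < z := by
      have := abs_pos.mpr hx.2
      positivity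
    set i := Nat.clog 2 ⌈z⌉₊ with hi
    have hzi : z ≤ 2^i := by
      have : ⌈z⌉₊ ≤ 2^i := Nat.le_pow_clog (by norm_num) _
      exact (Nat.le_ceil z).trans (by exact_mod_cast this)
    have hzd : z * v^4 = |Del e x| := by rw [hz]; field_simp
    have hc : |Del e x| ≤ 2^i * v^4 := by rw [← hzd]; gcongr
    have hm : m x ≤ 2*A/2^i := by
      rcases Nat.eq_zero_or_pos i with h0 | h0
      · rw [h0]; simp; linarith [h1 x]
      · obtain ⟨k, hk⟩ : ∃ k, i = k + 1 := ⟨_, (Nat.succ_pred_eq_of_pos h0).symm⟩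
        have hcl : 2^k < ⌈z⌉₊ := by
          apply (Nat.lt_clog_iff_pow_lt (by norm_num)).mp
          omega
        have hkz : (2:ℝ)^k < z := by
          have := Nat.lt_ceil.mp hcl
          exact_mod_cast this
        rw [hk, pow_succ, le_div_iff₀ (by positivity)]
        by_cases hm0 : m x ≤ 0
        · have : m x * (2^k*2) ≤ 0 := mul_nonpos_of_nonpos_of_nonneg hm0 (by positivity)
          linarith
        · push Not at hm0
          have h3 := h2 x
          rw [← hzd] at h3
          have h4 : m x * z ≤ A := by
            have hv4 : 0 < v^4 := by positivity
            by_contra hh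
            push Not at hh
            nlinarith
          nlinarith
    have hir : i ∈ Finset.range (I+1) := by
      rw [Finset.mem_range, Nat.lt_succ_iff]
      apply Nat.clog_mono_right
      apply Nat.ceil_le.mpr
      push_cast
      have h3 := Del_le Y e he x hx.1
      have h4 : √(Y:ℝ) ≤ Y := by
        rw [Real.sqrt_le_left (by linarith)]; nlinarith
      have : z = |Del e x| * (1/v^4) := by rw [hz]; ring
      rw [this]
      calc |Del e x| * (1/v^4) ≤ (4 * Y) * (2 * Y) := by
            gcongr
            linarith
        _ = _ := by ring
    refine le_trans ?_ (Finset.single_le_sum (f := fun i =>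
      (if |Del e x| ≤ 2^i * v^4 then Om x * (2*A/2^i) else 0)) ?_ hir)
    · simp only [if_pos hc]
      exact mul_le_mul_of_nonneg_left hm (Om_nonneg x)
    · intro j _
      have := Om_nonneg x
      split_ifs
      · positivity
      · exact le_rfl
  refine (Finset.sum_le_sum step).trans ?_
  rw [Finset.sum_comm]
  have : ∀ i ∈ Finset.range (I+1), ∑ x ∈ (Box Y).filter (fun x => Del e x ≠ 0),
        (if |Del e x| ≤ 2^i * v^4 then Om x * (2*A/2^i) else 0)
        ≤ 2 * 10^20 * D^8 * A * (v^4 * √(Y:ℝ) + v) := by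
    intro i _
    set b : ℝ := (2:ℝ)^((i:ℝ)/4) with hb
    have hb0 : 0 < b := by positivity
    have hb4 : b^4 = 2^i := by
      rw [hb, ← Real.rpow_natCast, ← Real.rpow_mul (by norm_num), ← Real.rpow_natCast]
      congr 1; push_cast; ring
    have hb1 : 1 ≤ b := Real.one_le_rpow (by norm_num) (by positivity)
    have hbb : b ≤ 2^i := by rw [← hb4]; exact le_self_pow₀ hb1 (by norm_num)
    rw [← Finset.sum_filter, Finset.filter_filter, ← Finset.sum_mul]
    have hV := V_bound Y D hY hG e he (b*v) (by positivity)
    rw [mul_pow, hb4] at hV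
    calc _ ≤ (10^20 * D^8 * (2^i*v^4 * √(Y:ℝ) + b*v)) * (2*A/2^i) := by
            gcongr
      _ ≤ (10^20 * D^8 * (2^i*v^4 * √(Y:ℝ) + 2^i*v)) * (2*A/2^i) := by
            gcongr
      _ = _ := by field_simp
  refine (Finset.sum_le_sum this).trans ?_
  rw [Finset.sum_const, Finset.card_range, nsmul_eq_mul]
  push_cast
  calc ((I:ℝ)+1) * (2 * 10^20 * D^8 * A * (v^4 * √(Y:ℝ) + v))
      ≤ D * (2 * 10^20 * D^8 * A * (v^4 * √(Y:ℝ) + v)) := by gcongr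
    _ = 2*10^20 * D^9 * A * (v^4 * √(Y:ℝ) + v) := by ring
    _ ≤ _ := by gcongr; norm_num

lemma osc_trivial (T a φ : ℝ) (hT : 0 < T) :
    |∫ x in (T/2)..T, x * Real.cos (4 * π * √x * a - φ)| ≤ T^2 := by
  have h : ∀ x ∈ Set.uIoc (T/2) T, ‖x * Real.cos (4 * π * √x * a - φ)‖ ≤ T := by
    intro x hx
    rw [Set.uIoc_of_le (by linarith)] at hx
    rw [norm_mul, Real.norm_eq_abs, Real.norm_eq_abs, abs_of_pos (by linarith [hx.1])]
    have := Real.abs_cos_le_one (4 * π * √x * a - φ)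
    nlinarith [hx.1, hx.2, abs_nonneg (Real.cos (4 * π * √x * a - φ))]
  have := intervalIntegral.norm_integral_le_of_norm_le_const h
  rw [Real.norm_eq_abs] at this
  refine this.trans ?_
  rw [abs_of_pos (by linarith)]
  nlinarith

lemma osc_bound (T a φ : ℝ) (hT : 0 < T) :
    |∫ x in (T/2)..T, x * Real.cos (4 * π * √x * a - φ)| * |a| ≤ T * √T := by
  have hpi := Real.pi_gt_three
  have hder : ∀ x ∈ Set.uIcc (T/2) T, HasDerivAt (fun x => x * √x * Real.sin (4 * π * √x * a - φ))
      (3/2 * (√x * Real.sin (4 * π * √x * a - φ)) + 2 * π * a * (x * Real.cos (4 * π * √x * a - φ))) x := by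
    intro x hx
    rw [Set.uIcc_of_le (by linarith)] at hx
    have hx0 : 0 < x := by linarith [hx.1]
    have hs : 0 < √x := Real.sqrt_pos.mpr hx0
    have hss : √x * √x = x := Real.mul_self_sqrt hx0.le
    have h1 : HasDerivAt (fun x => √x) (1/(2*√x)) x := Real.hasDerivAt_sqrt hx0.ne'
    have h2 : HasDerivAt (fun x => 4 * π * √x * a - φ) (4 * π * (1/(2*√x)) * a) x :=
      ((h1.const_mul (4*π)).mul_const a).sub_const φ
    have h3 := ((hasDerivAt_id x).mul h1).mul h2.sin
    refine h3.congr_deriv ?_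
    simp only [id, Pi.mul_apply]
    field_simp
    have h4 : √x^2 = x := by rw [sq]; exact hss
    rw [h4]
    ring_nf
    rw [h4]
  have c1 : Continuous (fun x : ℝ => √x * Real.sin (4 * π * √x * a - φ)) := by fun_prop
  have c2 : Continuous (fun x : ℝ => x * Real.cos (4 * π * √x * a - φ)) := by fun_prop
  have hIntg := intervalIntegral.integral_eq_sub_of_hasDerivAt hder
    (((c1.const_mul (3/2)).add (c2.const_mul (2*π*a))).intervalIntegrable _ _)
  rw [intervalIntegral.integral_add ((c1.const_mul (3/2)).intervalIntegrable _ _)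
    ((c2.const_mul (2*π*a)).intervalIntegrable _ _), intervalIntegral.integral_const_mul,
    intervalIntegral.integral_const_mul] at hIntg
  have b1 : |∫ x in (T/2)..T, √x * Real.sin (4 * π * √x * a - φ)| ≤ √T * (T/2) := by
    have h : ∀ x ∈ Set.uIoc (T/2) T, ‖√x * Real.sin (4 * π * √x * a - φ)‖ ≤ √T := by
      intro x hx
      rw [Set.uIoc_of_le (by linarith)] at hx
      rw [norm_mul, Real.norm_eq_abs, Real.norm_eq_abs, abs_of_nonneg (Real.sqrt_nonneg _)]
      have h1 := Real.abs_sin_le_one (4 * π * √x * a - φ)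
      have h2 : √x ≤ √T := Real.sqrt_le_sqrt hx.2
      have h3 := Real.sqrt_nonneg x
      nlinarith [abs_nonneg (Real.sin (4 * π * √x * a - φ))]
    have := intervalIntegral.norm_integral_le_of_norm_le_const h
    rw [Real.norm_eq_abs] at this
    refine this.trans (le_of_eq ?_)
    rw [abs_of_pos (by linarith)]
    ring
  have bs : ∀ x : ℝ, 0 ≤ x → x ≤ T → |x * √x * Real.sin (4 * π * √x * a - φ)| ≤ T * √T := by
    intro x h0 hxT
    rw [abs_mul, abs_of_nonneg (by positivity)]
    have h1 := Real.abs_sin_le_one (4 * π * √x * a - φ)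
    have h2 : x * √x ≤ T * √T := by gcongr
    have h3 : 0 ≤ x * √x := by positivity
    nlinarith [abs_nonneg (Real.sin (4 * π * √x * a - φ))]
  have b2 := bs T hT.le le_rfl
  have b3 := bs (T/2) (by linarith) (by linarith)
  set I := ∫ x in (T/2)..T, x * Real.cos (4 * π * √x * a - φ)
  have hP : 0 ≤ T * √T := by positivity
  have key : |2 * π * a * I| ≤ 3 * (T * √T) := by
    rw [abs_le] at *
    constructor <;> nlinarith
  rw [abs_mul, abs_mul, abs_of_pos (by positivity)] at key
  nlinarith [mul_nonneg (abs_nonneg a) (abs_nonneg I)]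

lemma Box_prod (Y : ℕ) (f₁ f₂ f₃ f₄ : ℕ → ℕ × ℕ → ℝ) :
    ∑ x ∈ Box Y, w4 x * dsum x (fun p₁ p₂ p₃ p₄ => f₁ x.1 p₁ * f₂ x.2.1 p₂ * f₃ x.2.2.1 p₃ * f₄ x.2.2.2 p₄)
      = (∑ n ∈ Icc 1 Y, ww n * ∑ p ∈ Nat.divisorsAntidiagonal n, f₁ n p)
      * (∑ n ∈ Icc 1 Y, ww n * ∑ p ∈ Nat.divisorsAntidiagonal n, f₂ n p)
      * (∑ n ∈ Icc 1 Y, ww n * ∑ p ∈ Nat.divisorsAntidiagonal n, f₃ n p)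
      * (∑ n ∈ Icc 1 Y, ww n * ∑ p ∈ Nat.divisorsAntidiagonal n, f₄ n p) := by
  have hd : ∀ x : ℕ × ℕ × ℕ × ℕ, dsum x (fun p₁ p₂ p₃ p₄ => f₁ x.1 p₁ * f₂ x.2.1 p₂ * f₃ x.2.2.1 p₃ * f₄ x.2.2.2 p₄)
      = (∑ p ∈ Nat.divisorsAntidiagonal x.1, f₁ x.1 p) * (∑ p ∈ Nat.divisorsAntidiagonal x.2.1, f₂ x.2.1 p)
      * (∑ p ∈ Nat.divisorsAntidiagonal x.2.2.1, f₃ x.2.2.1 p) * (∑ p ∈ Nat.divisorsAntidiagonal x.2.2.2, f₄ x.2.2.2 p) := by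
    intro x
    unfold dsum
    simp only [← Finset.mul_sum, ← Finset.sum_mul]
  simp only [hd]
  set g₁ := fun n => ww n * ∑ p ∈ Nat.divisorsAntidiagonal n, f₁ n p
  set g₂ := fun n => ww n * ∑ p ∈ Nat.divisorsAntidiagonal n, f₂ n p
  set g₃ := fun n => ww n * ∑ p ∈ Nat.divisorsAntidiagonal n, f₃ n p
  set g₄ := fun n => ww n * ∑ p ∈ Nat.divisorsAntidiagonal n, f₄ n p
  have h2 : ∀ x ∈ Box Y, w4 x * ((∑ p ∈ Nat.divisorsAntidiagonal x.1, f₁ x.1 p) * (∑ p ∈ Nat.divisorsAntidiagonal x.2.1, f₂ x.2.1 p)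
      * (∑ p ∈ Nat.divisorsAntidiagonal x.2.2.1, f₃ x.2.2.1 p) * (∑ p ∈ Nat.divisorsAntidiagonal x.2.2.2, f₄ x.2.2.2 p))
      = g₁ x.1 * g₂ x.2.1 * g₃ x.2.2.1 * g₄ x.2.2.2 := by
    intro x _
    simp only [g₁, g₂, g₃, g₄, w4]
    ring
  rw [Finset.sum_congr rfl h2]
  unfold Box
  simp only [Finset.sum_product, ← Finset.mul_sum, ← Finset.sum_mul]

/-- The exponential-type sum attached to a sign pattern. -/
def Fe (Y : ℕ) (e : Fin 4 → ℝ) (θ : ℕ → ℕ × ℕ → ℝ) : ℝ :=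
  ∑ x ∈ Box Y, w4 x * dsum x (fun p₁ p₂ p₃ p₄ =>
    Real.cos (e 0 * θ x.1 p₁ + e 1 * θ x.2.1 p₂ + e 2 * θ x.2.2.1 p₃ + e 3 * θ x.2.2.2 p₄))

lemma cos_Sg (s a : ℝ) (hs : Sg s) : Real.cos (s * a) = Real.cos a := by
  rcases hs with h | h <;> rw [h] <;> simp

lemma sin_Sg (s a : ℝ) (hs : Sg s) : Real.sin (s * a) = s * Real.sin a := by
  rcases hs with h | h <;> rw [h] <;> simp

lemma dsum_add (x : ℕ × ℕ × ℕ × ℕ) (f g : ℕ × ℕ → ℕ × ℕ → ℕ × ℕ → ℕ × ℕ → ℝ) :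
    dsum x (fun p₁ p₂ p₃ p₄ => f p₁ p₂ p₃ p₄ + g p₁ p₂ p₃ p₄) = dsum x f + dsum x g := by
  simp only [dsum, Finset.sum_add_distrib]

lemma dsum_mul (x : ℕ × ℕ × ℕ × ℕ) (c : ℝ) (f : ℕ × ℕ → ℕ × ℕ → ℕ × ℕ → ℕ × ℕ → ℝ) :
    dsum x (fun p₁ p₂ p₃ p₄ => c * f p₁ p₂ p₃ p₄) = c * dsum x f := by
  simp only [dsum, Finset.mul_sum]

lemma Fe_eq (Y : ℕ) (e : Fin 4 → ℝ) (he : ∀ i, Sg (e i)) (θ : ℕ → ℕ × ℕ → ℝ) (S S' : ℝ)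
    (hS : ∑ n ∈ Icc 1 Y, ww n * ∑ p ∈ Nat.divisorsAntidiagonal n, Real.cos (θ n p) = S)
    (hS' : ∑ n ∈ Icc 1 Y, ww n * ∑ p ∈ Nat.divisorsAntidiagonal n, Real.sin (θ n p) = S') :
    Fe Y e θ = S^4 - (e 0 * e 1 + e 0 * e 2 + e 0 * e 3 + e 1 * e 2 + e 1 * e 3 + e 2 * e 3) * (S^2*S'^2)
      + e 0 * e 1 * e 2 * e 3 * S'^4 := by
  set c : ℕ → ℕ × ℕ → ℝ := fun n p => Real.cos (θ n p) with hc
  set s : ℕ → ℕ × ℕ → ℝ := fun n p => Real.sin (θ n p) with hs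
  have hcos : ∀ (a b g d : ℝ), Real.cos (e 0 * a + e 1 * b + e 2 * g + e 3 * d) =
      cos a * cos b * cos g * cos d
      + (-(e 0 * e 1) * (sin a * sin b * cos g * cos d)
      + (-(e 0 * e 2) * (sin a * cos b * sin g * cos d)
      + (-(e 0 * e 3) * (sin a * cos b * cos g * sin d)
      + (-(e 1 * e 2) * (cos a * sin b * sin g * cos d)
      + (-(e 1 * e 3) * (cos a * sin b * cos g * sin d)
      + (-(e 2 * e 3) * (cos a * cos b * sin g * sin d)
      + (e 0 * e 1 * e 2 * e 3) * (sin a * sin b * sin g * sin d))))))) := by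
    intro a b g d
    simp only [Real.cos_add, Real.sin_add, cos_Sg _ _ (he _), sin_Sg _ _ (he _)]
    ring
  unfold Fe
  simp only [hcos, dsum_add, dsum_mul, mul_add, Finset.sum_add_distrib, mul_left_comm (w4 _),
    ← Finset.mul_sum]
  rw [Box_prod Y c c c c, Box_prod Y s s c c, Box_prod Y s c s c, Box_prod Y s c c s,
    Box_prod Y c s s c, Box_prod Y c s c s, Box_prod Y c c s s, Box_prod Y s s s s]
  simp only [hc, hs, hS, hS']
  ring

lemma fourth_power (Y : ℕ) (θ : ℕ → ℕ × ℕ → ℝ) :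
    (∑ n ∈ Icc 1 Y, ww n * ∑ p ∈ Nat.divisorsAntidiagonal n, Real.cos (θ n p))^4 =
    1/8 * (Fe Y ![1,1,1,1] θ + 3 * Fe Y ![1,1,1,-1] θ + 3 * Fe Y ![1,1,-1,-1] θ
      + Fe Y ![1,-1,-1,-1] θ) := by
  have hsg : ∀ a b c d : ℝ, Sg a → Sg b → Sg c → Sg d → ∀ i, Sg (![a,b,c,d] i) := by
    intro a b c d ha hb hc hd i
    fin_cases i <;> assumption
  have h1 : Sg 1 := Or.inl rfl
  have h2 : Sg (-1) := Or.inr rfl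
  rw [Fe_eq Y _ (hsg _ _ _ _ h1 h1 h1 h1) θ _ _ rfl rfl, Fe_eq Y _ (hsg _ _ _ _ h1 h1 h1 h2) θ _ _ rfl rfl,
    Fe_eq Y _ (hsg _ _ _ _ h1 h1 h2 h2) θ _ _ rfl rfl, Fe_eq Y _ (hsg _ _ _ _ h1 h2 h2 h2) θ _ _ rfl rfl]
  simp
  ring

/-- The phase function in `tau`. -/
def thet (M₁ M₂ ℓ₁ ℓ₂ : ℕ) (x : ℝ) (n : ℕ) (p : ℕ × ℕ) : ℝ :=
  4 * π * Real.sqrt (n * x) - 2 * π * phase M₁ M₂ ℓ₁ ℓ₂ p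

lemma Fe_thet (M₁ M₂ ℓ₁ ℓ₂ Y : ℕ) (e : Fin 4 → ℝ) (x : ℝ) :
    Fe Y e (thet M₁ M₂ ℓ₁ ℓ₂ x) = ∑ q ∈ Box Y, w4 q * dsum q (fun p₁ p₂ p₃ p₄ =>
      Real.cos (4 * π * √x * Del e q - 2 * π * Phi M₁ M₂ ℓ₁ ℓ₂ e p₁ p₂ p₃ p₄)) := by
  unfold Fe
  apply Finset.sum_congr rfl
  intro q _
  congr 2
  funext p₁ p₂ p₃ p₄
  congr 1
  simp only [thet, Phi, Del, Fin.sum_univ_four, vec]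
  rw [Real.sqrt_mul (by positivity), Real.sqrt_mul (by positivity), Real.sqrt_mul (by positivity),
    Real.sqrt_mul (by positivity)]
  simp
  ring

lemma int_dsum (a b : ℝ) (q : ℕ × ℕ × ℕ × ℕ) (f : ℕ × ℕ → ℕ × ℕ → ℕ × ℕ → ℕ × ℕ → ℝ → ℝ)
    (hf : ∀ p₁ p₂ p₃ p₄, Continuous (f p₁ p₂ p₃ p₄)) :
    ∫ x in a..b, dsum q (fun p₁ p₂ p₃ p₄ => f p₁ p₂ p₃ p₄ x) =
      dsum q (fun p₁ p₂ p₃ p₄ => ∫ x in a..b, f p₁ p₂ p₃ p₄ x) := by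
  unfold dsum
  rw [intervalIntegral.integral_finsetSum (fun p₁ _ => Continuous.intervalIntegrable (by fun_prop) _ _)]
  apply Finset.sum_congr rfl; intro p₁ _
  rw [intervalIntegral.integral_finsetSum (fun p₂ _ => Continuous.intervalIntegrable (by fun_prop) _ _)]
  apply Finset.sum_congr rfl; intro p₂ _
  rw [intervalIntegral.integral_finsetSum (fun p₃ _ => Continuous.intervalIntegrable (by fun_prop) _ _)]
  apply Finset.sum_congr rfl; intro p₃ _
  rw [intervalIntegral.integral_finsetSum (fun p₄ _ => Continuous.intervalIntegrable (by fun_prop) _ _)]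

lemma cont_dsum (q : ℕ × ℕ × ℕ × ℕ) (f : ℕ × ℕ → ℕ × ℕ → ℕ × ℕ → ℕ × ℕ → ℝ → ℝ)
    (hf : ∀ p₁ p₂ p₃ p₄, Continuous (f p₁ p₂ p₃ p₄)) :
    Continuous (fun x => dsum q (fun p₁ p₂ p₃ p₄ => f p₁ p₂ p₃ p₄ x)) := by
  unfold dsum
  fun_prop

lemma cont_Fe (M₁ M₂ ℓ₁ ℓ₂ Y : ℕ) (e : Fin 4 → ℝ) :
    Continuous (fun x : ℝ => x * Fe Y e (thet M₁ M₂ ℓ₁ ℓ₂ x)) := by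
  simp only [Fe_thet]
  apply continuous_id.mul
  apply continuous_finsetSum
  intro q _
  apply continuous_const.mul
  apply cont_dsum q (fun p₁ p₂ p₃ p₄ x => Real.cos (4 * π * √x * Del e q - 2 * π * Phi M₁ M₂ ℓ₁ ℓ₂ e p₁ p₂ p₃ p₄))
  intro p₁ p₂ p₃ p₄
  fun_prop

lemma int_Fe (M₁ M₂ ℓ₁ ℓ₂ Y : ℕ) (e : Fin 4 → ℝ) (a b : ℝ) :
    ∫ x in a..b, x * Fe Y e (thet M₁ M₂ ℓ₁ ℓ₂ x) = ∑ q ∈ Box Y, w4 q * dsum q (fun p₁ p₂ p₃ p₄ =>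
      ∫ x in a..b, x * Real.cos (4 * π * √x * Del e q - 2 * π * Phi M₁ M₂ ℓ₁ ℓ₂ e p₁ p₂ p₃ p₄)) := by
  have h1 : ∀ x : ℝ, x * Fe Y e (thet M₁ M₂ ℓ₁ ℓ₂ x) = ∑ q ∈ Box Y, w4 q * dsum q (fun p₁ p₂ p₃ p₄ =>
      x * Real.cos (4 * π * √x * Del e q - 2 * π * Phi M₁ M₂ ℓ₁ ℓ₂ e p₁ p₂ p₃ p₄)) := by
    intro x
    rw [Fe_thet, Finset.mul_sum]
    apply Finset.sum_congr rfl
    intro q _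
    rw [dsum_mul]; ring
  have hc : ∀ q p₁ p₂ p₃ p₄, Continuous (fun x : ℝ =>
      x * Real.cos (4 * π * √x * Del e q - 2 * π * Phi M₁ M₂ ℓ₁ ℓ₂ e p₁ p₂ p₃ p₄)) := by
    intro q p₁ p₂ p₃ p₄
    fun_prop
  simp only [h1]
  rw [intervalIntegral.integral_finsetSum]
  · apply Finset.sum_congr rfl
    intro q _
    rw [intervalIntegral.integral_const_mul, int_dsum a b q (fun p₁ p₂ p₃ p₄ x =>
      x * Real.cos (4 * π * √x * Del e q - 2 * π * Phi M₁ M₂ ℓ₁ ℓ₂ e p₁ p₂ p₃ p₄)) (hc q)]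
  · intro q _
    apply Continuous.intervalIntegrable
    apply continuous_const.mul
    exact cont_dsum q (fun p₁ p₂ p₃ p₄ x => x * Real.cos (4 * π * √x * Del e q - 2 * π * Phi M₁ M₂ ℓ₁ ℓ₂ e p₁ p₂ p₃ p₄)) (hc q)

theorem per_e (M₁ M₂ ℓ₁ ℓ₂ Y : ℕ) (D : ℝ) (hY : 1 ≤ Y) (hG : Good (2*Y) D) (e : Fin 4 → ℝ)
    (he : ∀ i, Sg (e i)) (T v : ℝ) (hT : 0 < T) (hv : 0 < v) (hvT : v^4 * √T = 1) (hTY : √T ≤ 2 * Y) :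
    |(∫ x in (T/2)..T, x * Fe Y e (thet M₁ M₂ ℓ₁ ℓ₂ x))
      - (∫ x in (T/2)..T, x) * ∑ q ∈ Box Y, zt M₁ M₂ ℓ₁ ℓ₂ e q| ≤
      10^21 * D^9 * T^2 * (v^4 * √(Y:ℝ) + v) := by
  have hss : √T * √T = T := Real.mul_self_sqrt hT.le
  have hsp : 0 < √T := Real.sqrt_pos.mpr hT
  set m : ℕ × ℕ × ℕ × ℕ → ℝ := fun q => min (T^2) (T * √T / |Del e q|) with hm
  have h := NZ_bound Y D hY hG e he v (T^2) hv (by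
    rw [div_le_iff₀ (by positivity)]
    have : 0 < v^4 := by positivity
    nlinarith) (by positivity) m (fun q => min_le_left _ _) (by
      intro q
      have e1 : T^2 * v^4 = T * √T := by
        have : T^2 = T * (√T * √T) := by rw [hss]; ring
        rw [this]
        linear_combination (T * √T) * hvT
      rw [e1]
      by_cases h0 : Del e q = 0
      · rw [h0]; simp; positivity
      · have hp : 0 < |Del e q| := abs_pos.mpr h0
        have : m q ≤ T * √T / |Del e q| := min_le_right _ _
        rwa [le_div_iff₀ hp] at this)
  refine le_trans ?_ h
  rw [int_Fe, Finset.mul_sum, ← Finset.sum_sub_distrib, Finset.sum_filter]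
  refine (Finset.abs_sum_le_sum_abs _ _).trans ?_
  apply Finset.sum_le_sum
  intro q hq
  have hpos : ∀ i, 1 ≤ vec q i := fun i => (mem_Box.mp hq i).1
  by_cases h0 : Del e q = 0
  · rw [if_neg (by simpa using h0)]
    have : (∀ i, 1 ≤ vec q i) ∧ Del e q = 0 := ⟨hpos, h0⟩
    unfold zt
    rw [if_pos this, h0]
    simp only [mul_zero, zero_sub, Real.cos_neg, intervalIntegral.integral_mul_const]
    rw [dsum_mul]
    apply le_of_eq
    rw [abs_eq_zero]
    ring
  · rw [if_pos h0]
    have : ¬ ((∀ i, 1 ≤ vec q i) ∧ Del e q = 0) := fun hh => h0 hh.2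
    unfold zt
    rw [if_neg this, mul_zero, sub_zero]
    apply dsum_abs
    intro p₁ p₂ p₃ p₄
    apply le_min
    · exact osc_trivial T _ _ hT
    · rw [le_div_iff₀ (abs_pos.mpr h0)]
      exact osc_bound T _ _ hT

lemma R0_pow (M₁ M₂ ℓ₁ ℓ₂ : ℕ) (y x : ℝ) (hx : 0 ≤ x) :
    (R0 M₁ M₂ ℓ₁ ℓ₂ y x)^4 = 1/(32*π^4) * (x * Fe ⌊y⌋₊ ![1,1,1,1] (thet M₁ M₂ ℓ₁ ℓ₂ x)
      + 3 * (x * Fe ⌊y⌋₊ ![1,1,1,-1] (thet M₁ M₂ ℓ₁ ℓ₂ x))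
      + 3 * (x * Fe ⌊y⌋₊ ![1,1,-1,-1] (thet M₁ M₂ ℓ₁ ℓ₂ x))
      + x * Fe ⌊y⌋₊ ![1,-1,-1,-1] (thet M₁ M₂ ℓ₁ ℓ₂ x)) := by
  have h := fourth_power ⌊y⌋₊ (thet M₁ M₂ ℓ₁ ℓ₂ x)
  have e1 : R0 M₁ M₂ ℓ₁ ℓ₂ y x = x ^ ((1:ℝ)/4) / (Real.sqrt 2 * π) *
      ∑ n ∈ Icc 1 ⌊y⌋₊, ww n * ∑ p ∈ Nat.divisorsAntidiagonal n, Real.cos (thet M₁ M₂ ℓ₁ ℓ₂ x n p) := by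
    unfold R0
    congr 1
    apply Finset.sum_congr rfl
    intro n _
    rw [mul_comm]
    rfl
  rw [e1, mul_pow, h]
  have e2 : (x ^ ((1:ℝ)/4))^4 = x := by
    rw [← Real.rpow_natCast, ← Real.rpow_mul hx]; norm_num
  have e3 : (√2 : ℝ)^4 = 4 := by
    have : (√2:ℝ)^4 = (√2^2)^2 := by ring
    rw [this, Real.sq_sqrt (by norm_num)]; norm_num
  rw [div_pow, e2, mul_pow, e3]
  have := Real.pi_pos
  field_simp
  ring

lemma zt_pos_zero (M₁ M₂ ℓ₁ ℓ₂ Y : ℕ) : ∑ q ∈ Box Y, zt M₁ M₂ ℓ₁ ℓ₂ ![1,1,1,1] q = 0 := by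
  apply Finset.sum_eq_zero
  intro q hq
  unfold zt
  rw [if_neg]
  rintro ⟨h1, h2⟩
  have h3 : (0:ℝ) < √(vec q 0 : ℝ) := Real.sqrt_pos.mpr (by exact_mod_cast h1 0)
  simp only [Del, Fin.sum_univ_four] at h2
  simp at h2
  have := Real.sqrt_nonneg (vec q 1 : ℝ)
  have := Real.sqrt_nonneg (vec q 2 : ℝ)
  have := Real.sqrt_nonneg (vec q 3 : ℝ)
  linarith

lemma final_arith (P X E R I₁ I₂ I₃ I₄ Z₂ Z₃ Z₄ S₂ S₃ S₄ : ℝ) (hP : 0 ≤ P) (hP1 : P ≤ 1) (hX : 0 ≤ X)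
    (h₁ : |I₁ - X * 0| ≤ E) (h₂ : |I₂ - X * Z₂| ≤ E) (h₃ : |I₃ - X * Z₃| ≤ E) (h₄ : |I₄ - X * Z₄| ≤ E)
    (s₂ : |S₂ - Z₂| ≤ R) (s₃ : |S₃ - Z₃| ≤ R) (s₄ : |S₄ - Z₄| ≤ R) :
    |P * (I₁ + 3 * I₂ + 3 * I₃ + I₄) - P * (3 * S₂ + 3 * S₃ + S₄) * X| ≤ 8 * E + 7 * (X * R) := by
  have e : P * (I₁ + 3 * I₂ + 3 * I₃ + I₄) - P * (3 * S₂ + 3 * S₃ + S₄) * X =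
    P * ((I₁ - X * 0) + 3 * (I₂ - X * Z₂) + 3 * (I₃ - X * Z₃) + (I₄ - X * Z₄)
      - 3 * (X * (S₂ - Z₂)) - 3 * (X * (S₃ - Z₃)) - X * (S₄ - Z₄)) := by ring
  have hx : ∀ z : ℝ, |z| ≤ R → |X * z| ≤ X * R := by
    intro z hz
    rw [abs_mul, abs_of_nonneg hX]
    gcongr
  have t₂ := hx _ s₂
  have t₃ := hx _ s₃
  have t₄ := hx _ s₄
  rw [e, abs_mul, abs_of_nonneg hP]
  set W := (I₁ - X * 0) + 3 * (I₂ - X * Z₂) + 3 * (I₃ - X * Z₃) + (I₄ - X * Z₄)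
      - 3 * (X * (S₂ - Z₂)) - 3 * (X * (S₃ - Z₃)) - X * (S₄ - Z₄) with hW
  have hb : |W| ≤ 8 * E + 7 * (X * R) := by
    rw [abs_le] at *
    constructor <;> linarith
  nlinarith [abs_nonneg W]

lemma int_comb (P a b : ℝ) (f g h k : ℝ → ℝ) (hf : Continuous f) (hg : Continuous g)
    (hh : Continuous h) (hk : Continuous k) :
    ∫ x in a..b, P * (f x + 3 * g x + 3 * h x + k x) =
      P * ((∫ x in a..b, f x) + 3 * (∫ x in a..b, g x) + 3 * (∫ x in a..b, h x) + ∫ x in a..b, k x) := by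
  rw [intervalIntegral.integral_const_mul,
    intervalIntegral.integral_add (Continuous.intervalIntegrable (by fun_prop) _ _)
      (Continuous.intervalIntegrable (by fun_prop) _ _),
    intervalIntegral.integral_add (Continuous.intervalIntegrable (by fun_prop) _ _)
      (Continuous.intervalIntegrable (by fun_prop) _ _),
    intervalIntegral.integral_add (Continuous.intervalIntegrable (by fun_prop) _ _)
      (Continuous.intervalIntegrable (by fun_prop) _ _),
    intervalIntegral.integral_const_mul, intervalIntegral.integral_const_mul]

theorem R0_fourth_moment_asymptotic
    (M₁ M₂ ℓ₁ ℓ₂ : ℕ) (hM₁ : 0 < M₁) (hM₂ : 0 < M₂)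
    (hℓ₁ : 1 ≤ ℓ₁) (hℓ₁' : ℓ₁ ≤ M₁) (hℓ₂ : 1 ≤ ℓ₂) (hℓ₂' : ℓ₂ ≤ M₂)
    (ε : ℝ) (hε : 0 < ε) :
    ∃ C > 0, ∀ T : ℝ, 10 ≤ T →
      |(∫ x in (T/2)..T, (R0 M₁ M₂ ℓ₁ ℓ₂ (T ^ ((3:ℝ)/4)) x) ^ 4)
          - 1 / (32 * π ^ 4) * C4 M₁ M₂ ℓ₁ ℓ₂ * ∫ x in (T/2)..T, x|
        ≤ C * T ^ (2 - 1/8 + ε) := by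
  obtain ⟨K, hK, hgood⟩ := exists_good (ε/9) (by positivity)
  obtain ⟨C, hC, htail⟩ := s4_tail
  refine ⟨8 * (10^21 * (K^9 * 2^ε) * 2) + 7 * (C * 2), by positivity, ?_⟩
  intro T hT
  have hT0 : 0 < T := by linarith
  have hT1 : 1 ≤ T := by linarith
  set Y := ⌊T ^ ((3:ℝ)/4)⌋₊ with hYdef
  have hy1 : 1 ≤ T ^ ((3:ℝ)/4) := Real.one_le_rpow hT1 (by norm_num)
  have hY : 1 ≤ Y := Nat.le_floor (by exact_mod_cast hy1)
  have hYr : (1:ℝ) ≤ Y := by exact_mod_cast hY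
  have hYle : (Y:ℝ) ≤ T ^ ((3:ℝ)/4) := Nat.floor_le (by positivity)
  have hYge : T ^ ((3:ℝ)/4) ≤ 2 * Y := by
    have := Nat.lt_floor_add_one (T ^ ((3:ℝ)/4))
    rw [← hYdef] at this
    linarith
  set v : ℝ := T ^ (-(1:ℝ)/8) with hvdef
  have hv : 0 < v := by positivity
  have hv4 : v^4 = T ^ (-(1:ℝ)/2) := by
    rw [hvdef, ← Real.rpow_natCast, ← Real.rpow_mul hT0.le]; norm_num
  have hsT : √T = T ^ ((1:ℝ)/2) := Real.sqrt_eq_rpow T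
  have hvT : v^4 * √T = 1 := by
    rw [hv4, hsT, ← Real.rpow_add hT0]; norm_num
  have hTY : √T ≤ 2 * Y := by
    refine le_trans ?_ hYge
    rw [hsT]
    exact Real.rpow_le_rpow_of_exponent_le hT1 (by norm_num)
  set D : ℝ := K * ((2*Y : ℕ):ℝ)^(ε/9) with hD
  have hG : Good (2*Y) D := hgood (2*Y) (by omega)
  have hsg : ∀ a b c d : ℝ, Sg a → Sg b → Sg c → Sg d → ∀ i, Sg (![a,b,c,d] i) := by
    intro a b c d ha hb hc hd i
    fin_cases i <;> assumption
  have g1 : Sg 1 := Or.inl rfl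
  have g2 : Sg (-1) := Or.inr rfl
  set E : ℝ := 10^21 * D^9 * T^2 * (v^4 * √(Y:ℝ) + v) with hE
  set R : ℝ := C * (Y:ℝ)^(-(1:ℝ)/6) with hR
  have hX : ∫ x in (T/2)..T, x = 3/8 * T^2 := by
    rw [integral_id]; ring
  set X := ∫ x in (T/2)..T, x with hXdef
  have p₁ := per_e M₁ M₂ ℓ₁ ℓ₂ Y D hY hG _ (hsg _ _ _ _ g1 g1 g1 g1) T v hT0 hv hvT hTY
  have p₂ := per_e M₁ M₂ ℓ₁ ℓ₂ Y D hY hG _ (hsg _ _ _ _ g1 g1 g1 g2) T v hT0 hv hvT hTY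
  have p₃ := per_e M₁ M₂ ℓ₁ ℓ₂ Y D hY hG _ (hsg _ _ _ _ g1 g1 g2 g2) T v hT0 hv hvT hTY
  have p₄ := per_e M₁ M₂ ℓ₁ ℓ₂ Y D hY hG _ (hsg _ _ _ _ g1 g2 g2 g2) T v hT0 hv hvT hTY
  rw [zt_pos_zero] at p₁
  have t₂ := htail M₁ M₂ ℓ₁ ℓ₂ _ (hsg _ _ _ _ g1 g1 g1 g2) Y hY
  have t₃ := htail M₁ M₂ ℓ₁ ℓ₂ _ (hsg _ _ _ _ g1 g1 g2 g2) Y hY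
  have t₄ := htail M₁ M₂ ℓ₁ ℓ₂ _ (hsg _ _ _ _ g1 g2 g2 g2) Y hY
  have hIntg : (∫ x in (T/2)..T, (R0 M₁ M₂ ℓ₁ ℓ₂ (T ^ ((3:ℝ)/4)) x) ^ 4) =
      1/(32*π^4) * ((∫ x in (T/2)..T, x * Fe Y ![1,1,1,1] (thet M₁ M₂ ℓ₁ ℓ₂ x))
      + 3 * (∫ x in (T/2)..T, x * Fe Y ![1,1,1,-1] (thet M₁ M₂ ℓ₁ ℓ₂ x))
      + 3 * (∫ x in (T/2)..T, x * Fe Y ![1,1,-1,-1] (thet M₁ M₂ ℓ₁ ℓ₂ x))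
      + (∫ x in (T/2)..T, x * Fe Y ![1,-1,-1,-1] (thet M₁ M₂ ℓ₁ ℓ₂ x))) := by
    have c := fun e => cont_Fe M₁ M₂ ℓ₁ ℓ₂ Y e
    rw [← int_comb _ _ _ _ _ _ _ (c _) (c _) (c _) (c _)]
    apply intervalIntegral.integral_congr
    intro x hx
    rw [Set.uIcc_of_le (by linarith)] at hx
    exact R0_pow M₁ M₂ ℓ₁ ℓ₂ _ x (by linarith [hx.1])
  have hpi := Real.pi_gt_three
  have hP1 : 1/(32*π^4) ≤ 1 := by
    rw [div_le_one (by positivity)]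
    have : 1 ≤ π^4 := one_le_pow₀ (by linarith)
    linarith
  have hfin := final_arith (1/(32*π^4)) X E R _ _ _ _ _ _ _ _ _ _ (by positivity) hP1
    (by rw [hX]; positivity) p₁ p₂ p₃ p₄ t₂ t₃ t₄
  rw [hIntg]
  unfold C4
  rw [s4_eq, s4_eq, s4_eq]
  refine hfin.trans ?_
  have hTε : (0:ℝ) < T ^ (2 - 1/8 + ε) := by positivity
  have bE : E ≤ 10^21 * (K^9 * 2^ε) * 2 * T ^ (2 - 1/8 + ε) := by
    have d1 : D^9 ≤ K^9 * 2^ε * T^ε := by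
      have e1 : (((2*Y : ℕ):ℝ)^(ε/9))^9 = ((2*Y : ℕ):ℝ)^ε := by
        rw [← Real.rpow_natCast, ← Real.rpow_mul (by positivity)]
        congr 1; push_cast; ring
      rw [hD, mul_pow, e1, mul_assoc, ← Real.mul_rpow (by norm_num) hT0.le]
      have h2 : ((2*Y : ℕ):ℝ) ≤ 2 * T := by
        push_cast
        have : T ^ ((3:ℝ)/4) ≤ T ^ (1:ℝ) := Real.rpow_le_rpow_of_exponent_le hT1 (by norm_num)
        rw [Real.rpow_one] at this
        linarith
      gcongr
    have d2 : v^4 * √(Y:ℝ) + v ≤ 2 * v := by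
      have : √(Y:ℝ) ≤ T ^ ((3:ℝ)/8) := by
        rw [Real.sqrt_le_left (by positivity), ← Real.rpow_natCast, ← Real.rpow_mul hT0.le]
        refine hYle.trans (le_of_eq ?_)
        congr 1; norm_num
      have h2 : v^4 * √(Y:ℝ) ≤ v := by
        calc v^4 * √(Y:ℝ) ≤ v^4 * T ^ ((3:ℝ)/8) := by gcongr
          _ = v := by rw [hv4, hvdef, ← Real.rpow_add hT0]; norm_num
      linarith
    have e3 : T ^ (2 - 1/8 + ε) = T^ε * T^2 * v := by
      rw [hvdef, ← Real.rpow_natCast T 2, ← Real.rpow_add hT0, ← Real.rpow_add hT0]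
      congr 1; push_cast; ring
    rw [e3]
    calc E ≤ 10^21 * (K^9 * 2^ε * T^ε) * T^2 * (2 * v) := by
          rw [hE]; gcongr
      _ = _ := by ring
  have bR : X * R ≤ C * 2 * T ^ (2 - 1/8 + ε) := by
    have e1 : (Y:ℝ)^(-(1:ℝ)/6) ≤ 2 * T ^ (-(1:ℝ)/8) := by
      have h1 : (Y:ℝ)^(-(1:ℝ)/6) ≤ (T ^ ((3:ℝ)/4) / 2)^(-(1:ℝ)/6) :=
        Real.rpow_le_rpow_of_nonpos (by positivity) (by linarith) (by norm_num)
      refine h1.trans ?_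
      rw [Real.div_rpow (by positivity) (by norm_num), ← Real.rpow_mul hT0.le, div_eq_mul_inv,
        ← Real.rpow_neg (by norm_num)]
      have h2 : (2:ℝ)^(-(-(1:ℝ)/6)) ≤ 2^(1:ℝ) :=
        Real.rpow_le_rpow_of_exponent_le (by norm_num) (by norm_num)
      rw [Real.rpow_one] at h2
      have h3 : T ^ ((3:ℝ)/4 * (-1/6)) = T ^ (-(1:ℝ)/8) := by norm_num
      rw [h3, mul_comm]
      gcongr
    have e2 : T^2 * T ^ (-(1:ℝ)/8) ≤ T ^ (2 - 1/8 + ε) := by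
      rw [← Real.rpow_natCast T 2, ← Real.rpow_add hT0]
      apply Real.rpow_le_rpow_of_exponent_le hT1
      push_cast
      linarith
    rw [hX, hR]
    calc 3/8 * T^2 * (C * (Y:ℝ)^(-(1:ℝ)/6)) ≤ 1 * T^2 * (C * (2 * T ^ (-(1:ℝ)/8))) := by
          gcongr; norm_num
      _ = C * 2 * (T^2 * T ^ (-(1:ℝ)/8)) := by ring
      _ ≤ _ := by gcongr
  calc 8 * E + 7 * (X * R) ≤ 8 * (10^21 * (K^9 * 2^ε) * 2 * T ^ (2 - 1/8 + ε)) + 7 * (C * 2 * T ^ (2 - 1/8 + ε)) := by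
        gcongr
    _ = _ := by ring
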